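/- arXiv:1512.02490 — 2 statements merged into one kernel-verified Lean document; each statement's English description precedes it below -/
import Mathlib

section
/- Let H be a finite-dimensional complex Hilbert space and α ∈ (0,1)∪(1,∞). If φ: S(H) → S(H) is a map (not assumed bijective) satisfying D_α(φ(A)‖φ(B)) = D_α(A‖B) for all A, B ∈ S(H), then there exists a unitary operator U on H such that either φ(A) = U A U* for all A ∈ S(H), or φ(A) = U Aᵀ U* for all A ∈ S(H) (where Aᵀ denotes the transpose with respect to a fixed orthonormal basis; the second case corresponds to an antiunitary similarity). -/
open Matrix
open scoped ComplexOrder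

/-- Apply a real function to (the eigenvalues of) a Hermitian matrix via the
spectral decomposition (functional calculus); junk value `0` otherwise. -/
noncomputable def matFun {n : ℕ} (h : ℝ → ℝ) (A : Matrix (Fin n) (Fin n) ℂ) :
    Matrix (Fin n) (Fin n) ℂ :=
  if hA : A.IsHermitian then hA.cfc h else 0

/-- The (real part of the) trace of a complex matrix. -/
noncomputable def retr {n : ℕ} (M : Matrix (Fin n) (Fin n) ℂ) : ℝ := M.trace.re

/-- Real power of a positive semidefinite matrix via the spectral decomposition. -/
noncomputable def rpowMat {n : ℕ} (A : Matrix (Fin n) (Fin n) ℂ) (r : ℝ) :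
    Matrix (Fin n) (Fin n) ℂ := matFun (fun t => t ^ r) A

/-- Density operators: positive semidefinite matrices of trace `1`. -/
def Density (n : ℕ) := {A : Matrix (Fin n) (Fin n) ℂ // A.PosSemidef ∧ A.trace = 1}

/-- `supp A ⊆ supp B`, i.e. the range of `A` is contained in the range of `B`. -/
def suppLE {n : ℕ} (A B : Matrix (Fin n) (Fin n) ℂ) : Prop :=
  LinearMap.range (Matrix.toLin' A) ≤ LinearMap.range (Matrix.toLin' B)

/-- `supp A ⟂ supp B`: the ranges of `A` and `B` are orthogonal. -/
def suppOrth {n : ℕ} (A B : Matrix (Fin n) (Fin n) ℂ) : Prop :=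
  ∀ x y : Fin n → ℂ, star (A.mulVec x) ⬝ᵥ B.mulVec y = 0

/-- The extension `f₀` of `f : (0,∞) → (0,∞)` to `[0,∞)` with `f₀ 0 = 0`. -/
noncomputable def extZero (f : ℝ → ℝ) : ℝ → ℝ := fun t => if 0 < t then f t else 0

/-- The generalized divergence `D'_{f,g}(A‖B) = tr g(f₀(B) A f₀(B))` (real-valued version,
used when `lim_{ε→0⁺} f(ε) = 0`). -/
noncomputable def Dfg {n : ℕ} (f g : ℝ → ℝ) (A B : Matrix (Fin n) (Fin n) ℂ) : ℝ :=
  retr (matFun g (matFun (extZero f) B * A * matFun (extZero f) B))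

open scoped Classical in
/-- The generalized divergence `D'_{f,g}(A‖B)`: equal to `tr g(f₀(B) A f₀(B))` if
`supp A ⊆ supp B` and `∞` otherwise (used when `lim_{ε→0⁺} f(ε) = ∞`). -/
noncomputable def DfgE {n : ℕ} (f g : ℝ → ℝ) (A B : Matrix (Fin n) (Fin n) ℂ) : EReal :=
  if suppLE A B then ((Dfg f g A B : ℝ) : EReal) else ⊤

open scoped Classical in
/-- The quantum Rényi divergence `D_α(A‖B)` of density operators `A, B`
(with the convention `tr A = 1`), with values in the extended reals. -/
noncomputable def Dalpha {n : ℕ} (α : ℝ) (A B : Matrix (Fin n) (Fin n) ℂ) : EReal :=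
  if (α < 1 ∧ ¬ suppOrth A B) ∨ (1 < α ∧ suppLE A B) then
    (((α - 1)⁻¹ * Real.log (retr (rpowMat
      (rpowMat B ((1 - α) / (2 * α)) * A * rpowMat B ((1 - α) / (2 * α))) α)) : ℝ) : EReal)
  else ⊤

/-- The quantum Rényi divergence on the cone of positive definite matrices
(a finite real number there). -/
noncomputable def DalphaPD {n : ℕ} (α : ℝ) (A B : Matrix (Fin n) (Fin n) ℂ) : ℝ :=
  (α - 1)⁻¹ * Real.log ((retr A)⁻¹ * retr (rpowMat
    (rpowMat B ((1 - α) / (2 * α)) * A * rpowMat B ((1 - α) / (2 * α))) α))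

/-- Rank-one (orthogonal) projections: `P = x ⊗ x` for a unit vector `x`. -/
def IsRankOneProj {n : ℕ} (P : Matrix (Fin n) (Fin n) ℂ) : Prop :=
  ∃ x : Fin n → ℂ, star x ⬝ᵥ x = 1 ∧ P = Matrix.vecMulVec x (star x)


section

variable {n : ℕ}

/-- The (unnormalised) rank-one projection onto the line spanned by `x`. -/
def prj (x : Fin n → ℂ) : Matrix (Fin n) (Fin n) ℂ := vecMulVec x (star x)

/-- The family `u` is an orthonormal basis of `ℂⁿ`. -/
def IsONB (u : Fin n → Fin n → ℂ) : Prop :=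
  ∀ i j, star (u i) ⬝ᵥ u j = if i = j then 1 else 0

/-- The Hermitian matrix with eigenbasis `u` and eigenvalues `a`. -/
noncomputable def specSum (u : Fin n → Fin n → ℂ) (a : Fin n → ℝ) : Matrix (Fin n) (Fin n) ℂ :=
  ∑ i, (a i : ℂ) • prj (u i)

lemma prj_mulVec (x y : Fin n → ℂ) : prj x *ᵥ y = (star x ⬝ᵥ y) • x := by
  simp [prj, vecMulVec_mulVec]

lemma prj_mul_prj (x y : Fin n → ℂ) :
    prj x * prj y = (star x ⬝ᵥ y) • vecMulVec x (star y) := by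
  simp [prj, vecMulVec_mul_vecMulVec, vecMulVec_smul]

lemma trace_mul_prj (A : Matrix (Fin n) (Fin n) ℂ) (x : Fin n → ℂ) :
    (A * prj x).trace = star x ⬝ᵥ A *ᵥ x := by
  rw [prj, mul_vecMulVec, trace_vecMulVec, dotProduct_comm]

lemma trace_prj (x : Fin n → ℂ) : (prj x).trace = star x ⬝ᵥ x := by
  rw [prj, trace_vecMulVec, dotProduct_comm]

lemma trace_prj_mul_prj (x y : Fin n → ℂ) :
    (prj x * prj y).trace = (star x ⬝ᵥ y) * star (star x ⬝ᵥ y) := by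
  rw [trace_mul_prj, prj_mulVec, dotProduct_smul, smul_eq_mul, mul_comm, mul_comm (star x ⬝ᵥ y),
    ← star_dotProduct, mul_comm]

lemma prj_smul (c : ℂ) (x : Fin n → ℂ) : prj (c • x) = (c * star c) • prj x := by
  ext i j
  simp [prj, vecMulVec_apply]
  ring

lemma posSemidef_prj (x : Fin n → ℂ) : (prj x).PosSemidef :=
  posSemidef_vecMulVec_self_star x

lemma IsONB.prj_mul_prj {u : Fin n → Fin n → ℂ} (hu : IsONB u) (i j : Fin n) :
    prj (u i) * prj (u j) = if i = j then prj (u i) else 0 := by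
  rw [_root_.prj_mul_prj, hu i j]
  split_ifs with h
  · subst h; simp [prj]
  · simp

/-- The matrix whose columns are the vectors of `u`. -/
def colMat (u : Fin n → Fin n → ℂ) : Matrix (Fin n) (Fin n) ℂ := Matrix.of fun r c => u c r

lemma IsONB.colMat_mem {u : Fin n → Fin n → ℂ} (hu : IsONB u) :
    colMat u ∈ Matrix.unitaryGroup (Fin n) ℂ := by
  rw [Matrix.mem_unitaryGroup_iff']
  ext i j
  have := hu i j
  simpa [Matrix.mul_apply, colMat, dotProduct, star_apply, Matrix.one_apply] using this

lemma IsONB.sum_prj {u : Fin n → Fin n → ℂ} (hu : IsONB u) : ∑ i, prj (u i) = 1 := by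
  have h := (Matrix.mem_unitaryGroup_iff).1 hu.colMat_mem
  rw [← h]
  ext r c
  simp [Matrix.sum_apply, Matrix.mul_apply, colMat, prj, vecMulVec_apply, star_apply]

lemma IsONB.specSum_one {u : Fin n → Fin n → ℂ} (hu : IsONB u) :
    specSum u (fun _ => 1) = 1 := by
  simp [specSum, hu.sum_prj]

lemma IsONB.specSum_mul {u : Fin n → Fin n → ℂ} (hu : IsONB u) (a b : Fin n → ℝ) :
    specSum u a * specSum u b = specSum u (fun i => a i * b i) := by
  simp [specSum, Finset.sum_mul_sum, hu.prj_mul_prj, smul_smul, mul_comm, -Complex.coe_smul]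

lemma IsONB.specSum_mul_prj {u : Fin n → Fin n → ℂ} (hu : IsONB u) (a : Fin n → ℝ) (j : Fin n) :
    specSum u a * prj (u j) = (a j : ℂ) • prj (u j) := by
  simp [specSum, Finset.sum_mul, hu.prj_mul_prj]

lemma IsONB.prj_mul_specSum {u : Fin n → Fin n → ℂ} (hu : IsONB u) (a : Fin n → ℝ) (j : Fin n) :
    prj (u j) * specSum u a = (a j : ℂ) • prj (u j) := by
  simp [specSum, Finset.mul_sum, hu.prj_mul_prj]

lemma IsONB.trace_specSum {u : Fin n → Fin n → ℂ} (hu : IsONB u) (a : Fin n → ℝ) :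
    (specSum u a).trace = ((∑ i, a i : ℝ) : ℂ) := by
  simp [specSum, Matrix.trace_sum, trace_prj, hu _ _]

lemma isHermitian_specSum (u : Fin n → Fin n → ℂ) (a : Fin n → ℝ) :
    (specSum u a).IsHermitian := by
  unfold Matrix.IsHermitian specSum
  rw [conjTranspose_sum]
  refine Finset.sum_congr rfl fun i _ => ?_
  rw [conjTranspose_smul, (posSemidef_prj (u i)).isHermitian]
  simp

lemma posSemidef_specSum (u : Fin n → Fin n → ℂ) {a : Fin n → ℝ} (ha : ∀ i, 0 ≤ a i) :
    (specSum u a).PosSemidef := by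
  refine posSemidef_sum _ fun i _ => (posSemidef_prj (u i)).smul ?_
  exact_mod_cast ha i

/-- Spectral decomposition, together with the corresponding description of `matFun`. -/
lemma exists_specSum {A : Matrix (Fin n) (Fin n) ℂ} (hA : A.IsHermitian) :
    ∃ u, IsONB u ∧ A = specSum u hA.eigenvalues ∧
      ∀ h : ℝ → ℝ, matFun h A = specSum u (fun i => h (hA.eigenvalues i)) := by
  have key : ∀ d : Fin n → ℝ, (hA.eigenvectorUnitary : Matrix (Fin n) (Fin n) ℂ) *
      diagonal (fun i => (d i : ℂ)) * star (hA.eigenvectorUnitary : Matrix (Fin n) (Fin n) ℂ) =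
      specSum (fun j i => (hA.eigenvectorUnitary : Matrix (Fin n) (Fin n) ℂ) i j) d := by
    intro d
    ext r c
    rw [Matrix.mul_apply]
    simp only [Matrix.mul_diagonal, specSum, prj, Matrix.sum_apply,
      Matrix.smul_apply, vecMulVec_apply, star_apply, smul_eq_mul, Pi.star_apply]
    refine Finset.sum_congr rfl fun i _ => ?_
    ring
  refine ⟨fun j i => (hA.eigenvectorUnitary : Matrix (Fin n) (Fin n) ℂ) i j, ?_, ?_, ?_⟩
  · intro i j
    have h := (Matrix.mem_unitaryGroup_iff').1 hA.eigenvectorUnitary.2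
    have := congrFun (congrFun h i) j
    simpa [Matrix.mul_apply, dotProduct, star_apply, Matrix.one_apply] using this
  · conv_lhs => rw [hA.spectral_theorem, Unitary.conjStarAlgAut_apply]
    exact key _
  · intro h
    rw [matFun, dif_pos hA, Matrix.IsHermitian.cfc, Unitary.conjStarAlgAut_apply]
    exact key _

lemma matFun_specSum {u : Fin n → Fin n → ℂ} (hu : IsONB u) (a : Fin n → ℝ) (h : ℝ → ℝ) :
    matFun h (specSum u a) = specSum u (fun i => h (a i)) := by
  obtain ⟨w, hw, hA, hf⟩ := exists_specSum (isHermitian_specSum u a)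
  set l := (isHermitian_specSum u a).eigenvalues
  have key : ∀ i j, (h (l i) : ℂ) • (prj (w i) * prj (u j)) =
      (h (a j) : ℂ) • (prj (w i) * prj (u j)) := by
    intro i j
    have h1 : (l i : ℂ) • (prj (w i) * prj (u j)) = (a j : ℂ) • (prj (w i) * prj (u j)) := by
      rw [← smul_mul_assoc, ← hw.prj_mul_specSum, ← hA, mul_assoc, hu.specSum_mul_prj,
        mul_smul_comm]
    by_cases hij : l i = a j
    · rw [hij]
    · have : prj (w i) * prj (u j) = 0 := by
        rw [← sub_eq_zero, ← sub_smul] at h1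
        refine (smul_eq_zero.1 h1).resolve_left ?_
        exact_mod_cast sub_ne_zero.2 hij
      simp [this]
  rw [hf h]
  calc specSum w (fun i => h (l i)) = specSum w (fun i => h (l i)) * ∑ j, prj (u j) := by
        rw [hu.sum_prj, mul_one]
    _ = ∑ i, ∑ j, (h (l i) : ℂ) • (prj (w i) * prj (u j)) := by
        simp [specSum, Finset.sum_mul_sum]
    _ = ∑ i, ∑ j, (h (a j) : ℂ) • (prj (w i) * prj (u j)) := by simp_rw [key]
    _ = (∑ i, prj (w i)) * specSum u (fun i => h (a i)) := by
        simp [specSum, Finset.sum_mul_sum]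
    _ = _ := by rw [hw.sum_prj, one_mul]

lemma isHermitian_matFun (h : ℝ → ℝ) (A : Matrix (Fin n) (Fin n) ℂ) :
    (matFun h A).IsHermitian := by
  by_cases hA : A.IsHermitian
  · obtain ⟨u, -, -, hf⟩ := exists_specSum hA
    rw [hf]
    exact isHermitian_specSum _ _
  · rw [matFun, dif_neg hA]
    exact isHermitian_zero

lemma matFun_mul {A : Matrix (Fin n) (Fin n) ℂ} (hA : A.IsHermitian) (f g : ℝ → ℝ) :
    matFun f A * matFun g A = matFun (fun t => f t * g t) A := by
  obtain ⟨u, hu, -, hf⟩ := exists_specSum hA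
  rw [hf, hf, hf, hu.specSum_mul]

lemma matFun_add {A : Matrix (Fin n) (Fin n) ℂ} (hA : A.IsHermitian) (f g : ℝ → ℝ) :
    matFun f A + matFun g A = matFun (fun t => f t + g t) A := by
  obtain ⟨u, hu, -, hf⟩ := exists_specSum hA
  rw [hf, hf, hf]
  simp [specSum, add_smul, Finset.sum_add_distrib]

lemma matFun_id {A : Matrix (Fin n) (Fin n) ℂ} (hA : A.IsHermitian) :
    matFun (fun t => t) A = A := by
  obtain ⟨u, hu, h, hf⟩ := exists_specSum hA
  rw [hf]
  exact h.symm

lemma matFun_one {A : Matrix (Fin n) (Fin n) ℂ} (hA : A.IsHermitian) :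
    matFun (fun _ => 1) A = 1 := by
  obtain ⟨u, hu, h, hf⟩ := exists_specSum hA
  rw [hf, hu.specSum_one]

lemma matFun_matFun {A : Matrix (Fin n) (Fin n) ℂ} (hA : A.IsHermitian) (f g : ℝ → ℝ) :
    matFun g (matFun f A) = matFun (fun t => g (f t)) A := by
  obtain ⟨u, hu, -, hf⟩ := exists_specSum hA
  rw [hf, hf, matFun_specSum hu]

lemma matFun_congr {A : Matrix (Fin n) (Fin n) ℂ} (hA : A.PosSemidef) {f g : ℝ → ℝ}
    (h : ∀ t, 0 ≤ t → f t = g t) : matFun f A = matFun g A := by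
  obtain ⟨u, hu, -, hf⟩ := exists_specSum hA.isHermitian
  rw [hf, hf]
  simp [h _ (hA.eigenvalues_nonneg _)]

lemma posSemidef_matFun {A : Matrix (Fin n) (Fin n) ℂ} (hA : A.PosSemidef) {f : ℝ → ℝ}
    (h : ∀ t, 0 ≤ t → 0 ≤ f t) : (matFun f A).PosSemidef := by
  obtain ⟨u, hu, -, hf⟩ := exists_specSum hA.isHermitian
  rw [hf]
  exact posSemidef_specSum _ fun i => h _ (hA.eigenvalues_nonneg _)

lemma posSemidef_rpowMat {A : Matrix (Fin n) (Fin n) ℂ} (hA : A.PosSemidef) (r : ℝ) :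
    (rpowMat A r).PosSemidef :=
  posSemidef_matFun hA fun _ ht => Real.rpow_nonneg ht r

lemma rpowMat_mul_self {A : Matrix (Fin n) (Fin n) ℂ} (hA : A.PosSemidef) {r : ℝ} (hr : r ≠ 0) :
    rpowMat A r * rpowMat A r = rpowMat A (2 * r) := by
  rw [rpowMat, rpowMat, matFun_mul hA.isHermitian]
  refine matFun_congr hA fun t ht => ?_
  rcases ht.eq_or_lt with rfl | ht
  · simp [Real.zero_rpow, hr]
  · rw [← Real.rpow_add ht, two_mul]

lemma rpowMat_rpowMat {A : Matrix (Fin n) (Fin n) ℂ} (hA : A.PosSemidef) {r : ℝ} (hr : r ≠ 0) :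
    rpowMat (rpowMat A r) r⁻¹ = A := by
  rw [rpowMat, rpowMat, matFun_matFun hA.isHermitian]
  conv_rhs => rw [← matFun_id hA.isHermitian]
  exact matFun_congr hA fun t ht => Real.rpow_rpow_inv ht hr

lemma IsONB.ofUnit {x : Fin n → ℂ} (hx : star x ⬝ᵥ x = 1) (k : Fin n) :
    ∃ u, IsONB u ∧ u k = x := by
  have hx' : inner ℂ (WithLp.toLp 2 x) (WithLp.toLp 2 x) = (1 : ℂ) := by
    rw [EuclideanSpace.inner_toLp_toLp, dotProduct_comm, hx]
  obtain ⟨b, hb⟩ := Orthonormal.exists_orthonormalBasis_extension_of_card_eq (𝕜 := ℂ)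
    (E := EuclideanSpace ℂ (Fin n)) (ι := Fin n) (by simp)
    (v := fun _ => WithLp.toLp 2 x) (s := {k}) (by
      rw [orthonormal_iff_ite]
      rintro ⟨i, rfl⟩ ⟨j, rfl⟩
      simpa using hx')
  refine ⟨fun i => (b i).ofLp, fun i j => ?_, ?_⟩
  · have := orthonormal_iff_ite.1 b.orthonormal i j
    rw [← this, dotProduct_comm]
    rfl
  · simp only [hb k rfl]

lemma span_prj : Submodule.span ℂ
    (Set.range fun x : {x : Fin n → ℂ // star x ⬝ᵥ x = 1} => prj x.1) = ⊤ := by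
  rw [eq_top_iff]
  have herm : ∀ A : Matrix (Fin n) (Fin n) ℂ, A.IsHermitian → A ∈ Submodule.span ℂ
    (Set.range fun x : {x : Fin n → ℂ // star x ⬝ᵥ x = 1} => prj x.1) := by
    intro A hA
    obtain ⟨u, hu, h, -⟩ := exists_specSum hA
    rw [h]
    refine Submodule.sum_mem _ fun i _ => Submodule.smul_mem _ _ (Submodule.subset_span ?_)
    exact ⟨⟨u i, by simp [hu i i]⟩, rfl⟩
  intro X _
  rw [← realPart_add_I_smul_imaginaryPart X]
  exact Submodule.add_mem _ (herm _ (realPart X).2)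
    (Submodule.smul_mem _ _ (herm _ (imaginaryPart X).2))

lemma eq_of_trace_mul_prj {X Y : Matrix (Fin n) (Fin n) ℂ}
    (h : ∀ x : Fin n → ℂ, star x ⬝ᵥ x = 1 → (X * prj x).trace = (Y * prj x).trace) : X = Y := by
  refine Matrix.ext_iff_trace_mul_right.2 fun Z => ?_
  have hZ : Z ∈ Submodule.span ℂ
    (Set.range fun x : {x : Fin n → ℂ // star x ⬝ᵥ x = 1} => prj x.1) := by simp [span_prj]
  induction hZ using Submodule.span_induction with
  | mem Z hZ => obtain ⟨x, rfl⟩ := hZ; exact h x.1 x.2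
  | zero => simp
  | add a b _ _ ha hb => rw [mul_add, mul_add, trace_add, trace_add, ha, hb]
  | smul c a _ ha => rw [mul_smul_comm, mul_smul_comm, trace_smul, trace_smul, ha]

lemma eq_zero_of_trace_mul_span {κ : Type*} {b : κ → Matrix (Fin n) (Fin n) ℂ}
    (hb : Submodule.span ℂ (Set.range b) = ⊤) {X : Matrix (Fin n) (Fin n) ℂ}
    (h : ∀ j, (X * b j).trace = 0) : X = 0 := by
  refine Matrix.ext_iff_trace_mul_right.2 fun Z => ?_
  have hZ : Z ∈ Submodule.span ℂ (Set.range b) := by simp [hb]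
  induction hZ using Submodule.span_induction with
  | mem Z hZ => obtain ⟨j, rfl⟩ := hZ; simp [h j]
  | zero => simp
  | add a b _ _ ha hb => rw [mul_add, mul_add, trace_add, trace_add, ha, hb]
  | smul c a _ ha => rw [mul_smul_comm, mul_smul_comm, trace_smul, trace_smul, ha]

lemma trace_linearCombination_mul {ι κ : Type*} {a a' : ι → Matrix (Fin n) (Fin n) ℂ}
    {b b' : κ → Matrix (Fin n) (Fin n) ℂ}
    (h : ∀ i j, (a' i * b' j).trace = (a i * b j).trace) (c : ι →₀ ℂ) (j : κ) :
    (Finsupp.linearCombination ℂ a' c * b' j).trace =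
      (Finsupp.linearCombination ℂ a c * b j).trace := by
  simp only [Finsupp.linearCombination_apply, Finsupp.sum, Finset.sum_mul, Matrix.trace_sum,
    smul_mul_assoc, trace_smul, h]

lemma span_eq_top_of_trace {ι κ : Type*} {a a' : ι → Matrix (Fin n) (Fin n) ℂ}
    {b b' : κ → Matrix (Fin n) (Fin n) ℂ}
    (ha : Submodule.span ℂ (Set.range a) = ⊤) (hb : Submodule.span ℂ (Set.range b) = ⊤)
    (h : ∀ i j, (a' i * b' j).trace = (a i * b j).trace) :
    Submodule.span ℂ (Set.range a') = ⊤ := by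
  obtain ⟨g, hg⟩ := LinearMap.exists_rightInverse_of_surjective
    (Finsupp.linearCombination ℂ a) (by rw [Finsupp.range_linearCombination, ha])
  have hg' : ∀ X, Finsupp.linearCombination ℂ a (g X) = X := fun X => LinearMap.congr_fun hg X
  have hinj : Function.Injective ((Finsupp.linearCombination ℂ a').comp g) := by
    rw [← LinearMap.ker_eq_bot, LinearMap.ker_eq_bot']
    intro X hX
    refine eq_zero_of_trace_mul_span hb fun j => ?_
    rw [← hg' X, ← trace_linearCombination_mul h]
    rw [LinearMap.comp_apply] at hX
    simp [hX]
  have hsurj := LinearMap.injective_iff_surjective.1 hinj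
  rw [eq_top_iff, ← Finsupp.range_linearCombination]
  intro X _
  obtain ⟨Y, rfl⟩ := hsurj X
  exact ⟨_, rfl⟩

lemma exists_linearMap_of_trace {ι κ : Type*} {a a' : ι → Matrix (Fin n) (Fin n) ℂ}
    {b b' : κ → Matrix (Fin n) (Fin n) ℂ}
    (ha : Submodule.span ℂ (Set.range a) = ⊤) (hb' : Submodule.span ℂ (Set.range b') = ⊤)
    (h : ∀ i j, (a' i * b' j).trace = (a i * b j).trace) :
    ∃ M : Matrix (Fin n) (Fin n) ℂ →ₗ[ℂ] Matrix (Fin n) (Fin n) ℂ, ∀ i, M (a i) = a' i := by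
  obtain ⟨g, hg⟩ := LinearMap.exists_rightInverse_of_surjective
    (Finsupp.linearCombination ℂ a) (by rw [Finsupp.range_linearCombination, ha])
  have hg' : ∀ X, Finsupp.linearCombination ℂ a (g X) = X := fun X => LinearMap.congr_fun hg X
  refine ⟨(Finsupp.linearCombination ℂ a').comp g, fun i => ?_⟩
  rw [← sub_eq_zero]
  refine eq_zero_of_trace_mul_span hb' fun j => ?_
  rw [sub_mul, trace_sub, LinearMap.comp_apply, trace_linearCombination_mul h, hg', h, sub_self]

/-- Two spanning families of matrices whose trace pairing is preserved are related by a pair of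
mutually contragredient linear maps. -/
lemma exists_linearMap_pair {ι κ : Type*} {a a' : ι → Matrix (Fin n) (Fin n) ℂ}
    {b b' : κ → Matrix (Fin n) (Fin n) ℂ}
    (ha : Submodule.span ℂ (Set.range a) = ⊤) (hb : Submodule.span ℂ (Set.range b) = ⊤)
    (h : ∀ i j, (a' i * b' j).trace = (a i * b j).trace) :
    ∃ M L : Matrix (Fin n) (Fin n) ℂ →ₗ[ℂ] Matrix (Fin n) (Fin n) ℂ,
      (∀ i, M (a i) = a' i) ∧ (∀ j, L (b j) = b' j) ∧
      ∀ X Y, (M X * L Y).trace = (X * Y).trace := by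
  have h' : ∀ j i, (b' j * a' i).trace = (b j * a i).trace := fun j i => by
    rw [trace_mul_comm, h, trace_mul_comm]
  obtain ⟨M, hM⟩ := exists_linearMap_of_trace ha (span_eq_top_of_trace hb ha h') h
  obtain ⟨L, hL⟩ := exists_linearMap_of_trace hb (span_eq_top_of_trace ha hb h) h'
  refine ⟨M, L, hM, hL, fun X Y => ?_⟩
  have hX : X ∈ Submodule.span ℂ (Set.range a) := by simp [ha]
  have hY : Y ∈ Submodule.span ℂ (Set.range b) := by simp [hb]
  induction hX using Submodule.span_induction with
  | mem X hX =>
    obtain ⟨i, rfl⟩ := hX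
    induction hY using Submodule.span_induction with
    | mem Y hY => obtain ⟨j, rfl⟩ := hY; rw [hM, hL, h]
    | zero => simp
    | add a b _ _ ha hb => rw [map_add, mul_add, mul_add, trace_add, trace_add, ha, hb]
    | smul c a _ ha => rw [map_smul, mul_smul_comm, mul_smul_comm, trace_smul, trace_smul, ha]
  | zero => simp
  | add a b _ _ ha hb => rw [map_add, add_mul, add_mul, trace_add, trace_add, ha, hb]
  | smul c a _ ha => rw [map_smul, smul_mul_assoc, smul_mul_assoc, trace_smul, trace_smul, ha]

/-- Complex linear maps sending pure states to pure states and preserving the trace pairing. -/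
structure PreservesPure (L : Matrix (Fin n) (Fin n) ℂ →ₗ[ℂ] Matrix (Fin n) (Fin n) ℂ) : Prop where
  map_prj : ∀ x, star x ⬝ᵥ x = 1 → ∃ y, star y ⬝ᵥ y = 1 ∧ L (prj x) = prj y
  trace_mul : ∀ X Y, (L X * L Y).trace = (X * Y).trace

lemma injective_of_trace_mul {M L : Matrix (Fin n) (Fin n) ℂ →ₗ[ℂ] Matrix (Fin n) (Fin n) ℂ}
    (h : ∀ X Y, (M X * L Y).trace = (X * Y).trace) : Function.Injective L := by
  rw [← LinearMap.ker_eq_bot, LinearMap.ker_eq_bot']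
  intro Y hY
  refine Matrix.ext_iff_trace_mul_left.2 fun X => ?_
  rw [← h, hY]
  simp

lemma IsONB.of_trace {v : Fin n → Fin n → ℂ} (h : ∀ i, star (v i) ⬝ᵥ v i = 1)
    (h' : ∀ i j, i ≠ j → (prj (v i) * prj (v j)).trace = 0) : IsONB v := by
  intro i j
  split_ifs with hij
  · rw [← hij, h]
  · have := h' i j hij
    rw [trace_prj_mul_prj] at this
    simpa using this

namespace PreservesPure

variable {L : Matrix (Fin n) (Fin n) ℂ →ₗ[ℂ] Matrix (Fin n) (Fin n) ℂ}

lemma injective (hL : PreservesPure L) : Function.Injective L :=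
  injective_of_trace_mul hL.trace_mul

lemma exists_ONB (hL : PreservesPure L) {u : Fin n → Fin n → ℂ} (hu : IsONB u) :
    ∃ v, IsONB v ∧ ∀ i, L (prj (u i)) = prj (v i) := by
  choose v hv hLv using fun i => hL.map_prj (u i) (by simp [hu i i])
  refine ⟨v, IsONB.of_trace hv fun i j hij => ?_, hLv⟩
  rw [← hLv, ← hLv, hL.trace_mul, hu.prj_mul_prj, if_neg hij, trace_zero]

lemma exists_specSum (hL : PreservesPure L) {u : Fin n → Fin n → ℂ} (hu : IsONB u) :
    ∃ v, IsONB v ∧ ∀ a, L (specSum u a) = specSum v a := by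
  obtain ⟨v, hv, h⟩ := hL.exists_ONB hu
  exact ⟨v, hv, fun a => by simp [specSum, h]⟩

lemma map_matFun (hL : PreservesPure L) {A : Matrix (Fin n) (Fin n) ℂ} (hA : A.IsHermitian)
    (h : ℝ → ℝ) : L (matFun h A) = matFun h (L A) := by
  obtain ⟨u, hu, hA', hf⟩ := _root_.exists_specSum hA
  obtain ⟨v, hv, hv'⟩ := hL.exists_specSum hu
  conv_rhs => rw [hA']
  rw [hf, hv', hv', matFun_specSum hv]

lemma isHermitian (hL : PreservesPure L) {A : Matrix (Fin n) (Fin n) ℂ} (hA : A.IsHermitian) :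
    (L A).IsHermitian := by
  rw [← matFun_id hA, hL.map_matFun hA]
  exact isHermitian_matFun _ _

lemma posSemidef (hL : PreservesPure L) {A : Matrix (Fin n) (Fin n) ℂ} (hA : A.PosSemidef) :
    (L A).PosSemidef := by
  obtain ⟨u, hu, hA', hf⟩ := _root_.exists_specSum hA.isHermitian
  obtain ⟨v, hv, hv'⟩ := hL.exists_specSum hu
  rw [hA', hv']
  exact posSemidef_specSum _ hA.eigenvalues_nonneg

lemma map_mul_self (hL : PreservesPure L) {A : Matrix (Fin n) (Fin n) ℂ} (hA : A.IsHermitian) :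
    L (A * A) = L A * L A := by
  have h := hL.map_matFun hA (fun t => t * t)
  rwa [← matFun_mul hA, ← matFun_mul (hL.isHermitian hA), matFun_id hA,
    matFun_id (hL.isHermitian hA)] at h

lemma map_jordan (hL : PreservesPure L) (X Y : Matrix (Fin n) (Fin n) ℂ) :
    L (X * Y + Y * X) = L X * L Y + L Y * L X := by
  have hX : X ∈ Submodule.span ℂ
    (Set.range fun x : {x : Fin n → ℂ // star x ⬝ᵥ x = 1} => prj x.1) := by simp [span_prj]
  have hY : Y ∈ Submodule.span ℂ
    (Set.range fun x : {x : Fin n → ℂ // star x ⬝ᵥ x = 1} => prj x.1) := by simp [span_prj]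
  induction hX using Submodule.span_induction with
  | mem X hX =>
    obtain ⟨x, rfl⟩ := hX
    induction hY using Submodule.span_induction with
    | mem Y hY =>
      obtain ⟨y, rfl⟩ := hY
      have hx := (posSemidef_prj x.1).isHermitian
      have hy := (posSemidef_prj y.1).isHermitian
      have h1 := hL.map_mul_self (hx.add hy)
      have h2 := hL.map_mul_self hx
      have h3 := hL.map_mul_self hy
      simp only [map_add, add_mul, mul_add, h2, h3] at h1 ⊢
      have h4 := congrArg (fun Z => Z - L (prj x.1) * L (prj x.1) - L (prj y.1) * L (prj y.1)) h1
      convert h4 using 1 <;> abel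
    | zero => simp
    | add a b _ _ ha hb =>
      calc L (prj x.1 * (a + b) + (a + b) * prj x.1)
          = L (prj x.1 * a + a * prj x.1) + L (prj x.1 * b + b * prj x.1) := by
            rw [← map_add]; congr 1; noncomm_ring
        _ = _ := by rw [ha, hb, map_add]; noncomm_ring
    | smul c a _ ha =>
      rw [mul_smul_comm, smul_mul_assoc, ← smul_add, map_smul, ha, map_smul, mul_smul_comm,
        smul_mul_assoc, smul_add]
  | zero => simp
  | add a b _ _ ha hb =>
    calc L ((a + b) * Y + Y * (a + b))
        = L (a * Y + Y * a) + L (b * Y + Y * b) := by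
          rw [← map_add]; congr 1; noncomm_ring
      _ = _ := by rw [ha, hb, map_add]; noncomm_ring
  | smul c a _ ha =>
    rw [mul_smul_comm, smul_mul_assoc, ← smul_add, map_smul, ha, map_smul, mul_smul_comm,
      smul_mul_assoc, smul_add]

lemma map_conjTranspose (hL : PreservesPure L) (X : Matrix (Fin n) (Fin n) ℂ) :
    L Xᴴ = (L X)ᴴ := by
  have hX : X ∈ Submodule.span ℂ
    (Set.range fun x : {x : Fin n → ℂ // star x ⬝ᵥ x = 1} => prj x.1) := by simp [span_prj]
  induction hX using Submodule.span_induction with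
  | mem X hX =>
    obtain ⟨x, rfl⟩ := hX
    rw [(posSemidef_prj x.1).isHermitian, hL.isHermitian (posSemidef_prj x.1).isHermitian]
  | zero => simp
  | add a b _ _ ha hb => simp [ha, hb]
  | smul c a _ ha => simp [ha]

/-- Conjugating by a unitary preserves the class. -/
lemma unitary_conj (hL : PreservesPure L) {U : Matrix (Fin n) (Fin n) ℂ}
    (hU : U ∈ Matrix.unitaryGroup (Fin n) ℂ) :
    PreservesPure ((LinearMap.mulRight ℂ U).comp ((LinearMap.mulLeft ℂ (star U)).comp L)) where
  map_prj x hx := by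
    obtain ⟨y, hy, h⟩ := hL.map_prj x hx
    have h1 : (Uᴴ)ᴴ * Uᴴ = 1 := by
      rw [conjTranspose_conjTranspose]; exact (Matrix.mem_unitaryGroup_iff).1 hU
    refine ⟨Uᴴ *ᵥ y, ?_, ?_⟩
    · rw [star_mulVec, dotProduct_mulVec, vecMul_vecMul, h1, vecMul_one, hy]
    · simp only [LinearMap.comp_apply, LinearMap.mulRight_apply, LinearMap.mulLeft_apply, h]
      rw [prj, prj, mul_vecMulVec, vecMulVec_mul, star_mulVec, conjTranspose_conjTranspose,
        star_eq_conjTranspose]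
  trace_mul X Y := by
    have h1 : U * star U = 1 := (Matrix.mem_unitaryGroup_iff).1 hU
    simp only [LinearMap.comp_apply, LinearMap.mulRight_apply, LinearMap.mulLeft_apply]
    rw [← hL.trace_mul X Y]
    calc (star U * L X * U * (star U * L Y * U)).trace
        = (star U * (L X * (U * star U) * L Y) * U).trace := by noncomm_ring
      _ = (L X * L Y).trace := by
        rw [h1, mul_one, trace_mul_comm, ← mul_assoc, h1, one_mul]

lemma map_single (hL : PreservesPure L)
    (hd : ∀ i, L (single i i 1) = single i i 1) {k j : Fin n} (hkj : k ≠ j) :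
    (∃ a : ℂ, a * star a = 1 ∧ L (single k j 1) = single k j a) ∨
      (∃ a : ℂ, a * star a = 1 ∧ L (single k j 1) = single j k a) := by
  set Y := L (single k j 1) with hY
  have h1 : Y = single k k 1 * Y + Y * single k k 1 := by
    have := hL.map_jordan (single k k 1) (single k j 1)
    simpa [hd, hkj.symm, single_mul_single_of_ne, ← hY] using this
  have h2 : Y = single j j 1 * Y + Y * single j j 1 := by
    have := hL.map_jordan (single j j 1) (single k j 1)
    simpa [hd, hkj.symm, hkj, single_mul_single_of_ne, ← hY] using this
  have h3 : Y * Y = 0 := by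
    have := hL.map_jordan (single k j 1) (single k j 1)
    simp only [single_mul_single_of_ne _ _ _ _ hkj.symm, add_zero, map_zero, ← hY] at this
    have h : (2 : ℂ) • (Y * Y) = 0 := by rw [two_smul, ← this]
    exact (smul_eq_zero.1 h).resolve_left two_ne_zero
  have hoff : ∀ r c, ¬ (r = k ∧ c = j) → ¬ (r = j ∧ c = k) → Y r c = 0 := by
    intro r c hrc hrc'
    have e1 := congrFun (congrFun h1 r) c
    have e2 := congrFun (congrFun h2 r) c
    rw [Matrix.add_apply] at e1 e2
    by_cases rk : r = k
    · have cj : c ≠ j := fun h => hrc ⟨rk, h⟩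
      have rj : r ≠ j := fun h => hkj (rk.symm.trans h)
      rwa [single_mul_apply_of_ne _ _ _ _ _ rj, mul_single_apply_of_ne _ _ _ _ _ cj,
        add_zero] at e2
    · by_cases ck : c = k
      · have rj : r ≠ j := fun h => hrc' ⟨h, ck⟩
        have cj : c ≠ j := fun h => hkj (ck.symm.trans h)
        rwa [single_mul_apply_of_ne _ _ _ _ _ rj, mul_single_apply_of_ne _ _ _ _ _ cj,
          add_zero] at e2
      · rwa [single_mul_apply_of_ne _ _ _ _ _ rk, mul_single_apply_of_ne _ _ _ _ _ ck,
          add_zero] at e1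
  have hYs : Y = single k j (Y k j) + single j k (Y j k) := by
    ext r c
    by_cases h : r = k ∧ c = j
    · obtain ⟨rfl, rfl⟩ := h
      simp [hkj]
    · by_cases h' : r = j ∧ c = k
      · obtain ⟨rfl, rfl⟩ := h'
        simp [hkj]
      · rw [hoff r c h h', Matrix.add_apply, single_apply_of_ne, single_apply_of_ne, add_zero]
        · exact fun hh => h' ⟨hh.1.symm, hh.2.symm⟩
        · exact fun hh => h ⟨hh.1.symm, hh.2.symm⟩
  have hab : Y k j * Y j k = 0 := by
    rw [hYs] at h3
    have := congrFun (congrFun h3 k) k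
    simpa [add_mul, mul_add, single_mul_single_of_ne, hkj, hkj.symm] using this
  have htr : (Y * Yᴴ).trace = 1 := by
    rw [hY, ← hL.map_conjTranspose, hL.trace_mul]
    simp
  rcases mul_eq_zero.1 hab with h | h
  · right
    rw [h, single_zero, zero_add] at hYs
    refine ⟨Y j k, ?_, hYs⟩
    rw [hYs] at htr
    simpa using htr
  · left
    rw [h, single_zero, add_zero] at hYs
    refine ⟨Y k j, ?_, hYs⟩
    rw [hYs] at htr
    simpa using htr

lemma map_single_star (hL : PreservesPure L) {i j k l : Fin n} {a : ℂ}
    (h : L (single i j 1) = single k l a) : L (single j i 1) = single l k (star a) := by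
  have := hL.map_conjTranspose (single i j 1)
  rw [h] at this
  simpa using this

lemma map_single_jordan (hL : PreservesPure L) {i j : Fin n} (o : Fin n) (hij : i ≠ j) :
    L (single i j 1) = L (single i o 1) * L (single o j 1) + L (single o j 1) * L (single i o 1) := by
  rw [← hL.map_jordan]
  simp [single_mul_single_of_ne, hij.symm]

lemma eq_of_single {L M : Matrix (Fin n) (Fin n) ℂ →ₗ[ℂ] Matrix (Fin n) (Fin n) ℂ}
    (h : ∀ i j, L (single i j 1) = M (single i j 1)) (X : Matrix (Fin n) (Fin n) ℂ) :
    L X = M X := by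
  have : L = M := by
    refine Matrix.ext_linearMap _ fun i j => ?_
    ext1
    exact h i j
  rw [this]

lemma diagonal_mem {a : Fin n → ℂ} (ha : ∀ j, a j * star (a j) = 1) :
    diagonal a ∈ Matrix.unitaryGroup (Fin n) ℂ := by
  rw [Matrix.mem_unitaryGroup_iff, star_eq_conjTranspose, diagonal_conjTranspose,
    diagonal_mul_diagonal]
  simp only [Pi.star_apply, ha]
  exact diagonal_one

lemma exists_unitary_of_diag (hL : PreservesPure L) (o : Fin n)
    (hd : ∀ i, L (single i i 1) = single i i 1) :
    ∃ U ∈ Matrix.unitaryGroup (Fin n) ℂ,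
      (∀ X, L X = U * X * star U) ∨ (∀ X, L X = U * Xᵀ * star U) := by
  by_cases hall : ∀ j, ∃ a : ℂ, a * star a = 1 ∧ L (single o j 1) = single o j a
  · choose a ha hLa using hall
    refine ⟨star (diagonal a), Unitary.star_mem (diagonal_mem ha), Or.inl fun X => ?_⟩
    refine eq_of_single (M := (LinearMap.mulRight ℂ (star (star (diagonal a)))).comp
      (LinearMap.mulLeft ℂ (star (diagonal a)))) (fun i j => ?_) X
    simp only [LinearMap.comp_apply, LinearMap.mulRight_apply, LinearMap.mulLeft_apply, star_star,
      star_eq_conjTranspose, diagonal_conjTranspose]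
    have hR : diagonal (star a) * single i j 1 * diagonal a = single i j (star (a i) * a j) := by
      ext r c
      rw [mul_diagonal, diagonal_mul]
      by_cases h : i = r ∧ j = c
      · obtain ⟨rfl, rfl⟩ := h; simp
      · rw [single_apply_of_ne _ _ _ _ _ h, single_apply_of_ne _ _ _ _ _ h]; simp
    rw [hR]
    by_cases hij : i = j
    · subst hij; rw [hd, mul_comm, ha]
    · rw [hL.map_single_jordan o hij, hLa, hL.map_single_star (hLa i), single_mul_single_same,
        single_mul_single_of_ne _ _ _ _ (Ne.symm hij), add_zero]
  · push Not at hall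
    obtain ⟨m, hm⟩ := hall
    have hom : o ≠ m := by
      rintro rfl
      exact hm 1 (by simp) (hd o)
    have hm' := (hL.map_single hd hom).resolve_left fun ⟨a, ha, h⟩ => hm a ha h
    obtain ⟨b, hb, hLb⟩ := hm'
    have hall' : ∀ j, ∃ a : ℂ, a * star a = 1 ∧ L (single o j 1) = single j o a := by
      intro j
      by_cases hoj : o = j
      · exact ⟨1, by simp, by rw [← hoj, hd]⟩
      rcases hL.map_single hd hoj with ⟨a, ha, h⟩ | h
      · exfalso
        have hjm : m ≠ j := by
          rintro rfl
          exact hm a ha h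
        have h0 : L (single m j 1) = 0 := by
          rw [hL.map_single_jordan o hjm, h, hL.map_single_star hLb,
            single_mul_single_of_ne _ _ _ _ hom.symm, single_mul_single_of_ne _ _ _ _ (Ne.symm hoj),
            add_zero]
        have := hL.injective (h0.trans (map_zero L).symm)
        have := congrFun (congrFun this m) j
        simp at this
      · exact h
    choose a ha hLa using hall'
    refine ⟨diagonal a, diagonal_mem ha, Or.inr fun X => ?_⟩
    refine eq_of_single (M := (LinearMap.mulRight ℂ (star (diagonal a))).comp
      ((LinearMap.mulLeft ℂ (diagonal a)).comp
        (Matrix.transposeLinearEquiv (Fin n) (Fin n) ℂ ℂ).toLinearMap)) (fun i j => ?_) X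
    simp only [LinearMap.comp_apply, LinearMap.mulRight_apply, LinearMap.mulLeft_apply,
      star_eq_conjTranspose, diagonal_conjTranspose]
    change _ = diagonal a * (single i j 1)ᵀ * diagonal (star a)
    rw [transpose_single]
    have hR : diagonal a * single j i 1 * diagonal (star a) = single j i (star (a i) * a j) := by
      ext r c
      rw [mul_diagonal, diagonal_mul]
      by_cases h : j = r ∧ i = c
      · obtain ⟨rfl, rfl⟩ := h; simp [mul_comm]
      · rw [single_apply_of_ne _ _ _ _ _ h, single_apply_of_ne _ _ _ _ _ h]; simp
    rw [hR]
    by_cases hij : i = j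
    · subst hij; rw [hd, mul_comm, ha]
    · rw [hL.map_single_jordan o hij, hLa, hL.map_single_star (hLa i), single_mul_single_same,
        single_mul_single_of_ne _ _ _ _ hij, zero_add, mul_comm]

/-- **Wigner's theorem** in linearised form. -/
theorem exists_unitary (hL : PreservesPure L) (o : Fin n) :
    ∃ U ∈ Matrix.unitaryGroup (Fin n) ℂ,
      (∀ X, L X = U * X * star U) ∨ (∀ X, L X = U * Xᵀ * star U) := by
  have hu : IsONB fun i : Fin n => (Pi.single i 1 : Fin n → ℂ) := by
    intro i j
    simp [Pi.single_apply, eq_comm]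
  have hsingle : ∀ i : Fin n, prj (Pi.single i 1 : Fin n → ℂ) = single i i 1 := by
    intro i
    rw [prj, single_eq_single_vecMulVec_single, Pi.star_single, star_one]
  obtain ⟨v, hv, hLv⟩ := hL.exists_ONB hu
  have hV := hv.colMat_mem
  have h1 : colMat v * star (colMat v) = 1 := (Matrix.mem_unitaryGroup_iff).1 hV
  have h2 : star (colMat v) * colMat v = 1 := (Matrix.mem_unitaryGroup_iff').1 hV
  have hcol : ∀ i, colMat v * single i i 1 * star (colMat v) = prj (v i) := by
    intro i
    have hc : colMat v *ᵥ Pi.single i 1 = v i := by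
      ext r; simp [colMat]
    rw [← hsingle, prj, prj, mul_vecMulVec, vecMulVec_mul, star_eq_conjTranspose, ← star_mulVec, hc]
  obtain ⟨W, hW, h⟩ := (hL.unitary_conj hV).exists_unitary_of_diag o fun i => by
    simp only [LinearMap.comp_apply, LinearMap.mulRight_apply, LinearMap.mulLeft_apply]
    rw [← hsingle, hLv, hsingle, ← hcol]
    calc star (colMat v) * (colMat v * single i i 1 * star (colMat v)) * colMat v
        = (star (colMat v) * colMat v) * single i i 1 * (star (colMat v) * colMat v) := by
          noncomm_ring
      _ = _ := by rw [h2, one_mul, mul_one]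
  simp only [LinearMap.comp_apply, LinearMap.mulRight_apply, LinearMap.mulLeft_apply] at h
  have hback : ∀ X, L X = colMat v * (star (colMat v) * L X * colMat v) * star (colMat v) := by
    intro X
    calc L X = (colMat v * star (colMat v)) * L X * (colMat v * star (colMat v)) := by
          rw [h1, one_mul, mul_one]
      _ = _ := by noncomm_ring
  refine ⟨colMat v * W, mul_mem hV hW, h.imp (fun h X => ?_) fun h X => ?_⟩
  · rw [hback, h, star_mul]; noncomm_ring
  · rw [hback, h, star_mul]; noncomm_ring

lemma exists_prj_eq (hL : PreservesPure L) {y : Fin n → ℂ} (hy : star y ⬝ᵥ y = 1) :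
    ∃ x, star x ⬝ᵥ x = 1 ∧ L (prj x) = prj y := by
  have : Nonempty (Fin n) := by
    by_contra hn
    rw [not_nonempty_iff] at hn
    simp [dotProduct] at hy
  obtain ⟨o⟩ := this
  obtain ⟨U, hU, h⟩ := hL.exists_unitary o
  have h1 : U * Uᴴ = 1 := (Matrix.mem_unitaryGroup_iff).1 hU
  have hx : star (Uᴴ *ᵥ y) ⬝ᵥ (Uᴴ *ᵥ y) = 1 := by
    rw [star_mulVec, dotProduct_mulVec, vecMul_vecMul, conjTranspose_conjTranspose, h1,
      vecMul_one, hy]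
  have hUU : U * prj (Uᴴ *ᵥ y) * star U = prj y := by
    rw [prj, prj, mul_vecMulVec, vecMulVec_mul, star_eq_conjTranspose, ← star_mulVec,
      mulVec_mulVec, h1, one_mulVec]
  rcases h with h | h
  · exact ⟨_, hx, by rw [h, hUU]⟩
  · refine ⟨star (Uᴴ *ᵥ y), ?_, ?_⟩
    · rw [star_star, dotProduct_comm, hx]
    · rw [h, prj, transpose_vecMulVec, star_star]
      exact hUU

end PreservesPure

lemma exists_IsONB (n : ℕ) : ∃ u : Fin n → Fin n → ℂ, IsONB u :=
  let ⟨u, hu, _⟩ := exists_specSum (isHermitian_zero (n := Fin n) (α := ℂ))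
  ⟨u, hu⟩

lemma matFun_zero {h : ℝ → ℝ} (h0 : h 0 = 0) : matFun h (0 : Matrix (Fin n) (Fin n) ℂ) = 0 := by
  obtain ⟨u, hu⟩ := exists_IsONB n
  have : (0 : Matrix (Fin n) (Fin n) ℂ) = specSum u (fun _ => 0) := by simp [specSum]
  rw [this, matFun_specSum hu, h0]

lemma matFun_smul_prj {h : ℝ → ℝ} (h0 : h 0 = 0) {x : Fin n → ℂ} (hx : star x ⬝ᵥ x = 1) (c : ℝ) :
    matFun h ((c : ℂ) • prj x) = ((h c : ℝ) : ℂ) • prj x := by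
  have : Nonempty (Fin n) := by
    by_contra hn
    rw [not_nonempty_iff] at hn
    simp [dotProduct] at hx
  obtain ⟨o⟩ := this
  obtain ⟨u, hu, rfl⟩ := IsONB.ofUnit hx o
  have key : ∀ c : ℝ, (c : ℂ) • prj (u o) = specSum u (fun i => if i = o then c else 0) := by
    intro c
    rw [specSum, Finset.sum_eq_single o]
    · simp
    · intro i _ hi; simp [hi]
    · simp
  rw [key, matFun_specSum hu, key]
  congr 1
  ext i
  split_ifs <;> simp [h0]

lemma exists_unit_of_ne_zero {z : Fin n → ℂ} (hz : z ≠ 0) :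
    ∃ x : Fin n → ℂ, star x ⬝ᵥ x = 1 ∧ (∃ d : ℂ, z = d • x) ∧
      prj z = (((star z ⬝ᵥ z).re : ℝ) : ℂ) • prj x := by
  have hpos : 0 < star z ⬝ᵥ z := dotProduct_star_self_pos_iff.2 hz
  obtain ⟨hre, him⟩ := Complex.lt_def.1 hpos
  set c := (star z ⬝ᵥ z).re with hc
  have hcz : star z ⬝ᵥ z = (c : ℂ) := Complex.ext rfl (by simpa using him.symm)
  have hc0 : 0 < c := by simpa using hre
  have hs : (Real.sqrt c : ℂ) ≠ 0 := by
    exact_mod_cast (Real.sqrt_pos.2 hc0).ne'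
  have hsc : (Real.sqrt c : ℂ) * (Real.sqrt c : ℂ) = c := by
    exact_mod_cast Real.mul_self_sqrt hc0.le
  have hz' : z = (Real.sqrt c : ℂ) • ((Real.sqrt c : ℂ)⁻¹ • z) := by
    rw [smul_smul, mul_inv_cancel₀ hs, one_smul]
  refine ⟨(Real.sqrt c : ℂ)⁻¹ • z, ?_, ⟨_, hz'⟩, ?_⟩
  · rw [star_smul, smul_dotProduct, dotProduct_smul, hcz, ← hsc]
    simp only [star_inv₀, smul_eq_mul, RCLike.star_def, Complex.conj_ofReal]
    field_simp
  · conv_lhs => rw [hz', prj_smul]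
    rw [RCLike.star_def, Complex.conj_ofReal, hsc]

lemma retr_rpowMat_prj (z : Fin n → ℂ) {r : ℝ} (hr : r ≠ 0) :
    retr (rpowMat (prj z) r) = (star z ⬝ᵥ z).re ^ r := by
  have h0 : (0 : ℝ) ^ r = 0 := Real.zero_rpow hr
  by_cases hz : z = 0
  · subst hz
    rw [rpowMat, prj, zero_vecMulVec, matFun_zero h0]
    simp [retr, h0]
  · obtain ⟨x, hx, -, h⟩ := exists_unit_of_ne_zero hz
    rw [h, rpowMat, matFun_smul_prj h0 hx, retr, trace_smul, trace_prj, hx]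
    simp

lemma mul_prj_mul {C : Matrix (Fin n) (Fin n) ℂ} (hC : C.IsHermitian) (x : Fin n → ℂ) :
    C * prj x * C = prj (C *ᵥ x) := by
  rw [prj, prj, mul_vecMulVec, vecMulVec_mul, star_mulVec, hC]

lemma prj_mul_mul_prj (A : Matrix (Fin n) (Fin n) ℂ) (x : Fin n → ℂ) :
    prj x * A * prj x = (A * prj x).trace • prj x := by
  rw [trace_mul_prj, mul_assoc, prj, mul_vecMulVec, vecMulVec_mul_vecMulVec, vecMulVec_smul]

lemma re_trace_mul_prj_nonneg {A : Matrix (Fin n) (Fin n) ℂ} (hA : A.PosSemidef)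
    (x : Fin n → ℂ) : 0 ≤ (A * prj x).trace.re ∧ (A * prj x).trace = ((A * prj x).trace.re : ℂ) := by
  rw [trace_mul_prj]
  obtain ⟨hre, him⟩ := Complex.le_def.1 (hA.dotProduct_mulVec_nonneg x)
  exact ⟨by simpa using hre, Complex.ext rfl (by simpa using him.symm)⟩

lemma trace_mul_prj_eq_zero_iff {A : Matrix (Fin n) (Fin n) ℂ} (hA : A.PosSemidef)
    (x : Fin n → ℂ) : (A * prj x).trace = 0 ↔ A * prj x = 0 := by
  refine ⟨fun h => ?_, fun h => by rw [h, trace_zero]⟩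
  rw [trace_mul_prj, hA.dotProduct_mulVec_zero_iff] at h
  rw [prj, mul_vecMulVec, h, zero_vecMulVec]

lemma retr_renyi_prj_left {α s : ℝ} (hα : α ≠ 0) (hs : s ≠ 0)
    {B : Matrix (Fin n) (Fin n) ℂ} (hB : B.PosSemidef) (x : Fin n → ℂ) :
    retr (rpowMat (rpowMat B s * prj x * rpowMat B s) α) =
      (rpowMat B (2 * s) * prj x).trace.re ^ α := by
  have hC : (rpowMat B s).IsHermitian := isHermitian_matFun _ _
  rw [mul_prj_mul hC, retr_rpowMat_prj _ hα, trace_mul_prj, ← rpowMat_mul_self hB hs, star_mulVec,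
    hC, ← mulVec_mulVec, ← dotProduct_mulVec]

lemma retr_renyi_prj_right {α s : ℝ} (hα : α ≠ 0) (hs : s ≠ 0)
    {A : Matrix (Fin n) (Fin n) ℂ} (hA : A.PosSemidef) {x : Fin n → ℂ} (hx : star x ⬝ᵥ x = 1) :
    retr (rpowMat (rpowMat (prj x) s * A * rpowMat (prj x) s) α) = (A * prj x).trace.re ^ α := by
  have h1 : rpowMat (prj x) s = prj x := by
    have := matFun_smul_prj (h := fun t => t ^ s) (Real.zero_rpow hs) hx 1
    simpa [rpowMat] using this
  rw [h1, prj_mul_mul_prj, (re_trace_mul_prj_nonneg hA x).2, rpowMat,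
    matFun_smul_prj (h := fun t => t ^ α) (Real.zero_rpow hα) hx, retr, trace_smul, trace_prj, hx]
  simp

lemma suppOrth_iff {A B : Matrix (Fin n) (Fin n) ℂ} (hA : A.IsHermitian) :
    suppOrth A B ↔ A * B = 0 := by
  have key : ∀ x y, star (A *ᵥ x) ⬝ᵥ B *ᵥ y = star x ⬝ᵥ (A * B) *ᵥ y := by
    intro x y
    rw [star_mulVec, hA, ← dotProduct_mulVec, mulVec_mulVec]
  constructor
  · intro h
    refine Matrix.ext_of_mulVec_single fun j => ?_
    have := h ((A * B) *ᵥ Pi.single j 1) (Pi.single j 1)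
    rw [key, dotProduct_star_self_eq_zero] at this
    rw [this, zero_mulVec]
  · intro h x y
    rw [key, h, zero_mulVec, dotProduct_zero]

/-- The indicator function of `0`. -/
noncomputable def indZero (t : ℝ) : ℝ := if t = 0 then 1 else 0

lemma matFun_indZero_add {A : Matrix (Fin n) (Fin n) ℂ} (hA : A.PosSemidef) {f g : ℝ → ℝ}
    (hf : f 0 = 0) (hfg : ∀ t, 0 < t → f t * g t = 1) :
    matFun indZero A + matFun f A * matFun g A = 1 := by
  rw [matFun_mul hA.isHermitian, matFun_add hA.isHermitian, ← matFun_one hA.isHermitian]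
  refine matFun_congr hA fun t ht => ?_
  rcases ht.eq_or_lt with rfl | ht
  · simp [indZero, hf]
  · simp [indZero, ht.ne', hfg t ht]

lemma matFun_indZero_mul_self {A : Matrix (Fin n) (Fin n) ℂ} (hA : A.PosSemidef) :
    matFun indZero A * A = 0 := by
  conv_lhs => rw [← matFun_id hA.isHermitian, matFun_matFun hA.isHermitian,
    matFun_mul hA.isHermitian]
  rw [show (fun t => indZero t * t) = fun t => (0 : ℝ) from ?_]
  · obtain ⟨u, hu, -, hf⟩ := exists_specSum hA.isHermitian
    rw [hf]; simp [specSum]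
  · ext t
    by_cases h : t = 0 <;> simp [indZero, h]

lemma posSemidef_matFun_indZero {A : Matrix (Fin n) (Fin n) ℂ} (hA : A.PosSemidef) :
    (matFun indZero A).PosSemidef :=
  posSemidef_matFun hA fun t _ => by unfold indZero; split_ifs <;> norm_num

lemma suppLE_iff {A B : Matrix (Fin n) (Fin n) ℂ} (hB : B.PosSemidef) :
    suppLE A B ↔ matFun indZero B * A = 0 := by
  constructor
  · intro h
    refine Matrix.ext_of_mulVec_single fun j => ?_
    obtain ⟨z, hz⟩ := h ⟨Pi.single j 1, rfl⟩
    rw [toLin'_apply, toLin'_apply] at hz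
    rw [← mulVec_mulVec, ← hz, mulVec_mulVec, matFun_indZero_mul_self hB, zero_mulVec, zero_mulVec]
  · rintro h _ ⟨y, rfl⟩
    have h1 := matFun_indZero_add hB (f := fun t => t) (g := fun t => t⁻¹) rfl
      fun t ht => mul_inv_cancel₀ ht.ne'
    rw [matFun_id hB.isHermitian] at h1
    refine ⟨(matFun (fun t => t⁻¹) B * A) *ᵥ y, ?_⟩
    rw [toLin'_apply, toLin'_apply, mulVec_mulVec, ← mul_assoc]
    conv_rhs => rw [← one_mul A, ← h1, add_mul, h, zero_add]

lemma suppLE_prj_iff {B : Matrix (Fin n) (Fin n) ℂ} (hB : B.PosSemidef) (x : Fin n → ℂ) :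
    suppLE (prj x) B ↔ (matFun indZero B * prj x).trace = 0 := by
  rw [suppLE_iff hB, trace_mul_prj_eq_zero_iff (posSemidef_matFun_indZero hB)]

lemma rpowMat_trace_pos {B : Matrix (Fin n) (Fin n) ℂ} (hB : B.PosSemidef) {x : Fin n → ℂ}
    (hx : star x ⬝ᵥ x = 1) (h : suppLE (prj x) B) {r : ℝ} (hr : r ≠ 0) :
    0 < (rpowMat B r * prj x).trace.re := by
  have hP := posSemidef_rpowMat hB r
  obtain ⟨h1, h2⟩ := re_trace_mul_prj_nonneg hP x
  refine h1.lt_of_ne fun h0 => ?_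
  rw [← h0, Complex.ofReal_zero, trace_mul_prj_eq_zero_iff hP] at h2
  rw [suppLE_iff hB] at h
  have h3 := matFun_indZero_add hB (f := fun t => t ^ (-r)) (g := fun t => t ^ r)
    (Real.zero_rpow (neg_ne_zero.2 hr)) fun t ht => by
      rw [← Real.rpow_add ht]; simp
  have h4 : prj x = 0 := by
    rw [← one_mul (prj x), ← h3, add_mul, h, zero_add, mul_assoc]
    rw [rpowMat] at h2
    rw [h2, mul_zero]
  have := trace_prj x
  rw [h4, hx, trace_zero] at this
  exact zero_ne_one this

lemma exists_eigenvector {A : Matrix (Fin n) (Fin n) ℂ} (hA : A.IsHermitian) (h0 : A ≠ 0) :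
    ∃ (v : Fin n → ℂ) (l : ℝ), star v ⬝ᵥ v = 1 ∧ l ≠ 0 ∧ A *ᵥ v = (l : ℂ) • v := by
  obtain ⟨u, hu, h, -⟩ := exists_specSum hA
  have : ∃ i, hA.eigenvalues i ≠ 0 := by
    by_contra! hc
    refine h0 (h.trans ?_)
    simp [specSum, hc]
  obtain ⟨i, hi⟩ := this
  refine ⟨u i, hA.eigenvalues i, by simp [hu i i], hi, ?_⟩
  conv_lhs => rw [h]
  simp [specSum, Matrix.sum_mulVec, smul_mulVec, prj_mulVec, hu _ i, -Complex.coe_smul]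

/-- Rényi divergences preserve orthogonality: `α < 1`. -/
lemma dalpha_prj_right {α : ℝ} (hα : α ∈ Set.Ioo (0 : ℝ) 1) {A : Matrix (Fin n) (Fin n) ℂ}
    (hA : A.PosSemidef) {x : Fin n → ℂ} (hx : star x ⬝ᵥ x = 1) :
    Dalpha α A (prj x) = if (A * prj x).trace = 0 then ⊤ else
      (((α - 1)⁻¹ * Real.log ((A * prj x).trace.re ^ α) : ℝ) : EReal) := by
  have hs : (1 - α) / (2 * α) ≠ 0 := (div_pos (by linarith [hα.2]) (by linarith [hα.1])).ne'
  rw [Dalpha, suppOrth_iff hA.isHermitian, ← trace_mul_prj_eq_zero_iff hA,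
    retr_renyi_prj_right hα.1.ne' hs hA hx]
  by_cases h : (A * prj x).trace = 0
  · simp [h, hα.2.le]
  · simp [h, hα.2]

lemma ofReal_log_inj {α s t : ℝ} (h0 : α ≠ 0) (h1 : α ≠ 1) (hs : 0 < s) (ht : 0 < t)
    (h : (((α - 1)⁻¹ * Real.log (s ^ α) : ℝ) : EReal) = ((α - 1)⁻¹ * Real.log (t ^ α) : ℝ)) :
    s = t := by
  rw [EReal.coe_eq_coe_iff, Real.log_rpow hs, Real.log_rpow ht] at h
  exact Real.log_injOn_pos hs ht <|
    mul_left_cancel₀ h0 (mul_left_cancel₀ (inv_ne_zero (sub_ne_zero.2 h1)) h)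

lemma trace_mul_prj_eq_of_dalpha {α : ℝ} (hα : α ∈ Set.Ioo (0 : ℝ) 1)
    {A B : Matrix (Fin n) (Fin n) ℂ} (hA : A.PosSemidef) (hB : B.PosSemidef) {x y : Fin n → ℂ}
    (hx : star x ⬝ᵥ x = 1) (hy : star y ⬝ᵥ y = 1)
    (h : Dalpha α A (prj x) = Dalpha α B (prj y)) : (A * prj x).trace = (B * prj y).trace := by
  rw [dalpha_prj_right hα hA hx, dalpha_prj_right hα hB hy] at h
  obtain ⟨hA0, hA1⟩ := re_trace_mul_prj_nonneg hA x
  obtain ⟨hB0, hB1⟩ := re_trace_mul_prj_nonneg hB y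
  split_ifs at h with h1 h2 h2
  · rw [h1, h2]
  · exact absurd h.symm (EReal.coe_ne_top _)
  · exact absurd h (EReal.coe_ne_top _)
  · rw [hA1, hB1]
    congr 1
    refine ofReal_log_inj hα.1.ne' hα.2.ne (hA0.lt_of_ne fun h0 => h1 ?_)
      (hB0.lt_of_ne fun h0 => h2 ?_) h
    · rw [hA1, ← h0, Complex.ofReal_zero]
    · rw [hB1, ← h0, Complex.ofReal_zero]

/-- The pure state given by a unit vector. -/
def Density.pure (x : Fin n → ℂ) (hx : star x ⬝ᵥ x = 1) : Density n :=
  ⟨prj x, posSemidef_prj x, by rw [trace_prj, hx]⟩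

lemma Density.mul_eq_zero_iff {α : ℝ} (h1 : α < 1) (A B : Density n) :
    A.1 * B.1 = 0 ↔ Dalpha α A.1 B.1 = ⊤ := by
  rw [Dalpha, ← suppOrth_iff A.2.1.isHermitian]
  by_cases h : suppOrth A.1 B.1
  · simp [h, h1.le]
  · rw [if_pos (Or.inl ⟨h1, h⟩)]
    simp only [h, false_iff]
    exact EReal.coe_ne_top _

lemma Density.ne_zero (A : Density n) : A.1 ≠ 0 := by
  intro h
  have := A.2.2
  rw [h, trace_zero] at this
  exact zero_ne_one this

/-- Pairwise orthogonal density matrices `R i`, as many as the dimension, are pure states. -/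
lemma Density.exists_eq_prj {R : Fin n → Density n} (hR : ∀ i j, i ≠ j → (R i).1 * (R j).1 = 0)
    (k : Fin n) : ∃ y, star y ⬝ᵥ y = 1 ∧ (R k).1 = prj y := by
  choose v l hv hl hvl using fun i => exists_eigenvector (R i).2.1.isHermitian (R i).ne_zero
  have hc : ∀ i, ((l i : ℝ) : ℂ) ≠ 0 := fun i => by exact_mod_cast hl i
  have h0 : ∀ i j, i ≠ j → (R i).1 *ᵥ v j = 0 := by
    intro i j hij
    have : (l j : ℂ) • ((R i).1 *ᵥ v j) = 0 := by
      rw [← mulVec_smul, ← hvl, mulVec_mulVec, hR i j hij, zero_mulVec]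
    exact (smul_eq_zero.1 this).resolve_left (hc j)
  have hpr : ∀ i j, (R i).1 * prj (v j) = if i = j then (l i : ℂ) • prj (v i) else 0 := by
    intro i j
    split_ifs with hij
    · subst hij
      rw [prj, mul_vecMulVec, hvl, smul_vecMulVec]
    · rw [prj, mul_vecMulVec, h0 i j hij, zero_vecMulVec]
  have hu : IsONB v := by
    refine IsONB.of_trace hv fun i j hij => ?_
    have : (l i : ℂ) • prj (v i) * prj (v j) = 0 := by
      have h1 := hpr i i
      rw [if_pos rfl] at h1
      have h2 : prj (v i) * (R i).1 = (l i : ℂ) • prj (v i) := by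
        have := congrArg conjTranspose h1
        rw [conjTranspose_mul, (posSemidef_prj _).1, (R i).2.1.1, conjTranspose_smul,
          (posSemidef_prj _).1] at this
        simpa [-Complex.coe_smul] using this
      rw [← h2, mul_assoc, hpr, if_neg hij, mul_zero]
    rw [smul_mul, smul_eq_zero] at this
    rw [this.resolve_left (hc i), trace_zero]
  have h1 : (R k).1 = (l k : ℂ) • prj (v k) := by
    conv_lhs => rw [← mul_one (R k).1, ← hu.sum_prj, Finset.mul_sum]
    simp [hpr, -Complex.coe_smul]
  have h2 := (R k).2.2
  rw [h1, trace_smul, trace_prj, hv, smul_eq_mul, mul_one] at h2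
  exact ⟨v k, hv k, by rw [h1, h2, one_smul]⟩

/-- A map that preserves traces of products with pure states comes from a linear map. -/
lemma exists_preservesPure_of_trace {φ : Density n → Density n}
    (hp : ∀ x (hx : star x ⬝ᵥ x = 1), ∃ y, star y ⬝ᵥ y = 1 ∧ (φ (.pure x hx)).1 = prj y)
    (ht : ∀ A x (hx : star x ⬝ᵥ x = 1),
      ((φ A).1 * (φ (.pure x hx)).1).trace = (A.1 * prj x).trace) :
    ∃ L : Matrix (Fin n) (Fin n) ℂ →ₗ[ℂ] Matrix (Fin n) (Fin n) ℂ,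
      PreservesPure L ∧ ∀ A : Density n, (φ A).1 = L A.1 := by
  obtain ⟨M, L, hM, hL, hML⟩ := exists_linearMap_pair (n := n)
    (a := fun x : {x : Fin n → ℂ // star x ⬝ᵥ x = 1} => prj x.1)
    (b := fun x : {x : Fin n → ℂ // star x ⬝ᵥ x = 1} => prj x.1)
    (a' := fun x => (φ (.pure x.1 x.2)).1) (b' := fun x => (φ (.pure x.1 x.2)).1)
    span_prj span_prj (fun x y => ht (.pure x.1 x.2) y.1 y.2)
  have hMe : M = L := LinearMap.ext_on_range span_prj fun x => (hM x).trans (hL x).symm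
  subst hMe
  have hP : PreservesPure M := by
    refine ⟨fun x hx => ?_, hML⟩
    obtain ⟨y, hy, h⟩ := hp x hx
    exact ⟨y, hy, (hM ⟨x, hx⟩).trans h⟩
  refine ⟨M, hP, fun A => eq_of_trace_mul_prj fun y hy => ?_⟩
  obtain ⟨x, hx, hxy⟩ := hP.exists_prj_eq hy
  rw [← hxy, hML, ← ht A x hx]
  congr 2
  exact hM ⟨x, hx⟩

/-- Preservers of `D_α` with `α < 1` are restrictions of linear maps preserving pure states. -/
lemma exists_preservesPure_of_lt_one {α : ℝ} (hα : α ∈ Set.Ioo (0 : ℝ) 1) {φ : Density n → Density n}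
    (hφ : ∀ A B : Density n, Dalpha α (φ A).1 (φ B).1 = Dalpha α A.1 B.1) :
    ∃ L : Matrix (Fin n) (Fin n) ℂ →ₗ[ℂ] Matrix (Fin n) (Fin n) ℂ,
      PreservesPure L ∧ ∀ A : Density n, (φ A).1 = L A.1 := by
  have hp : ∀ x (hx : star x ⬝ᵥ x = 1), ∃ y, star y ⬝ᵥ y = 1 ∧ (φ (.pure x hx)).1 = prj y := by
    intro x hx
    have : Nonempty (Fin n) := by
      by_contra hn
      rw [not_nonempty_iff] at hn
      simp [dotProduct] at hx
    obtain ⟨k⟩ := this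
    obtain ⟨u, hu, rfl⟩ := IsONB.ofUnit hx k
    have hu1 : ∀ i, star (u i) ⬝ᵥ u i = 1 := fun i => by simp [hu i i]
    refine Density.exists_eq_prj (R := fun i => φ (.pure (u i) (hu1 i))) (fun i j hij => ?_) k
    rw [Density.mul_eq_zero_iff hα.2, hφ, ← Density.mul_eq_zero_iff hα.2]
    exact (hu.prj_mul_prj i j).trans (if_neg hij)
  refine exists_preservesPure_of_trace hp fun A x hx => ?_
  obtain ⟨y, hy, h⟩ := hp x hx
  rw [h]
  refine trace_mul_prj_eq_of_dalpha hα (φ A).2.1 A.2.1 hy hx ?_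
  rw [← h, hφ]
  rfl

lemma Density.suppLE_iff {α : ℝ} (h1 : 1 < α) (A B : Density n) :
    suppLE A.1 B.1 ↔ Dalpha α A.1 B.1 ≠ ⊤ := by
  rw [Dalpha]
  by_cases h : suppLE A.1 B.1
  · rw [if_pos (Or.inr ⟨h1, h⟩)]
    simp only [h, true_iff]
    exact EReal.coe_ne_top _
  · simp [h, h1.le]

lemma specSum_eq_zero_iff {u : Fin n → Fin n → ℂ} (hu : IsONB u) {a : Fin n → ℝ} :
    specSum u a = 0 ↔ ∀ i, a i = 0 := by
  refine ⟨fun h i => ?_, fun h => by simp [specSum, h]⟩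
  have h1 := hu.specSum_mul_prj a i
  have h2 := congrArg trace h1
  rw [h, zero_mul, trace_zero, trace_smul, trace_prj, hu i i, if_pos rfl, smul_eq_mul,
    mul_one] at h2
  exact_mod_cast h2.symm

lemma suppLE_specSum_iff {u : Fin n → Fin n → ℂ} (hu : IsONB u) {a b : Fin n → ℝ}
    (hb : ∀ i, 0 ≤ b i) : suppLE (specSum u a) (specSum u b) ↔ ∀ i, b i = 0 → a i = 0 := by
  rw [suppLE_iff (posSemidef_specSum u hb), matFun_specSum hu, hu.specSum_mul,
    specSum_eq_zero_iff hu]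
  refine forall_congr' fun i => ?_
  by_cases h : b i = 0 <;> simp [indZero, h]

lemma Density.exists_eq_prj_of_finrank {R : Density n}
    (hR : Module.finrank ℂ (LinearMap.range (toLin' R.1)) = 1) :
    ∃ y, star y ⬝ᵥ y = 1 ∧ R.1 = prj y := by
  obtain ⟨v, l, hv, hl, hvl⟩ := exists_eigenvector R.2.1.isHermitian R.ne_zero
  have hc : (l : ℂ) ≠ 0 := by exact_mod_cast hl
  have hmem : v ∈ LinearMap.range (toLin' R.1) :=
    ⟨(l : ℂ)⁻¹ • v, by rw [toLin'_apply, mulVec_smul, hvl, smul_smul, inv_mul_cancel₀ hc, one_smul]⟩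
  have hne : (⟨v, hmem⟩ : LinearMap.range (toLin' R.1)) ≠ 0 := by
    intro h
    have h0 : v = 0 := congrArg Subtype.val h
    simp [h0] at hv
  have hw := (finrank_eq_one_iff_of_nonzero' _ hne).1 hR
  have h1 : R.1 = (l : ℂ) • prj v := by
    refine Matrix.ext_of_mulVec_single fun j => ?_
    obtain ⟨c, h⟩ := hw ⟨R.1 *ᵥ Pi.single j 1, Pi.single j 1, rfl⟩
    have h : c • v = R.1 *ᵥ Pi.single j 1 := congrArg Subtype.val h
    have h2 : star v ⬝ᵥ R.1 *ᵥ Pi.single j 1 = (l : ℂ) * (star v ⬝ᵥ Pi.single j 1) := by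
      have h3 : star (R.1 *ᵥ v) = star v ᵥ* R.1 := by rw [star_mulVec, R.2.1.1]
      rw [dotProduct_mulVec, ← h3, hvl, star_smul, smul_dotProduct, RCLike.star_def,
        Complex.conj_ofReal, smul_eq_mul]
    have h4 : c = (l : ℂ) * (star v ⬝ᵥ Pi.single j 1) := by
      rw [← h2, ← h, dotProduct_smul, hv, smul_eq_mul, mul_one]
    rw [← h, h4, smul_mulVec, prj_mulVec, smul_smul]
  have h2 := R.2.2
  rw [h1, trace_smul, trace_prj, hv, smul_eq_mul, mul_one] at h2
  exact ⟨v, hv, by rw [h1, h2, one_smul]⟩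

/-- The density matrix that is uniformly distributed over `u i`, `i ≤ k`. -/
noncomputable def IsONB.flag {u : Fin n → Fin n → ℂ} (hu : IsONB u) (k : Fin n) : Density n :=
  ⟨specSum u fun i => if i ≤ k then ((k : ℝ) + 1)⁻¹ else 0,
    posSemidef_specSum u fun i => by split_ifs <;> positivity, by
      have : ((k : ℝ) + 1) ≠ 0 := by positivity
      rw [hu.trace_specSum, ← Finset.sum_filter, Finset.sum_const]
      have h : Finset.filter (fun i => i ≤ k) Finset.univ = Finset.Iic k := by ext; simp
      rw [h, Fin.card_Iic, nsmul_eq_mul]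
      push_cast
      exact mul_inv_cancel₀ (by exact_mod_cast this)⟩

lemma IsONB.suppLE_flag_iff {u : Fin n → Fin n → ℂ} (hu : IsONB u) {k l : Fin n} :
    suppLE (hu.flag k).1 (hu.flag l).1 ↔ k ≤ l := by
  have hpos : ∀ k : Fin n, ((k : ℝ) + 1) ≠ 0 := fun k => by positivity
  rw [flag, flag, suppLE_specSum_iff hu fun i => by split_ifs <;> positivity]
  simp only [ite_eq_right_iff, inv_eq_zero, hpos, imp_false, not_le]
  exact ⟨fun h => not_lt.1 fun hlk => absurd (h k hlk) (lt_irrefl _), fun h i hi => h.trans_lt hi⟩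

lemma exists_eq_prj_of_suppLE {φ : Density n → Density n}
    (h : ∀ A B : Density n, suppLE (φ A).1 (φ B).1 ↔ suppLE A.1 B.1)
    {x : Fin n → ℂ} (hx : star x ⬝ᵥ x = 1) :
    ∃ y, star y ⬝ᵥ y = 1 ∧ (φ (.pure x hx)).1 = prj y := by
  have hn : 0 < n := by
    by_contra hn
    obtain rfl : n = 0 := by omega
    simp [dotProduct] at hx
  obtain ⟨u, hu, hux⟩ := IsONB.ofUnit hx ⟨0, hn⟩
  have h0 : Density.pure x hx = hu.flag ⟨0, hn⟩ := by
    refine Subtype.ext ?_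
    change prj x = specSum u _
    rw [specSum, Finset.sum_eq_single ⟨0, hn⟩]
    · simp [hux]
    · intro i _ hi
      rw [if_neg, Complex.ofReal_zero, zero_smul]
      rw [Fin.le_def]
      intro hi'
      exact hi (Fin.ext (by simpa using hi'))
    · simp
  rw [h0]
  set f : Fin n → ℕ := fun k => Module.finrank ℂ (LinearMap.range (toLin' (φ (hu.flag k)).1))
  have hf : StrictMono f := by
    intro k l hkl
    refine Submodule.finrank_lt_finrank_of_lt (lt_of_le_not_ge ?_ ?_)
    · exact (h _ _).2 (hu.suppLE_flag_iff.2 hkl.le)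
    · exact fun hc => hkl.not_ge (hu.suppLE_flag_iff.1 ((h _ _).1 hc))
  have hle : ∀ k, f k ≤ n := fun k => (Submodule.finrank_le _).trans (by simp)
  have hcard : (Finset.univ : Finset (Fin n)).card ≤ (Finset.Icc (f ⟨0, hn⟩) n).card :=
    Finset.card_le_card_of_injOn f
      (fun k _ => Finset.mem_coe.2 <|
        Finset.mem_Icc.2 ⟨hf.monotone (Fin.le_def.2 (Nat.zero_le _)), hle k⟩)
      hf.injective.injOn
  rw [Finset.card_univ, Fintype.card_fin, Nat.card_Icc] at hcard
  have hpos : f ⟨0, hn⟩ ≠ 0 := by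
    intro hc
    rw [Submodule.finrank_eq_zero, LinearMap.range_eq_bot] at hc
    exact (φ (hu.flag ⟨0, hn⟩)).ne_zero (by simpa using hc)
  have h1 : f ⟨0, hn⟩ = 1 := by omega
  exact Density.exists_eq_prj_of_finrank h1

/-- Each positive definite matrix is a positive multiple of the `r`-th power of an invertible
density matrix. -/
lemma exists_density_rpowMat_eq_smul (o : Fin n) {X : Matrix (Fin n) (Fin n) ℂ} (hX : X.PosDef)
    {r : ℝ} (hr : r ≠ 0) : ∃ B : Density n, (∀ A, suppLE A B.1) ∧
      ∃ c : ℝ, 0 < c ∧ rpowMat B.1 r = (c : ℂ) • X := by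
  obtain ⟨u, hu, h, -⟩ := exists_specSum hX.isHermitian
  set a := hX.isHermitian.eigenvalues
  have ha : ∀ i, 0 < a i := hX.eigenvalues_pos
  have hra : ∀ i, 0 < a i ^ r⁻¹ := fun i => Real.rpow_pos_of_pos (ha i) _
  set S := ∑ i, a i ^ r⁻¹ with hS
  have hS0 : 0 < S := Finset.sum_pos (fun i _ => hra i) ⟨o, Finset.mem_univ o⟩
  have hb : ∀ i, 0 < S⁻¹ * a i ^ r⁻¹ := fun i => mul_pos (inv_pos.2 hS0) (hra i)
  refine ⟨⟨specSum u fun i => S⁻¹ * a i ^ r⁻¹, posSemidef_specSum u fun i => (hb i).le, ?_⟩, ?_,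
    S⁻¹ ^ r, Real.rpow_pos_of_pos (inv_pos.2 hS0) _, ?_⟩
  · rw [hu.trace_specSum, ← Finset.mul_sum, ← hS, inv_mul_cancel₀ hS0.ne', Complex.ofReal_one]
  · intro A
    rw [suppLE_iff (posSemidef_specSum u fun i => (hb i).le), matFun_specSum hu,
      (specSum_eq_zero_iff hu).2 fun i => by simp [indZero, (hb i).ne'], zero_mul]
  · rw [rpowMat, matFun_specSum hu, h, specSum, specSum, Finset.smul_sum]
    refine Finset.sum_congr rfl fun i _ => ?_
    rw [smul_smul, Real.mul_rpow (inv_pos.2 hS0).le (hra i).le, ← Real.rpow_mul (ha i).le,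
      inv_mul_cancel₀ hr, Real.rpow_one, Complex.ofReal_mul]

lemma posSemidef_of_add_smul_one {N : Matrix (Fin n) (Fin n) ℂ}
    (h : ∀ ε : ℝ, 0 < ε → (N + (ε : ℂ) • 1).PosSemidef) : N.PosSemidef := by
  have hN : N.IsHermitian := by
    have h1 := (h 1 one_pos).isHermitian.sub isHermitian_one
    simpa using h1
  refine .of_dotProduct_mulVec_nonneg hN fun w => ?_
  have key : ∀ ε : ℝ, 0 < ε → 0 ≤ star w ⬝ᵥ N *ᵥ w + (ε : ℂ) * (star w ⬝ᵥ w) := by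
    intro ε hε
    have := (h ε hε).dotProduct_mulVec_nonneg w
    rwa [add_mulVec, smul_mulVec, one_mulVec, dotProduct_add, dotProduct_smul] at this
  obtain ⟨hq, hq'⟩ := Complex.le_def.1 (dotProduct_star_self_nonneg w)
  simp only [Complex.zero_re, Complex.zero_im] at hq hq'
  have key' := fun ε hε => Complex.le_def.1 (key ε hε)
  simp only [Complex.zero_re, Complex.zero_im, Complex.add_re, Complex.add_im,
    Complex.re_ofReal_mul, Complex.im_ofReal_mul, ← hq', mul_zero, add_zero] at key'
  refine Complex.le_def.2 ⟨?_, (key' 1 one_pos).2⟩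
  refine le_of_forall_pos_le_add fun δ hδ => ?_
  have h1 := (key' (δ / ((star w ⬝ᵥ w).re + 1)) (by positivity)).1
  have h2 : δ / ((star w ⬝ᵥ w).re + 1) * (star w ⬝ᵥ w).re ≤ δ := by
    rw [div_mul_eq_mul_div, div_le_iff₀ (by positivity)]
    nlinarith
  rw [Complex.zero_re]
  linarith

/-- If `L` maps pure states to pure states and is dual to a positive map, then it preserves pure
states together with their transition probabilities. -/
lemma PreservesPure.of_dual {M L : Matrix (Fin n) (Fin n) ℂ →ₗ[ℂ] Matrix (Fin n) (Fin n) ℂ}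
    (hL : ∀ x, star x ⬝ᵥ x = 1 → ∃ y, star y ⬝ᵥ y = 1 ∧ L (prj x) = prj y)
    (hM : ∀ X, X.PosDef → (M X).PosSemidef)
    (hML : ∀ X Y, (M X * L Y).trace = (X * Y).trace) : PreservesPure L := by
  have hsurj : Function.Surjective L :=
    LinearMap.injective_iff_surjective.1 (injective_of_trace_mul hML)
  have htr : (traceLinearMap (Fin n) ℂ ℂ).comp L = traceLinearMap (Fin n) ℂ ℂ := by
    refine LinearMap.ext_on_range span_prj fun x => ?_
    obtain ⟨y, hy, h⟩ := hL x.1 x.2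
    simp [h, trace_prj, hy, x.2]
  have hM1 : M 1 = 1 := by
    refine eq_of_trace_mul_prj fun y _ => ?_
    obtain ⟨Y, hY⟩ := hsurj (prj y)
    rw [← hY, hML, one_mul, one_mul]
    exact (LinearMap.congr_fun htr Y).symm
  have hN : ∀ x, (M (prj x)).PosSemidef := by
    refine fun x => posSemidef_of_add_smul_one fun ε hε => ?_
    have h1 : ((ε : ℂ) • (1 : Matrix (Fin n) (Fin n) ℂ)).PosDef :=
      PosDef.one.smul (by exact_mod_cast hε)
    have := hM _ (h1.posSemidef_add (posSemidef_prj x))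
    rwa [map_add, map_smul, hM1] at this
  have hMx : ∀ x, star x ⬝ᵥ x = 1 → M (prj x) = L (prj x) := by
    intro x hx
    have : Nonempty (Fin n) := by
      by_contra hn
      rw [not_nonempty_iff] at hn
      simp [dotProduct] at hx
    obtain ⟨k⟩ := this
    obtain ⟨u, hu, rfl⟩ := IsONB.ofUnit hx k
    have hu1 : ∀ i, star (u i) ⬝ᵥ u i = 1 := fun i => by simp [hu i i]
    choose v hv hLv using fun i => hL (u i) (hu1 i)
    have h0 : ∀ i j, i ≠ j → M (prj (u i)) * prj (v j) = 0 := by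
      intro i j hij
      rw [← trace_mul_prj_eq_zero_iff (hN _), ← hLv, hML, hu.prj_mul_prj, if_neg hij, trace_zero]
    have hsum : ∑ i, M (prj (u i)) = 1 := by rw [← map_sum, hu.sum_prj, hM1]
    have h1 : ∀ i, M (prj (u i)) * prj (v i) = prj (v i) := by
      intro i
      conv_rhs => rw [← one_mul (prj (v i)), ← hsum, Finset.sum_mul]
      rw [Finset.sum_eq_single i (fun j _ hj => h0 j i hj) (by simp)]
    have h2 : ∀ i j, i ≠ j → prj (v j) * M (prj (u i)) = 0 := by
      intro i j hij
      have := congrArg conjTranspose (h0 i j hij)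
      rwa [conjTranspose_mul, (posSemidef_prj _).1, (hN _).1, conjTranspose_zero] at this
    have hvo : IsONB v := by
      refine IsONB.of_trace hv fun i j hij => ?_
      rw [← h1 j, ← mul_assoc, h2 j i hij.symm, zero_mul, trace_zero]
    rw [hLv]
    conv_lhs => rw [← mul_one (M _), ← hvo.sum_prj, Finset.mul_sum]
    rw [Finset.sum_eq_single k (fun j _ hj => h0 k j hj.symm) (by simp), h1]
  have hMe : M = L := LinearMap.ext_on_range span_prj fun x => hMx x.1 x.2
  subst hMe
  exact ⟨hL, hML⟩

lemma matFun_indZero_mul {A : Matrix (Fin n) (Fin n) ℂ} (hA : A.PosSemidef) {f : ℝ → ℝ}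
    (hf : f 0 = 0) : matFun indZero A * matFun f A = 0 := by
  obtain ⟨u, hu, -, h⟩ := exists_specSum hA.isHermitian
  rw [h, h, hu.specSum_mul, specSum_eq_zero_iff hu]
  intro i
  by_cases hi : hA.isHermitian.eigenvalues i = 0 <;> simp [indZero, hi, hf]

/-- Orthogonal projections with the same kernel coincide. -/
lemma eq_of_mul_prj_eq_zero {E F : Matrix (Fin n) (Fin n) ℂ} (hE : E.IsHermitian)
    (hF : F.IsHermitian) (hEE : E * E = E) (hFF : F * F = F)
    (h : ∀ y, star y ⬝ᵥ y = 1 → (E * prj y = 0 ↔ F * prj y = 0)) : E = F := by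
  have h' : ∀ G : Matrix (Fin n) (Fin n) ℂ, ∀ y, star y ⬝ᵥ y = 1 →
      (G * prj y = 0 ↔ G *ᵥ y = 0) := by
    intro G y hy
    rw [prj, mul_vecMulVec]
    refine ⟨fun h0 => ?_, fun h0 => by rw [h0, zero_vecMulVec]⟩
    have := congrArg (· *ᵥ y) h0
    simpa [vecMulVec_mulVec, hy] using this
  have key : ∀ z, E *ᵥ z = 0 ↔ F *ᵥ z = 0 := by
    intro z
    by_cases hz : z = 0
    · simp [hz]
    · obtain ⟨x, hx, ⟨d, hd⟩, -⟩ := exists_unit_of_ne_zero hz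
      have hd0 : d ≠ 0 := by
        rintro rfl
        exact hz (by rw [hd, zero_smul])
      rw [hd, mulVec_smul, mulVec_smul, smul_eq_zero_iff_right hd0, smul_eq_zero_iff_right hd0,
        ← h' E x hx, ← h' F x hx, h x hx]
  have mul : ∀ {E F : Matrix (Fin n) (Fin n) ℂ}, E * E = E →
      (∀ z, E *ᵥ z = 0 ↔ F *ᵥ z = 0) → F * E = F := by
    intro E F hEE key
    refine Matrix.ext_of_mulVec_single fun j => ?_
    have h0 : E *ᵥ (Pi.single j 1 - E *ᵥ Pi.single j 1) = 0 := by
      rw [mulVec_sub, mulVec_mulVec, hEE, sub_self]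
    have h1 := (key _).1 h0
    rw [mulVec_sub, mulVec_mulVec, sub_eq_zero] at h1
    exact h1.symm
  have h1 : F * E = F := mul hEE key
  have h2 : E * F = E := mul hFF fun z => (key z).symm
  have h3 := congrArg conjTranspose h2
  rw [conjTranspose_mul, hE, hF] at h3
  exact h3.symm.trans h1

/-- A positive semidefinite matrix is determined by the pure states below its support and their
expectations in the `r`-th power of the matrix. -/
lemma eq_of_trace_rpowMat {R T : Matrix (Fin n) (Fin n) ℂ} (hR : R.PosSemidef) (hT : T.PosSemidef)
    {r : ℝ} (hr : r ≠ 0) (hs : ∀ y, star y ⬝ᵥ y = 1 → (suppLE (prj y) R ↔ suppLE (prj y) T))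
    (ht : ∀ y, star y ⬝ᵥ y = 1 → suppLE (prj y) R →
      (rpowMat R r * prj y).trace = (rpowMat T r * prj y).trace) : R = T := by
  have h0 : (0 : ℝ) ^ r = 0 := Real.zero_rpow hr
  have idem : ∀ {A : Matrix (Fin n) (Fin n) ℂ}, A.PosSemidef →
      matFun indZero A * matFun indZero A = matFun indZero A := by
    intro A hA
    rw [matFun_mul hA.isHermitian]
    congr 1
    ext t
    unfold indZero
    split_ifs <;> simp
  have hEF : matFun indZero R = matFun indZero T := by
    refine eq_of_mul_prj_eq_zero (isHermitian_matFun _ _) (isHermitian_matFun _ _) (idem hR)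
      (idem hT) fun y hy => ?_
    rw [← suppLE_iff hR, ← suppLE_iff hT, hs y hy]
  have hEE := idem hR
  set E := matFun indZero R
  have hE : E.IsHermitian := isHermitian_matFun _ _
  have hQ : (1 - E).IsHermitian := isHermitian_one.sub hE
  have compress : ∀ {A : Matrix (Fin n) (Fin n) ℂ}, A.PosSemidef → matFun indZero A = E →
      ∀ y, (rpowMat A r * prj y).trace = (rpowMat A r * prj ((1 - E) *ᵥ y)).trace := by
    intro A hA hAE y
    have h1 : E * rpowMat A r = 0 := hAE ▸ matFun_indZero_mul hA h0
    have h2 : rpowMat A r * E = 0 := by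
      have := congrArg conjTranspose h1
      rwa [conjTranspose_mul, hE, (posSemidef_rpowMat hA r).1, conjTranspose_zero] at this
    rw [← mul_prj_mul hQ, mul_assoc, ← mul_assoc (rpowMat A r), mul_sub, mul_one, h2, sub_zero,
      ← mul_assoc, trace_mul_comm (_ * _), ← mul_assoc, sub_mul, one_mul, h1, sub_zero]
  have hpow : rpowMat R r = rpowMat T r := by
    refine eq_of_trace_mul_prj fun y _ => ?_
    rw [compress hR rfl, compress hT hEF.symm]
    by_cases hz : (1 - E) *ᵥ y = 0
    · simp [hz, prj]
    · obtain ⟨x, hx, ⟨d, hd⟩, hp⟩ := exists_unit_of_ne_zero hz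
      have hd0 : d ≠ 0 := by
        rintro rfl
        exact hz (by rw [hd, zero_smul])
      have hEx : E *ᵥ x = 0 := by
        refine (smul_eq_zero_iff_right hd0).1 ?_
        rw [← mulVec_smul, ← hd, mulVec_mulVec, mul_sub, mul_one, hEE, sub_self, zero_mulVec]
      rw [hp, Matrix.mul_smul, Matrix.mul_smul, trace_smul, trace_smul, ht x hx]
      rw [suppLE_iff hR, prj, mul_vecMulVec, hEx, zero_vecMulVec]
  rw [← rpowMat_rpowMat hR hr, hpow, rpowMat_rpowMat hT hr]

lemma trace_rpowMat_eq_of_dalpha {α : ℝ} (hα : 1 < α) {B C : Matrix (Fin n) (Fin n) ℂ}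
    (hB : B.PosSemidef) (hC : C.PosSemidef) {x y : Fin n → ℂ} (hx : star x ⬝ᵥ x = 1)
    (hy : star y ⬝ᵥ y = 1) (hxB : suppLE (prj x) B) (hyC : suppLE (prj y) C)
    (h : Dalpha α (prj x) B = Dalpha α (prj y) C) :
    (rpowMat B (2 * ((1 - α) / (2 * α))) * prj x).trace =
      (rpowMat C (2 * ((1 - α) / (2 * α))) * prj y).trace := by
  have hα0 : α ≠ 0 := by linarith
  have hs : (1 - α) / (2 * α) ≠ 0 :=
    div_ne_zero (sub_ne_zero.2 hα.ne) (mul_ne_zero two_ne_zero hα0)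
  have hs2 : 2 * ((1 - α) / (2 * α)) ≠ 0 := mul_ne_zero two_ne_zero hs
  rw [Dalpha, Dalpha, if_pos (Or.inr ⟨hα, hxB⟩), if_pos (Or.inr ⟨hα, hyC⟩),
    retr_renyi_prj_left hα0 hs hB, retr_renyi_prj_left hα0 hs hC] at h
  rw [(re_trace_mul_prj_nonneg (posSemidef_rpowMat hB _) x).2,
    (re_trace_mul_prj_nonneg (posSemidef_rpowMat hC _) y).2,
    ofReal_log_inj hα0 hα.ne' (rpowMat_trace_pos hB hx hxB hs2) (rpowMat_trace_pos hC hy hyC hs2) h]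

/-- Preservers of `D_α` with `1 < α` are restrictions of linear maps preserving pure states. -/
lemma exists_preservesPure_of_one_lt (o : Fin n) {α : ℝ} (hα : 1 < α) {φ : Density n → Density n}
    (hφ : ∀ A B : Density n, Dalpha α (φ A).1 (φ B).1 = Dalpha α A.1 B.1) :
    ∃ L : Matrix (Fin n) (Fin n) ℂ →ₗ[ℂ] Matrix (Fin n) (Fin n) ℂ,
      PreservesPure L ∧ ∀ A : Density n, (φ A).1 = L A.1 := by
  have hsupp : ∀ A B : Density n, suppLE (φ A).1 (φ B).1 ↔ suppLE A.1 B.1 := fun A B => by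
    rw [Density.suppLE_iff hα, Density.suppLE_iff hα, hφ]
  have hp := fun x (hx : star x ⬝ᵥ x = 1) => exists_eq_prj_of_suppLE hsupp hx
  set r := 2 * ((1 - α) / (2 * α)) with hr
  have hr0 : r ≠ 0 := mul_ne_zero two_ne_zero
    (div_ne_zero (sub_ne_zero.2 hα.ne) (mul_ne_zero two_ne_zero (by linarith)))
  have htr : ∀ (B : Density n) x (hx : star x ⬝ᵥ x = 1), suppLE (prj x) B.1 →
      (rpowMat (φ B).1 r * (φ (.pure x hx)).1).trace = (rpowMat B.1 r * prj x).trace := by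
    intro B x hx hxB
    obtain ⟨y, hy, h⟩ := hp x hx
    have hyB : suppLE (prj y) (φ B).1 := by
      rw [← h, hsupp]
      exact hxB
    rw [h]
    refine trace_rpowMat_eq_of_dalpha hα (φ B).2.1 B.2.1 hy hx hyB hxB ?_
    rw [← h, hφ]
    rfl
  have hspan : Submodule.span ℂ (Set.range
      fun B : {B : Density n // ∀ A, suppLE A B.1} => rpowMat B.1.1 r) = ⊤ := by
    set S := Submodule.span ℂ (Set.range
      fun B : {B : Density n // ∀ A, suppLE A B.1} => rpowMat B.1.1 r)
    have hS : ∀ X, X.PosDef → X ∈ S := by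
      intro X hX
      obtain ⟨B, hB, c, hc, h⟩ := exists_density_rpowMat_eq_smul o hX hr0
      have hc' : (c : ℂ) ≠ 0 := by exact_mod_cast hc.ne'
      refine (S.smul_mem_iff hc').1 ?_
      rw [← h]
      exact Submodule.subset_span ⟨⟨B, hB⟩, rfl⟩
    rw [eq_top_iff, ← span_prj, Submodule.span_le]
    rintro _ ⟨x, rfl⟩
    have := S.sub_mem (hS _ (PosDef.one.add_posSemidef (posSemidef_prj x.1))) (hS _ PosDef.one)
    simpa using this
  obtain ⟨M, L, hM, hL, hML⟩ := exists_linearMap_pair (n := n)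
    (a := fun B : {B : Density n // ∀ A, suppLE A B.1} => rpowMat B.1.1 r)
    (b := fun x : {x : Fin n → ℂ // star x ⬝ᵥ x = 1} => prj x.1)
    (a' := fun B => rpowMat (φ B.1).1 r) (b' := fun x => (φ (.pure x.1 x.2)).1)
    hspan span_prj (fun B x => htr B.1 x.1 x.2 (B.2 _))
  have hMpos : ∀ X, X.PosDef → (M X).PosSemidef := by
    intro X hX
    obtain ⟨B, hB, c, hc, h⟩ := exists_density_rpowMat_eq_smul o hX hr0
    have hc' : (c : ℂ) ≠ 0 := by exact_mod_cast hc.ne'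
    have hX' : X = ((c⁻¹ : ℝ) : ℂ) • rpowMat B.1 r := by
      rw [h, smul_smul, Complex.ofReal_inv, inv_mul_cancel₀ hc', one_smul]
    rw [hX', map_smul, hM ⟨B, hB⟩]
    exact (posSemidef_rpowMat (φ B).2.1 r).smul (by exact_mod_cast (inv_pos.2 hc).le)
  have hP : PreservesPure L := by
    refine .of_dual (fun x hx => ?_) hMpos hML
    obtain ⟨y, hy, h⟩ := hp x hx
    exact ⟨y, hy, (hL ⟨x, hx⟩).trans h⟩
  refine ⟨L, hP, fun A => ?_⟩
  have hLA := hP.posSemidef A.2.1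
  have hsupp' : ∀ x (hx : star x ⬝ᵥ x = 1),
      (suppLE (φ (.pure x hx)).1 (φ A).1 ↔ suppLE (prj x) A.1) := fun x hx => hsupp _ A
  refine eq_of_trace_rpowMat (φ A).2.1 hLA hr0 (fun y hy => ?_) fun y hy hyA => ?_
  · obtain ⟨x, hx, hxy⟩ := hP.exists_prj_eq hy
    rw [suppLE_prj_iff hLA, ← hP.map_matFun A.2.1.isHermitian, ← hxy, hP.trace_mul,
      ← suppLE_prj_iff A.2.1, ← hsupp' x hx, hL ⟨x, hx⟩]
  · obtain ⟨x, hx, hxy⟩ := hP.exists_prj_eq hy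
    rw [← hxy, hL ⟨x, hx⟩, hsupp' x hx] at hyA
    rw [rpowMat, rpowMat, ← hP.map_matFun A.2.1.isHermitian, ← hxy, hP.trace_mul, hL ⟨x, hx⟩]
    exact htr A x hx hyA

end

/-- Preservers of the quantum Rényi divergence `D_α` on density
operators are unitary or antiunitary similarity transformations. -/
theorem stmt2 {n : ℕ} (α : ℝ) (hα : α ∈ Set.Ioo (0:ℝ) 1 ∪ Set.Ioi (1:ℝ))
    (φ : Density n → Density n)
    (hφ : ∀ A B : Density n, Dalpha α (φ A).1 (φ B).1 = Dalpha α A.1 B.1) :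
    ∃ U ∈ Matrix.unitaryGroup (Fin n) ℂ,
      (∀ A : Density n, (φ A).1 = U * A.1 * star U) ∨
      (∀ A : Density n, (φ A).1 = U * A.1ᵀ * star U) := by
  rcases n.eq_zero_or_pos with rfl | hn
  · refine ⟨1, one_mem _, Or.inl fun A => absurd ?_ A.ne_zero⟩
    exact Subsingleton.elim _ _
  obtain ⟨L, hL, hφL⟩ : ∃ L : Matrix (Fin n) (Fin n) ℂ →ₗ[ℂ] Matrix (Fin n) (Fin n) ℂ,
      PreservesPure L ∧ ∀ A : Density n, (φ A).1 = L A.1 := by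
    rcases hα with hα | hα
    · exact exists_preservesPure_of_lt_one hα hφ
    · exact exists_preservesPure_of_one_lt ⟨0, hn⟩ hα hφ
  obtain ⟨U, hU, h⟩ := hL.exists_unitary ⟨0, hn⟩
  exact ⟨U, hU, h.imp (fun h A => (hφL A).trans (h _)) fun h A => (hφL A).trans (h _)⟩
end

section
/- Let H be a finite-dimensional complex Hilbert space and α ∈ (0,1)∪(1,∞). If φ: B(H)^{++} → B(H)^{++} is a bijective map satisfying D_α(φ(A)‖φ(B)) = D_α(A‖B) for all A, B ∈ B(H)^{++}, then there exist a scalar c > 0 and a unitary operator U on H such that either φ(A) = c·U A U* for all A ∈ B(H)^{++}, or φ(A) = c·U Aᵀ U* for all A ∈ B(H)^{++} (where Aᵀ denotes the transpose with respect to a fixed orthonormal basis; the second case corresponds to an antiunitary similarity). -/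
open Matrix
open scoped ComplexOrder

section RpowTrace

open scoped MatrixOrder Matrix.Norms.L2Operator

variable {ι : Type*} [Fintype ι] [DecidableEq ι]

lemma Matrix.IsHermitian.dotProduct_cfc_mulVec {A : Matrix ι ι ℂ} (hA : A.IsHermitian)
    (f : ℝ → ℝ) (v : ι → ℂ) :
    star v ⬝ᵥ (cfc f A *ᵥ v) = ((∑ j, ‖(star (hA.eigenvectorUnitary : Matrix ι ι ℂ) *ᵥ v) j‖ ^ 2 *
      f (hA.eigenvalues j) : ℝ) : ℂ) := by
  rw [hA.cfc_eq, IsHermitian.cfc, Unitary.conjStarAlgAut_apply]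
  have h : star v ᵥ* (hA.eigenvectorUnitary : Matrix ι ι ℂ) =
      star (star (hA.eigenvectorUnitary : Matrix ι ι ℂ) *ᵥ v) := by
    rw [star_mulVec, star_eq_conjTranspose, conjTranspose_conjTranspose]
  rw [← mulVec_mulVec, ← mulVec_mulVec, dotProduct_mulVec, h, Complex.ofReal_sum]
  refine Finset.sum_congr rfl fun j _ => ?_
  rw [mulVec_diagonal, Pi.star_apply, Complex.star_def, Complex.ofReal_mul, Complex.ofReal_pow,
    ← Complex.conj_mul']
  simp only [Function.comp_apply, Complex.coe_algebraMap]
  ring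

lemma Matrix.IsHermitian.trace_cfc {A : Matrix ι ι ℂ} (hA : A.IsHermitian) (f : ℝ → ℝ) :
    (cfc f A).trace = ((∑ j, f (hA.eigenvalues j) : ℝ) : ℂ) := by
  rw [hA.cfc_eq, IsHermitian.cfc, Unitary.conjStarAlgAut_apply, trace_mul_cycle]
  simp [trace]

/-- The real trace `tr X ^ α`, for a positive semidefinite matrix `X`. -/
noncomputable def traceRpow (α : ℝ) (X : Matrix ι ι ℂ) : ℝ := (X ^ α).trace.re

lemma traceRpow_eq_sum {X : Matrix ι ι ℂ} (hX : X.PosSemidef) (α : ℝ) :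
    traceRpow α X = ∑ j, hX.isHermitian.eigenvalues j ^ α := by
  rw [traceRpow, CFC.rpow_eq_cfc_real (nonneg_iff_posSemidef.2 hX), hX.isHermitian.trace_cfc,
    Complex.ofReal_re]

lemma traceRpow_mul_comm (X : Matrix ι ι ℂ) (α : ℝ) :
    traceRpow α (Xᴴ * X) = traceRpow α (X * Xᴴ) := by
  have h1 := posSemidef_conjTranspose_mul_self X
  have h2 := posSemidef_self_mul_conjTranspose X
  rw [traceRpow_eq_sum h1, traceRpow_eq_sum h2,
    (h1.isHermitian.eigenvalues_eq_eigenvalues_iff h2.isHermitian).2 (charpoly_mul_comm _ _)]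

/-- Jensen's inequality for the spectral measure of `Y` in a unit vector. -/
lemma rpow_dotProduct_le {Y : Matrix ι ι ℂ} (hY : Y.PosSemidef) {α : ℝ} (hα : 1 ≤ α)
    {v : ι → ℂ} (hv : star v ⬝ᵥ v = 1) :
    (star v ⬝ᵥ (Y *ᵥ v)).re ^ α ≤ (star v ⬝ᵥ (Y ^ α *ᵥ v)).re := by
  have hH := hY.isHermitian
  have key := hH.dotProduct_cfc_mulVec
  have e0 := key (fun _ => 1) v
  have e1 := key id v
  rw [cfc_const_one ℝ Y, one_mulVec, hv] at e0
  rw [cfc_id ℝ Y] at e1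
  rw [CFC.rpow_eq_cfc_real (nonneg_iff_posSemidef.2 hY), key, e1, Complex.ofReal_re,
    Complex.ofReal_re]
  have e0' : ∑ j, ‖(star (hH.eigenvectorUnitary : Matrix ι ι ℂ) *ᵥ v) j‖ ^ 2 = 1 := by
    have := e0.symm
    simp only [mul_one] at this
    exact_mod_cast this
  exact Real.rpow_arith_mean_le_arith_mean_rpow _ _ _ (fun _ _ => by positivity) e0'
    (fun j _ => hY.eigenvalues_nonneg j) hα

lemma traceRpow_mono {α : ℝ} (hα : 0 < α) {X Y : Matrix ι ι ℂ} (hX : 0 ≤ X) (hXY : X ≤ Y) :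
    traceRpow α X ≤ traceRpow α Y := by
  have hY : 0 ≤ Y := hX.trans hXY
  rcases le_total α 1 with h | h
  · have := CFC.rpow_le_rpow ⟨hα.le, h⟩ hXY
    have := (Matrix.le_iff.1 this).trace_nonneg
    rw [trace_sub, Complex.le_def] at this
    simpa [traceRpow] using this.1
  · have hX' := nonneg_iff_posSemidef.1 hX
    have hH := hX'.isHermitian
    have hY' := nonneg_iff_posSemidef.1 hY
    rw [traceRpow_eq_sum hX']
    have htr : traceRpow α Y = ∑ j, (star (hH.eigenvectorBasis j).ofLp ⬝ᵥ
        (Y ^ α *ᵥ (hH.eigenvectorBasis j).ofLp)).re := by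
      have : (Y ^ α).trace = (star (hH.eigenvectorUnitary : Matrix ι ι ℂ) * (Y ^ α) *
          (hH.eigenvectorUnitary : Matrix ι ι ℂ)).trace := by
        rw [trace_mul_cycle]; simp
      rw [traceRpow, this, trace, Complex.re_sum]
      congr! 2 with j
      rw [← hH.eigenvectorUnitary_mulVec, diag_apply, star_mulVec, ← star_eq_conjTranspose,
        ← dotProduct_mulVec, mulVec_mulVec, mulVec_mulVec]
      generalize star (hH.eigenvectorUnitary : Matrix ι ι ℂ) * Y ^ α *
        (hH.eigenvectorUnitary : Matrix ι ι ℂ) = M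
      simp
    rw [htr]
    refine Finset.sum_le_sum fun j _ => ?_
    have hn : star (hH.eigenvectorBasis j).ofLp ⬝ᵥ (hH.eigenvectorBasis j).ofLp = 1 := by
      have := hH.eigenvectorBasis.orthonormal.1 j
      rw [dotProduct_comm, ← EuclideanSpace.inner_eq_star_dotProduct, inner_self_eq_norm_sq_to_K,
        this]
      simp
    refine le_trans (Real.rpow_le_rpow (hX'.eigenvalues_nonneg j) ?_ (by linarith))
      (rpow_dotProduct_le hY' h hn)
    have h1 := (Matrix.le_iff.1 hXY).dotProduct_mulVec_nonneg (hH.eigenvectorBasis j).ofLp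
    rw [sub_mulVec, hH.mulVec_eigenvectorBasis, dotProduct_sub, dotProduct_smul, hn] at h1
    simpa using (Complex.le_def.1 h1).1

lemma tendsto_traceRpow {α : ℝ} (hα : 0 < α) {β : Type*} {l : Filter β} {X : β → Matrix ι ι ℂ}
    {Y : Matrix ι ι ℂ} (hX : ∀ k, 0 ≤ X k) (hY : 0 ≤ Y) (h : Filter.Tendsto X l (nhds Y)) :
    Filter.Tendsto (fun k => traceRpow α (X k)) l (nhds (traceRpow α Y)) := by
  lift α to NNReal using hα.le
  have h1 := CFC.continuousOn_nnrpow (A := Matrix ι ι ℂ) α Y hY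
  have h2 := h1.tendsto.comp (tendsto_nhdsWithin_iff.2 ⟨h, .of_forall hX⟩)
  have hc : Continuous fun X : Matrix ι ι ℂ => X.trace.re := by fun_prop
  have h3 := (hc.tendsto _).comp h2
  simpa only [traceRpow, Function.comp_def,
    ← CFC.nnrpow_eq_rpow (A := Matrix ι ι ℂ) (NNReal.coe_pos.1 hα)] using h3

lemma smul_rpow {X : Matrix ι ι ℂ} (hX : 0 ≤ X) {t : ℝ} (ht : 0 ≤ t) (α : ℝ) :
    (t • X) ^ α = t ^ α • X ^ α := by
  have hX' := nonneg_iff_posSemidef.1 hX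
  have hH : IsSelfAdjoint X := hX'.isHermitian
  have htX : 0 ≤ t • X := smul_nonneg ht hX
  have hfin : (spectrum ℝ X).Finite := Matrix.finite_real_spectrum
  rw [CFC.rpow_eq_cfc_real htX, CFC.rpow_eq_cfc_real hX, ← cfc_comp_smul t _ X
    ((hfin.image _).continuousOn _) hH,
    ← cfc_smul _ _ _ (hfin.continuousOn _)]
  refine cfc_congr fun x hx => ?_
  simp only [smul_eq_mul]
  exact Real.mul_rpow ht (spectrum_nonneg_of_nonneg hX hx)

lemma traceRpow_smul {X : Matrix ι ι ℂ} (hX : 0 ≤ X) {t : ℝ} (ht : 0 ≤ t) (α : ℝ) :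
    traceRpow α (t • X) = t ^ α * traceRpow α X := by
  simp [traceRpow, smul_rpow hX ht]

lemma traceRpow_pos [Nonempty ι] {X : Matrix ι ι ℂ} (hX : X.PosDef) (α : ℝ) :
    0 < traceRpow α X := by
  rw [traceRpow_eq_sum hX.posSemidef]
  exact Finset.sum_pos (fun j _ => Real.rpow_pos_of_pos (hX.eigenvalues_pos j) _)
    Finset.univ_nonempty

lemma traceRpow_vecMulVec (v : ι → ℂ) {α : ℝ} (hα : 0 < α) :
    traceRpow α (vecMulVec v (star v)) = (star v ⬝ᵥ v).re ^ α := by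
  have hX := posSemidef_vecMulVec_self_star v
  set c := (star v ⬝ᵥ v).re with hc
  have hnn := Complex.le_def.1 (dotProduct_star_self_nonneg v)
  have hcv : (c : ℂ) = star v ⬝ᵥ v := Complex.ext rfl (by simpa using hnn.2)
  have hc0 : 0 ≤ c := hnn.1
  rcases hc0.eq_or_lt with h0 | hcpos
  · have : v = 0 := by
      rw [← h0] at hcv
      exact dotProduct_star_self_eq_zero.1 (by simpa [dotProduct_comm] using hcv.symm)
    have h0' : vecMulVec v (star v) = 0 := by simp [this]
    rw [h0', ← h0, traceRpow, ← CFC.rpow_eq_pow, CFC.zero_rpow hα.ne', Real.zero_rpow hα.ne']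
    simp
  have hfin : (spectrum ℝ (vecMulVec v (star v))).Finite := Matrix.finite_real_spectrum
  have hpow : (vecMulVec v (star v)) ^ α = c ^ (α - 1) • vecMulVec v (star v) := by
    rw [CFC.rpow_eq_cfc_real (nonneg_iff_posSemidef.2 hX)]
    have hid := cfc_id ℝ (vecMulVec v (star v)) (ha := hX.isHermitian.isSelfAdjoint)
    conv_rhs => rw [← hid]
    rw [← cfc_smul _ _ _ (hfin.continuousOn _)]
    refine cfc_congr fun x hx => ?_
    have : x * x = c * x := by
      rw [hX.isHermitian.spectrum_real_eq_range_eigenvalues] at hx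
      obtain ⟨j, rfl⟩ := hx
      set w := (hX.isHermitian.eigenvectorBasis j).ofLp
      have hw : vecMulVec v (star v) *ᵥ w = hX.isHermitian.eigenvalues j • w :=
        hX.isHermitian.mulVec_eigenvectorBasis j
      have hw0 : w ≠ 0 := fun h => hX.isHermitian.eigenvectorBasis.orthonormal.ne_zero j
        (by ext i; exact congrFun h i)
      have h2 : vecMulVec v (star v) * vecMulVec v (star v) = c • vecMulVec v (star v) := by
        rw [vecMulVec_mul_vecMulVec, ← hcv]
        ext i k
        simp [vecMulVec_apply]
        ring
      have h3 := congrArg (· *ᵥ w) h2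
      simp only [← mulVec_mulVec, smul_mulVec, hw, mulVec_smul] at h3
      rw [smul_smul, smul_smul] at h3
      exact smul_left_injective ℝ hw0 h3
    rcases eq_or_ne x 0 with rfl | hx0
    · simp [Real.zero_rpow hα.ne']
    · have : x = c := mul_right_cancel₀ hx0 this
      subst this
      simp only [id, smul_eq_mul]
      rw [Real.rpow_sub_one hx0, div_mul_cancel₀ _ hx0]
  rw [traceRpow, hpow, trace_smul, trace_vecMulVec, dotProduct_comm, ← hcv,
    Real.rpow_sub_one hcpos.ne']
  simp [div_mul_cancel₀ _ hcpos.ne']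

end RpowTrace

section Herstein

variable {ι : Type*} [Fintype ι] [DecidableEq ι]

/-- A matrix identity expressing primeness of the full matrix ring. -/
lemma Matrix.eq_zero_or_eq_zero_of_mul_mul_add {u v : Matrix ι ι ℂ}
    (h : ∀ c : Matrix ι ι ℂ, u * c * v + v * c * u = 0) : u = 0 ∨ v = 0 := by
  have key : ∀ i j k l, u i k * v l j + v i k * u l j = 0 := by
    intro i j k l
    have := congrFun (congrFun (h (single k l 1)) i) j
    simpa [mul_apply, single_apply, ite_and, Finset.sum_mul] using this
  have h1 : ∀ i k, u i k = 0 ∨ v i k = 0 := by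
    intro i k
    have := key i k k i
    have h2 : u i k * v i k = 0 := by linear_combination this / 2
    exact mul_eq_zero.1 h2
  by_contra hne
  push Not at hne
  obtain ⟨hu, hv⟩ := hne
  obtain ⟨i, k, hik⟩ : ∃ i k, u i k ≠ 0 := by
    by_contra hc; push Not at hc; exact hu (by ext i j; exact hc i j)
  obtain ⟨l, j, hlj⟩ : ∃ l j, v l j ≠ 0 := by
    by_contra hc; push Not at hc; exact hv (by ext i j; exact hc i j)
  have := key i j k l
  have hv0 := (h1 i k).resolve_left hik
  rw [hv0, zero_mul, add_zero] at this
  exact (mul_ne_zero hik hlj) this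

/-- A linear bijection of the full matrix ring that preserves squares is multiplicative or
antimultiplicative. -/
lemma LinearEquiv.map_mul_or_map_mul_rev (χ : Matrix ι ι ℂ ≃ₗ[ℂ] Matrix ι ι ℂ)
    (hsq : ∀ a, χ (a * a) = χ a * χ a) :
    (∀ a b, χ (a * b) = χ a * χ b) ∨ (∀ a b, χ (a * b) = χ b * χ a) := by
  have h2 : ∀ a b, χ (a * b) + χ (b * a) = χ a * χ b + χ b * χ a := by
    intro a b
    have := hsq (a + b)
    simp only [add_mul, mul_add, map_add, hsq] at this
    have h3 : (χ (a * b) + χ (b * a)) = (χ a * χ a + χ (b * a) + (χ (a * b) + χ b * χ b))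
      - χ a * χ a - χ b * χ b := by abel
    rw [h3, this]; abel
  have haba : ∀ a b, χ (a * b * a) = χ a * χ b * χ a := by
    intro a b
    have e1 := h2 a (a * b + b * a)
    have e2 := h2 (a * a) b
    have hj : χ (a * b + b * a) = χ a * χ b + χ b * χ a := by rw [map_add, h2]
    rw [hj] at e1
    rw [hsq] at e2
    simp only [mul_add, add_mul, map_add, ← mul_assoc] at e1 e2 ⊢
    have h3 : (2 : ℂ) • χ (a * b * a) = (2 : ℂ) • (χ a * χ b * χ a) := by
      rw [two_smul, two_smul]
      linear_combination (norm := abel) e1 - e2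
    exact smul_right_injective _ (two_ne_zero' ℂ) h3
  have habc : ∀ a b c, χ (a * b * c) + χ (c * b * a) = χ a * χ b * χ c + χ c * χ b * χ a := by
    intro a b c
    have := haba (a + c) b
    simp only [add_mul, mul_add, map_add, haba] at this
    linear_combination (norm := abel) this
  have huv : ∀ a b, χ (a * b) = χ a * χ b ∨ χ (a * b) = χ b * χ a := by
    intro a b
    have : ∀ c, (χ (a * b) - χ a * χ b) * c * (χ (a * b) - χ b * χ a) +
        (χ (a * b) - χ b * χ a) * c * (χ (a * b) - χ a * χ b) = 0 := by
      intro c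
      obtain ⟨c, rfl⟩ := χ.surjective c
      have e1 := habc (a * b) c (b * a)
      have e2 := haba a (b * c * b)
      have e3 := haba b (a * c * a)
      rw [haba b c] at e2
      rw [haba a c] at e3
      have hv : χ (b * a) = χ a * χ b + χ b * χ a - χ (a * b) := by rw [← h2]; abel
      rw [hv] at e1
      simp only [mul_add, add_mul, mul_sub, sub_mul, ← mul_assoc] at e1 e2 e3 ⊢
      rw [e2, e3] at e1
      linear_combination (norm := abel) e1
    rcases Matrix.eq_zero_or_eq_zero_of_mul_mul_add this with h | h
    · exact .inl (sub_eq_zero.1 h)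
    · exact .inr (sub_eq_zero.1 h)
  have hrow : ∀ a, (∀ b, χ (a * b) = χ a * χ b) ∨ (∀ b, χ (a * b) = χ b * χ a) := by
    intro a
    by_contra! hc
    obtain ⟨⟨b, hb⟩, ⟨c, hc⟩⟩ := hc
    have hb' := (huv a b).resolve_left hb
    have hc' := (huv a c).resolve_right hc
    rcases huv a (b + c) with h | h
    · simp only [mul_add, map_add, hc'] at h
      exact hb (add_right_cancel h)
    · simp only [mul_add, add_mul, map_add, hb'] at h
      exact hc (add_left_cancel h)
  by_contra! hc
  obtain ⟨⟨a, b, hab⟩, ⟨c, d, hcd⟩⟩ := hc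
  have ha := (hrow a).resolve_left fun h => hab (h b)
  have hc := (hrow c).resolve_right fun h => hcd (h d)
  rcases hrow (a + c) with h | h
  · have := h b
    simp only [add_mul, map_add, hc] at this
    exact hab (add_right_cancel this)
  · have := h d
    simp only [add_mul, mul_add, map_add, ha] at this
    exact hcd (add_left_cancel this)

end Herstein

section Wigner

open scoped MatrixOrder Matrix.Norms.L2Operator

variable {ι : Type*} [Fintype ι] [DecidableEq ι]

/-- A star-algebra automorphism of a full matrix algebra is a unitary conjugation. -/
lemma StarAlgEquiv.exists_unitaryGroup_conj (f : Matrix ι ι ℂ ≃⋆ₐ[ℂ] Matrix ι ι ℂ) :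
    ∃ U ∈ unitaryGroup ι ℂ, ∀ E, f E = U * E * star U := by
  let T := toEuclideanCLM (n := ι) (𝕜 := ℂ)
  let g := (T.symm.trans f).trans T
  have hg : Continuous g := by
    exact LinearMap.continuous_of_finiteDimensional g.toAlgEquiv.toLinearMap
  obtain ⟨V, hV⟩ := StarAlgEquiv.eq_linearIsometryEquivConjStarAlgEquiv g hg
  let W := Unitary.linearIsometryEquiv.symm V
  have hst : ∀ X, T (star X) = star (T X) := T.map_star'
  refine ⟨T.symm W, ?_, ?_⟩
  · rw [mem_unitaryGroup_iff]
    apply EquivLike.injective T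
    rw [map_mul T, hst, StarAlgEquiv.apply_symm_apply,
      Unitary.mul_star_self_of_mem W.2, map_one T]
  · intro E
    apply EquivLike.injective T
    rw [map_mul T, map_mul T, hst,
      StarAlgEquiv.apply_symm_apply]
    have := DFunLike.congr_fun hV (T E)
    rw [← Unitary.conjStarAlgAut_symm_unitaryLinearIsometryEquiv] at this
    rw [Unitary.conjStarAlgAut_apply] at this
    rw [← this]
    simp [g]

lemma isHermitian_map_of_posSemidef_map (χ : Matrix ι ι ℂ →ₗ[ℂ] Matrix ι ι ℂ)
    (h : ∀ E, E.PosSemidef → (χ E).PosSemidef) {E : Matrix ι ι ℂ} (hE : E.IsHermitian) :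
    (χ E).IsHermitian := by
  have h1 : E ≤ algebraMap ℝ _ ‖E‖ := IsSelfAdjoint.le_algebraMap_norm_self (a := E) hE
  have h2 : (0 : Matrix ι ι ℂ) ≤ algebraMap ℝ _ ‖E‖ := algebraMap_nonneg _ (norm_nonneg E)
  have h3 := (h _ (nonneg_iff_posSemidef.1 h2)).isHermitian.sub (h _ (le_iff.1 h1)).isHermitian
  rwa [← map_sub, sub_sub_cancel] at h3

lemma map_conjTranspose_of_posSemidef_map (χ : Matrix ι ι ℂ →ₗ[ℂ] Matrix ι ι ℂ)
    (h : ∀ E, E.PosSemidef → (χ E).PosSemidef) (E : Matrix ι ι ℂ) :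
    χ (star E) = star (χ E) := by
  have hre := isHermitian_map_of_posSemidef_map χ h (realPart E).2
  have him := isHermitian_map_of_posSemidef_map χ h (imaginaryPart E).2
  conv_lhs => rw [← realPart_add_I_smul_imaginaryPart E]
  conv_rhs => rw [← realPart_add_I_smul_imaginaryPart E]
  have hre' : star (χ (realPart E : Matrix ι ι ℂ)) = _ := hre
  have him' : star (χ (imaginaryPart E : Matrix ι ι ℂ)) = _ := him
  have e1 : star (realPart E : Matrix ι ι ℂ) = _ := (realPart E).2
  have e2 : star (imaginaryPart E : Matrix ι ι ℂ) = _ := (imaginaryPart E).2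
  simp only [star_add, star_smul, map_add, map_smul, e1, e2, hre', him']

lemma Matrix.mul_eq_zero_of_conj_le_zero {X Q : Matrix ι ι ℂ} (hX : 0 ≤ X)
    (hQ : star Q * X * Q ≤ 0) : X * Q = 0 := by
  obtain ⟨B, rfl⟩ := CStarAlgebra.nonneg_iff_eq_star_mul_self.1 hX
  have : star (B * Q) * (B * Q) = 0 := by
    refine le_antisymm ?_ (star_mul_self_nonneg _)
    simpa [mul_assoc] using hQ
  rw [mul_assoc, CStarRing.star_mul_self_eq_zero_iff _ |>.1 this, mul_zero]

/-- Order-theoretic characterisation of projections. -/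
lemma isIdempotentElem_iff_forall_le {P : Matrix ι ι ℂ} (h0 : 0 ≤ P) (h1 : P ≤ 1) :
    P * P = P ↔ ∀ X : Matrix ι ι ℂ, 0 ≤ X → X ≤ P → X ≤ 1 - P → X = 0 := by
  have hH : star P = P := IsSelfAdjoint.of_nonneg h0
  constructor
  · intro hP X hX hXP hXP'
    have k1 : X * P = 0 := by
      refine mul_eq_zero_of_conj_le_zero hX ((star_left_conjugate_le_conjugate hXP' P).trans_eq ?_)
      simp [mul_sub, hH, hP]
    have k2 : X * (1 - P) = 0 := by
      refine mul_eq_zero_of_conj_le_zero hX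
        ((star_left_conjugate_le_conjugate hXP (1 - P)).trans_eq ?_)
      simp [mul_sub, sub_mul, hH, hP]
    simpa [mul_sub, k1] using k2
  · intro h
    have := h (P - P * P) ?_ ?_ ?_
    · exact (sub_eq_zero.1 this).symm
    · have h2 : 0 ≤ 1 - P := sub_nonneg.2 h1
      have := Commute.mul_nonneg h0 h2 ((Commute.one_right P).sub_right (Commute.refl P))
      simpa [mul_sub] using this
    · have := star_mul_self_nonneg P
      rw [hH] at this
      simpa using this
    · have := star_mul_self_nonneg (1 - P)
      rw [star_sub, hH, star_one] at this
      rw [← sub_nonneg]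
      convert this using 1
      noncomm_ring

lemma mul_eq_zero_of_isIdempotentElem_add {P Q : Matrix ι ι ℂ} (hP : P * P = P) (hQ : Q * Q = Q)
    (h : (P + Q) * (P + Q) = P + Q) : P * Q = 0 := by
  have h1 : P * Q = - (Q * P) := by
    simp only [mul_add, add_mul, hP, hQ] at h
    linear_combination (norm := abel) h
  have h2 : P * Q = - (P * Q * P) := by
    conv_lhs => rw [← hP, mul_assoc, h1, mul_neg, ← mul_assoc]
  have h3 : Q * P = - (P * Q * P) := by
    conv_lhs => rw [← hP, ← mul_assoc, ← neg_neg (Q * P), ← h1, neg_mul]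
  rw [← h3] at h2
  have h4 : (2 : ℂ) • (P * Q) = 0 := by
    rw [two_smul]; nth_rw 1 [h1]; rw [h2]; simp
  exact (smul_eq_zero.1 h4).resolve_left two_ne_zero

/-- A unital linear order automorphism of a full matrix algebra preserves projections. -/
lemma LinearEquiv.map_isIdempotentElem (χ : Matrix ι ι ℂ ≃ₗ[ℂ] Matrix ι ι ℂ) (h1 : χ 1 = 1)
    (h : ∀ E, (χ E).PosSemidef ↔ E.PosSemidef) {P : Matrix ι ι ℂ} (hP : P * P = P)
    (hP0 : 0 ≤ P) : χ P * χ P = χ P := by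
  have hn : ∀ E, 0 ≤ χ E ↔ 0 ≤ E := fun E => by
    rw [nonneg_iff_posSemidef, nonneg_iff_posSemidef, h]
  have hle : ∀ E F, χ E ≤ χ F ↔ E ≤ F := fun E F => by
    rw [← sub_nonneg, ← map_sub, hn, sub_nonneg]
  have hPH : star P = P := IsSelfAdjoint.of_nonneg hP0
  have hP1 : P ≤ 1 := by
    have := star_mul_self_nonneg (1 - P)
    simpa [mul_sub, sub_mul, hPH, hP] using this
  rw [isIdempotentElem_iff_forall_le ((hn P).2 hP0) (by rw [← h1, hle]; exact hP1)]
  intro X hX hXP hXP'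
  obtain ⟨X, rfl⟩ := χ.surjective X
  rw [hle] at hXP
  rw [← h1, ← map_sub, hle] at hXP'
  rw [(isIdempotentElem_iff_forall_le hP0 hP1).1 hP X ((hn X).1 hX) hXP hXP', map_zero]

lemma LinearEquiv.map_mul_self_of_isHermitian (χ : Matrix ι ι ℂ ≃ₗ[ℂ] Matrix ι ι ℂ) (h1 : χ 1 = 1)
    (h : ∀ E, (χ E).PosSemidef ↔ E.PosSemidef) {E : Matrix ι ι ℂ} (hE : E.IsHermitian) :
    χ (E * E) = χ E * χ E := by
  let V : Matrix ι ι ℂ := hE.eigenvectorUnitary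
  have hV : star V * V = 1 := Unitary.coe_star_mul_self _
  let P : ι → Matrix ι ι ℂ := fun i => V * single i i 1 * star V
  have hPP : ∀ i j, P i * P j = if i = j then P i else 0 := by
    intro i j
    have : P i * P j = V * (single i i 1 * (star V * V) * single j j 1) * star V := by
      simp only [P, mul_assoc]
    rw [this, hV, mul_one]
    split_ifs with hij
    · subst hij; simp [P]
    · rw [single_mul_single_of_ne]
      · simp
      · exact hij
  have hP0 : ∀ i, 0 ≤ P i := by
    intro i
    have : P i = star (star (P i)) * star (P i) := by
      have hs : star (P i) = P i := by
        simp [P, star_eq_conjTranspose, mul_assoc]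
      rw [hs, hs, hPP, if_pos rfl]
    rw [this]; exact star_mul_self_nonneg _
  have hχP : ∀ i j, χ (P i) * χ (P j) = if i = j then χ (P i) else 0 := by
    intro i j
    split_ifs with hij
    · subst hij
      exact χ.map_isIdempotentElem h1 h (by simp [hPP]) (hP0 i)
    · apply mul_eq_zero_of_isIdempotentElem_add
      · exact χ.map_isIdempotentElem h1 h (by simp [hPP]) (hP0 i)
      · exact χ.map_isIdempotentElem h1 h (by simp [hPP]) (hP0 j)
      · rw [← map_add]
        refine χ.map_isIdempotentElem h1 h ?_ (add_nonneg (hP0 i) (hP0 j))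
        simp [mul_add, add_mul, hPP, hij, Ne.symm hij]
  have hEs : E = ∑ i, (hE.eigenvalues i : ℂ) • P i := by
    conv_lhs => rw [hE.spectral_theorem, Unitary.conjStarAlgAut_apply]
    have : diagonal (RCLike.ofReal ∘ hE.eigenvalues) =
      ∑ i, (hE.eigenvalues i : ℂ) • single i i (1 : ℂ) := by
      rw [← sum_single_eq_diagonal]
      simp
    rw [this, Finset.mul_sum, Finset.sum_mul]
    simp only [Matrix.mul_smul, Matrix.smul_mul, P, V]
  rw [hEs]
  simp only [map_sum, map_smul, Finset.sum_mul, Finset.mul_sum, smul_mul_smul_comm, hPP, hχP]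
  simp [apply_ite χ]

/-- A unital linear order automorphism of a full matrix algebra is a unitary or an antiunitary
conjugation. -/
theorem LinearEquiv.exists_unitaryGroup_of_posSemidef_iff (χ : Matrix ι ι ℂ ≃ₗ[ℂ] Matrix ι ι ℂ)
    (h1 : χ 1 = 1) (h : ∀ E, (χ E).PosSemidef ↔ E.PosSemidef) :
    ∃ U ∈ unitaryGroup ι ℂ, (∀ E, χ E = U * E * star U) ∨ (∀ E, χ E = U * Eᵀ * star U) := by
  have hstar := map_conjTranspose_of_posSemidef_map χ.toLinearMap fun E => (h E).2
  simp only [LinearEquiv.coe_coe] at hstar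
  have hsq : ∀ a, χ (a * a) = χ a * χ a := by
    intro a
    have hs := fun {E} => χ.map_mul_self_of_isHermitian h1 h (E := E)
    have hx := hs (realPart a).2
    have hy := hs (imaginaryPart a).2
    have hxy := hs (realPart a + imaginaryPart a).2
    rw [← realPart_add_I_smul_imaginaryPart a]
    rw [AddSubgroup.coe_add] at hxy
    generalize (realPart a : Matrix ι ι ℂ) = x at *
    generalize (imaginaryPart a : Matrix ι ι ℂ) = y at *
    simp only [add_mul, mul_add, map_add, hx, hy] at hxy
    have hxy' : χ (x * y) + χ (y * x) = χ x * χ y + χ y * χ x := by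
      linear_combination (norm := abel) hxy
    simp only [add_mul, mul_add, map_add, map_smul, smul_mul_assoc, mul_smul_comm, hx, hy]
    linear_combination (norm := module) Complex.I • hxy'
  rcases χ.map_mul_or_map_mul_rev hsq with hm | hm
  · let f : Matrix ι ι ℂ ≃⋆ₐ[ℂ] Matrix ι ι ℂ :=
      StarAlgEquiv.ofAlgEquiv (AlgEquiv.ofLinearEquiv χ h1 hm) hstar
    obtain ⟨U, hU, hf⟩ := f.exists_unitaryGroup_conj
    exact ⟨U, hU, .inl hf⟩
  · let f : Matrix ι ι ℂ ≃⋆ₐ[ℂ] Matrix ι ι ℂ :=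
      StarAlgEquiv.ofAlgEquiv (AlgEquiv.ofLinearEquiv ((transposeLinearEquiv ι ι ℂ ℂ).trans χ)
        (by simp [h1]) (by simp [hm])) (fun a => by
          exact hstar aᵀ)
    obtain ⟨U, hU, hf⟩ := f.exists_unitaryGroup_conj
    refine ⟨U, hU, .inr fun E => ?_⟩
    rw [← hf]
    exact congrArg χ (transpose_transpose E).symm

end Wigner

section ConeAutomorphism

open scoped MatrixOrder Matrix.Norms.L2Operator
open Filter Topology

variable {ι : Type*} [Fintype ι] [DecidableEq ι]

/-- The cone of positive definite matrices. -/
abbrev PDMatrix (ι : Type*) [Fintype ι] [DecidableEq ι] := {A : Matrix ι ι ℂ // A.PosDef}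

lemma Matrix.PosDef.exists_smul_one_le {C : Matrix ι ι ℂ} (hC : C.PosDef) :
    ∃ δ : ℝ, 0 < δ ∧ δ • (1 : Matrix ι ι ℂ) ≤ C := by
  cases isEmpty_or_nonempty ι
  · exact ⟨1, one_pos, (Subsingleton.elim _ _).le⟩
  have h := (CFC.exists_pos_algebraMap_le_iff (A := Matrix ι ι ℂ) (a := C)
    (ha := hC.isHermitian.isSelfAdjoint)).2 fun x hx =>
    (isStrictlyPositive_iff_posDef.2 hC).spectrum_pos hx
  simpa only [Algebra.algebraMap_eq_smul_one, gt_iff_lt] using h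

omit [Fintype ι] in
lemma Matrix.posDef_real_smul_one {ε : ℝ} (hε : 0 < ε) : (ε • (1 : Matrix ι ι ℂ)).PosDef :=
  PosDef.one.smul hε

omit [Fintype ι] in
lemma Matrix.PosSemidef.posDef_add_smul_one {P : Matrix ι ι ℂ} (hP : P.PosSemidef) {ε : ℝ}
    (hε : 0 < ε) : (P + ε • (1 : Matrix ι ι ℂ)).PosDef :=
  PosDef.posSemidef_add hP (posDef_real_smul_one hε)

lemma Matrix.le_of_forall_le_add_smul {X Y D : Matrix ι ι ℂ}
    (h : ∀ t : ℝ, 0 < t → X ≤ Y + t • D) : X ≤ Y := by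
  have hc : Tendsto (fun t : ℝ => Y + t • D) (𝓝[>] 0) (𝓝 (Y + (0 : ℝ) • D)) :=
    (Continuous.tendsto (by fun_prop) 0).mono_left nhdsWithin_le_nhds
  rw [zero_smul, add_zero] at hc
  exact ge_of_tendsto hc (eventually_nhdsWithin_of_forall h)

/-- `P` and `R` correspond to each other under `e` if they cut out matching upper sets. -/
def ConeRel (e : PDMatrix ι → PDMatrix ι) (P R : Matrix ι ι ℂ) : Prop :=
  ∀ C : PDMatrix ι, P ≤ C.1 ↔ R ≤ (e C).1

lemma le_of_forall_posDef_le {R R' : Matrix ι ι ℂ} (hR : R.PosSemidef)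
    (h : ∀ C : PDMatrix ι, R ≤ C.1 → R' ≤ C.1) : R' ≤ R :=
  le_of_forall_le_add_smul (D := 1) fun _ ht =>
    h ⟨_, hR.posDef_add_smul_one ht⟩
      (le_add_of_nonneg_right (nonneg_iff_posSemidef.2 (posDef_real_smul_one ht).posSemidef))

lemma ConeRel.unique {e : PDMatrix ι ≃ PDMatrix ι} {P R R' : Matrix ι ι ℂ}
    (hR : R.PosSemidef) (hR' : R'.PosSemidef) (h : ConeRel e P R) (h' : ConeRel e P R') :
    R = R' := by
  have key : ∀ D : PDMatrix ι, R ≤ D.1 ↔ R' ≤ D.1 := fun D => by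
    simpa using (h (e.symm D)).symm.trans (h' (e.symm D))
  exact le_antisymm (le_of_forall_posDef_le hR' fun C => (key C).2)
    (le_of_forall_posDef_le hR fun C => (key C).1)

/-- Positive homogeneity of a map on the cone of positive definite matrices. -/
def PosHomogeneous (e : PDMatrix ι → PDMatrix ι) : Prop :=
  ∀ t : ℝ, 0 < t → ∀ C D : PDMatrix ι, D.1 = t • C.1 → (e D).1 = t • (e C).1

lemma PosHomogeneous.symm {e : PDMatrix ι ≃ PDMatrix ι} (he : PosHomogeneous e) :
    PosHomogeneous e.symm := by
  intro t ht C D hD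
  let D' : PDMatrix ι := ⟨t • (e.symm C).1, (e.symm C).2.smul ht⟩
  have h := he t ht (e.symm C) D' rfl
  rw [e.apply_symm_apply, ← hD] at h
  have : D = e D' := Subtype.ext h.symm
  rw [this, e.symm_apply_apply]

variable {e : PDMatrix ι ≃o PDMatrix ι}

lemma exists_coneRel_of_posSemidef (he : PosHomogeneous e) {P : Matrix ι ι ℂ}
    (hP : P.PosSemidef) :
    ∃ R : Matrix ι ι ℂ, R.PosSemidef ∧ ConeRel e P R ∧
      ∃ (ε : ℕ → ℝ) (C : ℕ → PDMatrix ι), (∀ k, (C k).1 = P + ε k • 1) ∧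
        Tendsto ε atTop (𝓝 0) ∧ Tendsto (fun k => (e (C k)).1) atTop (𝓝 R) := by
  let η : ℕ → ℝ := fun k => 1 / ((k : ℝ) + 1)
  have hη : ∀ k, 0 < η k := fun k => Nat.one_div_pos_of_nat
  let C : ℕ → PDMatrix ι := fun k => ⟨P + η k • 1, hP.posDef_add_smul_one (hη k)⟩
  have hη0 : Tendsto η atTop (𝓝 0) := tendsto_one_div_add_atTop_nhds_zero_nat
  have hone : (0 : Matrix ι ι ℂ) ≤ 1 := zero_le_one
  have hanti : ∀ j k, j ≤ k → (e (C k)).1 ≤ (e (C j)).1 := by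
    intro j k hjk
    refine e.monotone (?_ : (C k).1 ≤ (C j).1)
    exact add_le_add le_rfl (smul_le_smul_of_nonneg_right (Nat.one_div_le_one_div hjk) hone)
  have hnn : ∀ D : PDMatrix ι, 0 ≤ D.1 := fun D => nonneg_iff_posSemidef.2 D.2.posSemidef
  obtain ⟨R, -, θ, hθ, hlim⟩ := tendsto_subseq_of_bounded
    (Metric.isBounded_closedBall (x := (0 : Matrix ι ι ℂ)) (r := ‖(e (C 0)).1‖))
    (x := fun k => (e (C k)).1) fun k => by
      rw [mem_closedBall_zero_iff]
      exact CStarAlgebra.norm_le_norm_of_nonneg_of_le (hnn _) (hanti 0 k k.zero_le)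
  have hR0 : 0 ≤ R := ge_of_tendsto hlim (.of_forall fun k => hnn _)
  have hRle : ∀ k, R ≤ (e (C k)).1 := fun k =>
    le_of_tendsto hlim ((hθ.tendsto_atTop.eventually_ge_atTop k).mono fun j hj => hanti k _ hj)
  refine ⟨R, nonneg_iff_posSemidef.1 hR0, fun D => ⟨fun h => ?_, fun h => ?_⟩, η ∘ θ, C ∘ θ,
    fun k => rfl, hη0.comp hθ.tendsto_atTop, hlim⟩
  · refine le_of_forall_le_add_smul (D := (e D).1) fun t ht => ?_
    obtain ⟨δ, hδ, hδD⟩ := D.2.exists_smul_one_le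
    obtain ⟨k, hk⟩ := (hη0.eventually_le_const (mul_pos ht hδ)).exists
    let D' : PDMatrix ι := ⟨(1 + t) • D.1, D.2.smul (by positivity)⟩
    have hle : C k ≤ D' := by
      change P + η k • 1 ≤ (1 + t) • D.1
      rw [add_smul, one_smul]
      refine add_le_add h ((smul_le_smul_of_nonneg_right hk hone).trans ?_)
      rw [mul_smul]
      exact smul_le_smul_of_nonneg_left hδD ht.le
    have h2 : (e (C k)).1 ≤ (e D').1 := e.monotone hle
    rw [he (1 + t) (by positivity) D D' rfl, add_smul, one_smul] at h2
    exact (hRle k).trans h2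
  · refine le_of_forall_le_add_smul (D := D.1) fun t ht => ?_
    obtain ⟨δ, hδ, hδD⟩ := (e D).2.exists_smul_one_le
    have hev := (Metric.tendsto_nhds.1 hlim) (t * δ) (by positivity)
    obtain ⟨k, hk⟩ := hev.exists
    let D' : PDMatrix ι := ⟨(1 + t) • D.1, D.2.smul (by positivity)⟩
    have h2 : (e (C (θ k))).1 ≤ (e D').1 := by
      rw [he (1 + t) (by positivity) D D' rfl, add_smul, one_smul]
      have h3 : (e (C (θ k))).1 - R ≤ (t * δ) • 1 := by
        have hsa : IsSelfAdjoint ((e (C (θ k))).1 - R) :=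
          (IsSelfAdjoint.of_nonneg (hnn _)).sub (.of_nonneg hR0)
        refine hsa.le_algebraMap_norm_self.trans ?_
        rw [Algebra.algebraMap_eq_smul_one]
        refine smul_le_smul_of_nonneg_right ?_ hone
        rw [Function.comp_apply, dist_eq_norm] at hk
        exact hk.le
      rw [mul_smul] at h3
      have h4 := h3.trans (smul_le_smul_of_nonneg_left hδD ht.le)
      rw [sub_le_iff_le_add'] at h4
      exact h4.trans (add_le_add h le_rfl)
    have h3 : (C (θ k)).1 ≤ D'.1 := e.le_iff_le.1 h2
    have h4 : P ≤ (C (θ k)).1 := le_add_of_nonneg_right (smul_nonneg (hη _).le hone)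
    have h5 := h4.trans h3
    simpa only [D', add_smul, one_smul] using h5

end ConeAutomorphism

section ConeRankOne

open scoped MatrixOrder Matrix.Norms.L2Operator
open Filter Topology

variable {ι : Type*} [Fintype ι] [DecidableEq ι]

omit [DecidableEq ι] in
lemma Matrix.vecMulVec_star_nonneg (x : ι → ℂ) : 0 ≤ vecMulVec x (star x) :=
  nonneg_iff_posSemidef.2 (posSemidef_vecMulVec_self_star x)

lemma Matrix.PosSemidef.exists_vecMulVec_le {R : Matrix ι ι ℂ} (hR : R.PosSemidef) (h0 : R ≠ 0) :
    ∃ z : ι → ℂ, z ≠ 0 ∧ vecMulVec z (star z) ≤ R := by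
  obtain ⟨B, rfl⟩ := CStarAlgebra.nonneg_iff_eq_star_mul_self.1 (nonneg_iff_posSemidef.2 hR)
  obtain ⟨i, hi⟩ : ∃ i, star (B i) ≠ 0 := by
    by_contra! h
    exact h0 (by rw [show B = 0 from funext fun i => star_eq_zero.1 (h i), mul_zero])
  refine ⟨star (B i), hi, ?_⟩
  have : star B * B = ∑ j, vecMulVec (star (B j)) (star (star (B j))) := by
    ext k l
    simp [mul_apply, sum_apply, vecMulVec_apply]
  rw [this]
  exact Finset.single_le_sum (f := fun j => vecMulVec (star (B j)) (star (star (B j))))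
    (fun j _ => vecMulVec_star_nonneg _) (Finset.mem_univ i)

lemma Matrix.PosSemidef.eq_smul_vecMulVec_of_le {P : Matrix ι ι ℂ} (hP : P.PosSemidef) {x : ι → ℂ}
    (hx : x ≠ 0) (h : P ≤ vecMulVec x (star x)) :
    ∃ s : ℝ, 0 ≤ s ∧ P = s • vecMulVec x (star x) := by
  set X := vecMulVec x (star x) with hXdef
  have hP0 := nonneg_iff_posSemidef.2 hP
  have hPs : star P = P := hP.isHermitian
  obtain ⟨N, hN, hNx⟩ : ∃ N : ℝ, 0 < N ∧ star x ⬝ᵥ x = N := by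
    have := dotProduct_star_self_pos_iff.2 hx
    obtain ⟨h1, h2⟩ := Complex.lt_def.1 this
    exact ⟨_, h1, Complex.ext rfl h2.symm⟩
  have hXX : X * X = N • X := by
    rw [hXdef, vecMulVec_mul_vecMulVec, hNx]
    ext i k
    simp [vecMulVec_apply]
    ring
  have hXs : star X = X := (posSemidef_vecMulVec_self_star x).isHermitian
  have hXPX : X * P * X = ((star x ⬝ᵥ P *ᵥ x).re) • X := by
    have hr : star x ⬝ᵥ P *ᵥ x = ((star x ⬝ᵥ P *ᵥ x).re : ℂ) :=
      Complex.ext rfl (by simpa using hP.isHermitian.im_star_dotProduct_mulVec_self x)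
    rw [hXdef, mul_vecMulVec, ← mulVec_mulVec, vecMulVec_mulVec, hr]
    ext i k
    simp [vecMulVec_apply]
    ring
  have hPQ : P * (1 - N⁻¹ • X) = 0 := by
    refine mul_eq_zero_of_conj_le_zero hP0 ((star_left_conjugate_le_conjugate h _).trans_eq ?_)
    have : X * (1 - N⁻¹ • X) = 0 := by
      rw [mul_sub, mul_smul_comm, hXX, smul_smul, inv_mul_cancel₀ hN.ne', one_smul, mul_one,
        sub_self]
    rw [mul_assoc, this, mul_zero]
  have h1 : P = N⁻¹ • (P * X) := by
    rw [mul_sub, mul_smul_comm, mul_one, sub_eq_zero] at hPQ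
    exact hPQ
  have h2 : P = N⁻¹ • (X * P) := by
    have := congrArg star h1
    simpa [hPs, hXs] using this
  refine ⟨N⁻¹ * N⁻¹ * (star x ⬝ᵥ P *ᵥ x).re, ?_, ?_⟩
  · have := (Complex.le_def.1 (hP.dotProduct_mulVec_nonneg x)).1
    exact mul_nonneg (by positivity) this
  · rw [mul_smul, ← hXPX, mul_assoc X, mul_smul, ← mul_smul_comm N⁻¹ X, ← h1, ← h2]

/-- The Schur complement criterion for domination of a rank-one matrix. -/
lemma Matrix.PosDef.vecMulVec_le_iff {C : Matrix ι ι ℂ} (hC : C.PosDef) (x : ι → ℂ) :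
    vecMulVec x (star x) ≤ C ↔ star x ⬝ᵥ C⁻¹ *ᵥ x ≤ 1 := by
  have := hC.isUnit.invertible
  have : Invertible (1 : Matrix Unit Unit ℂ) := invertibleOne
  have h1 := PosDef.fromBlocks₁₁ (replicateCol Unit x) (1 : Matrix Unit Unit ℂ) hC
  have h2 := PosDef.fromBlocks₂₂ C (replicateCol Unit x) (PosDef.one (n := Unit) (R := ℂ))
  rw [h1] at h2
  rw [le_iff]
  have e1 : replicateCol Unit x * (1 : Matrix Unit Unit ℂ)⁻¹ * (replicateCol Unit x)ᴴ =
      vecMulVec x (star x) := by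
    simp [vecMulVec_eq Unit]
  rw [e1] at h2
  rw [← h2]
  have e2 : (1 : Matrix Unit Unit ℂ) - (replicateCol Unit x)ᴴ * C⁻¹ * replicateCol Unit x =
      diagonal fun _ => 1 - star x ⬝ᵥ C⁻¹ *ᵥ x := by
    rw [Matrix.mul_assoc]
    ext i j
    simp [mul_apply, dotProduct, mulVec]
  rw [e2, posSemidef_diagonal_iff]
  simp

lemma Matrix.PosDef.exists_dotProduct_inv_mulVec {C : Matrix ι ι ℂ} (hC : C.PosDef) (x : ι → ℂ) :
    ∃ a : ℝ, 0 ≤ a ∧ star x ⬝ᵥ C⁻¹ *ᵥ x = a := by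
  obtain ⟨h1, h2⟩ := Complex.le_def.1 (hC.inv.posSemidef.dotProduct_mulVec_nonneg x)
  exact ⟨_, h1, Complex.ext rfl h2.symm⟩

variable {e : PDMatrix ι ≃o PDMatrix ι}

lemma ConeRel.dotProduct_inv_mulVec_eq (he : PosHomogeneous e) {x y : ι → ℂ}
    (h : ConeRel e (vecMulVec x (star x)) (vecMulVec y (star y))) (C : PDMatrix ι) :
    star x ⬝ᵥ C.1⁻¹ *ᵥ x = star y ⬝ᵥ (e C).1⁻¹ *ᵥ y := by
  obtain ⟨a, ha, hxa⟩ := C.2.exists_dotProduct_inv_mulVec x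
  obtain ⟨b, hb, hyb⟩ := (e C).2.exists_dotProduct_inv_mulVec y
  have key : ∀ t : ℝ, 0 < t → (a ≤ t ↔ b ≤ t) := by
    intro t ht
    let D : PDMatrix ι := ⟨t • C.1, C.2.smul ht⟩
    have h1 := h D
    rw [D.2.vecMulVec_le_iff, (e D).2.vecMulVec_le_iff, he t ht C D rfl] at h1
    have hinv : ∀ E : Matrix ι ι ℂ, E.PosDef → (t • E)⁻¹ = t⁻¹ • E⁻¹ := by
      intro E hE
      refine inv_eq_left_inv ?_
      rw [smul_mul_smul_comm, inv_mul_cancel₀ ht.ne', one_smul,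
        nonsing_inv_mul _ ((isUnit_iff_isUnit_det _).1 hE.isUnit)]
    rw [hinv _ C.2, hinv _ (e C).2, smul_mulVec, smul_mulVec, dotProduct_smul, dotProduct_smul,
      hxa, hyb] at h1
    simp only [Complex.real_smul, ← Complex.ofReal_mul] at h1
    norm_cast at h1
    rwa [inv_mul_le_iff₀ ht, inv_mul_le_iff₀ ht, mul_one] at h1
  rw [hxa, hyb]
  congr 1
  refine le_antisymm (le_of_forall_gt_imp_ge_of_dense fun t ht => ?_)
    (le_of_forall_gt_imp_ge_of_dense fun t ht => ?_)
  · exact (key t (hb.trans_lt ht)).2 ht.le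
  · exact (key t (ha.trans_lt ht)).1 ht.le

lemma ConeRel.ne_zero {P R : Matrix ι ι ℂ} (hP : P.PosSemidef) (h0 : P ≠ 0)
    (h : ConeRel e P R) : R ≠ 0 := by
  rintro rfl
  have h1 : P ≤ 0 := le_of_forall_posDef_le PosSemidef.zero fun C _ =>
    (h C).2 (nonneg_iff_posSemidef.2 (e C).2.posSemidef)
  exact h0 (le_antisymm h1 (nonneg_iff_posSemidef.2 hP))

lemma exists_coneRel_vecMulVec (he : PosHomogeneous e) (x : ι → ℂ) :
    ∃ y, ConeRel e (vecMulVec x (star x)) (vecMulVec y (star y)) := by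
  rcases eq_or_ne x 0 with rfl | hx
  · refine ⟨0, fun C => ?_⟩
    simp only [star_zero, vecMulVec_zero]
    exact iff_of_true (nonneg_iff_posSemidef.2 C.2.posSemidef)
      (nonneg_iff_posSemidef.2 (e C).2.posSemidef)
  have hX := posSemidef_vecMulVec_self_star x
  have hne : ∀ {x : ι → ℂ}, x ≠ 0 → vecMulVec x (star x) ≠ 0 := by
    intro x hx h
    rcases vecMulVec_eq_zero.1 h with h | h
    · exact hx h
    · exact hx (star_eq_zero.1 h)
  obtain ⟨R, hR, hxR, -⟩ := exists_coneRel_of_posSemidef he hX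
  obtain ⟨z, hz, hzR⟩ := hR.exists_vecMulVec_le (hxR.ne_zero hX (hne hx))
  have he' : PosHomogeneous e.symm := PosHomogeneous.symm (e := e.toEquiv) he
  obtain ⟨P, hP, hzP, -⟩ := exists_coneRel_of_posSemidef he' (posSemidef_vecMulVec_self_star z)
  have hPx : P ≤ vecMulVec x (star x) := le_of_forall_posDef_le hX fun C hC => by
    have := (hzP (e C)).1 (hzR.trans ((hxR C).1 hC))
    rwa [e.symm_apply_apply] at this
  obtain ⟨s, hs, rfl⟩ := hP.eq_smul_vecMulVec_of_le hx hPx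
  have hs0 : s ≠ 0 := by
    rintro rfl
    exact hzP.ne_zero (posSemidef_vecMulVec_self_star z) (hne hz) (zero_smul _ _)
  have hs1 : 0 < s := lt_of_le_of_ne hs hs0.symm
  refine ⟨(√s)⁻¹ • z, fun C => ?_⟩
  let D : PDMatrix ι := ⟨s • C.1, C.2.smul hs1⟩
  have h1 := hzP (e D)
  rw [e.symm_apply_apply, he s hs1 C D rfl] at h1
  have hsq : vecMulVec ((√s)⁻¹ • z) (star ((√s)⁻¹ • z)) =
      s⁻¹ • vecMulVec z (star z) := by
    have h2 : (√s)⁻¹ * (√s)⁻¹ = s⁻¹ := by rw [← mul_inv, Real.mul_self_sqrt hs]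
    ext i k
    simp [← h2, vecMulVec_apply]
    ring
  rw [hsq, inv_smul_le_iff_of_pos hs1, h1]
  exact (smul_le_smul_iff_of_pos_left hs1).symm

lemma ConeRel.symm {P R : Matrix ι ι ℂ} (h : ConeRel e P R) : ConeRel e.symm R P := fun C => by
  simpa using (h (e.symm C)).symm

end ConeRankOne

section ConeLinearisation

open scoped MatrixOrder Matrix.Norms.L2Operator
open Filter Topology

variable {ι : Type*} [Fintype ι] [DecidableEq ι]

lemma Matrix.eq_zero_of_dotProduct_mulVec_self {F : Matrix ι ι ℂ}
    (h : ∀ y, star y ⬝ᵥ F *ᵥ y = 0) : F = 0 := by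
  have := (inner_map_self_eq_zero (toEuclideanLin F)).1 fun y => by
    have h1 := h y.ofLp
    rw [EuclideanSpace.inner_eq_star_dotProduct, dotProduct_comm, star_dotProduct]
    exact star_eq_zero.2 h1
  exact toEuclideanLin.map_eq_zero_iff.1 this

lemma Matrix.posSemidef_iff_forall_nonneg {E : Matrix ι ι ℂ} :
    E.PosSemidef ↔ ∀ x, 0 ≤ star x ⬝ᵥ E *ᵥ x := by
  refine ⟨fun h => h.dotProduct_mulVec_nonneg, fun h => .of_dotProduct_mulVec_nonneg ?_ h⟩
  refine sub_eq_zero.1 (eq_zero_of_dotProduct_mulVec_self fun x => ?_)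
  have h1 : star x ⬝ᵥ Eᴴ *ᵥ x = star (star x ⬝ᵥ E *ᵥ x) := by
    rw [star_dotProduct, star_mulVec, dotProduct_mulVec, conjTranspose_conjTranspose]
  have h2 : star (star x ⬝ᵥ E *ᵥ x) = star x ⬝ᵥ E *ᵥ x := IsSelfAdjoint.of_nonneg (h x)
  rw [sub_mulVec, dotProduct_sub, h1, h2, sub_self]

lemma Matrix.span_posDef : Submodule.span ℂ {E : Matrix ι ι ℂ | E.PosDef} = ⊤ := by
  rw [eq_top_iff, ← CStarAlgebra.span_nonneg, Submodule.span_le]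
  intro E hE
  have h1 : (E + 1).PosDef := PosDef.posSemidef_add (nonneg_iff_posSemidef.1 hE) PosDef.one
  have h2 := Submodule.sub_mem _
    (Submodule.subset_span (R := ℂ) (s := {E : Matrix ι ι ℂ | E.PosDef}) h1)
    (Submodule.subset_span (PosDef.one (n := ι) (R := ℂ)))
  simpa using h2

variable {e : PDMatrix ι ≃o PDMatrix ι}

/-- The pairs of matrices whose quadratic forms agree along the rank-one correspondence of `e`. -/
def rankOneGraph (e : PDMatrix ι → PDMatrix ι) : Submodule ℂ (Matrix ι ι ℂ × Matrix ι ι ℂ) where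
  carrier := {p | ∀ x y, ConeRel e (vecMulVec x (star x)) (vecMulVec y (star y)) →
    star x ⬝ᵥ p.1 *ᵥ x = star y ⬝ᵥ p.2 *ᵥ y}
  add_mem' := fun {p q} hp hq x y hxy => by
    simp only [Prod.fst_add, Prod.snd_add, add_mulVec, dotProduct_add, hp x y hxy, hq x y hxy]
  zero_mem' := fun x y _ => by simp
  smul_mem' := fun c p hp x y hxy => by
    simp only [Prod.smul_fst, Prod.smul_snd, smul_mulVec, dotProduct_smul, hp x y hxy]

lemma mem_rankOneGraph {e : PDMatrix ι → PDMatrix ι} {E F : Matrix ι ι ℂ} :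
    (E, F) ∈ rankOneGraph e ↔ ∀ x y, ConeRel e (vecMulVec x (star x)) (vecMulVec y (star y)) →
      star x ⬝ᵥ E *ᵥ x = star y ⬝ᵥ F *ᵥ y := Iff.rfl

/-- A homogeneous order automorphism of the cone of positive definite matrices becomes linear
after taking inverses. -/
theorem PosHomogeneous.exists_linearEquiv (he : PosHomogeneous e) :
    ∃ χ : Matrix ι ι ℂ ≃ₗ[ℂ] Matrix ι ι ℂ, (∀ E, (χ E).PosSemidef ↔ E.PosSemidef) ∧
      ∀ C : PDMatrix ι, χ C.1⁻¹ = (e C).1⁻¹ := by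
  have hl : ∀ x, ∃ y, ConeRel e (vecMulVec x (star x)) (vecMulVec y (star y)) :=
    exists_coneRel_vecMulVec he
  have hr : ∀ y, ∃ x, ConeRel e (vecMulVec x (star x)) (vecMulVec y (star y)) := fun y => by
    obtain ⟨x, hx⟩ := exists_coneRel_vecMulVec (e := e.symm)
      (PosHomogeneous.symm (e := e.toEquiv) he) y
    exact ⟨x, by simpa using hx.symm⟩
  let G := rankOneGraph e
  have hmem : ∀ C : PDMatrix ι, (C.1⁻¹, (e C).1⁻¹) ∈ G := fun C =>
    mem_rankOneGraph.2 fun x y h => h.dotProduct_inv_mulVec_eq he C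
  have hex : ∀ E, ∃ F, (E, F) ∈ G := by
    have htop : G.map (LinearMap.fst ℂ _ _) = ⊤ := by
      rw [eq_top_iff, ← Matrix.span_posDef, Submodule.span_le]
      intro E hE
      refine ⟨_, hmem ⟨E⁻¹, PosDef.inv hE⟩, ?_⟩
      exact nonsing_inv_nonsing_inv _ ((isUnit_iff_isUnit_det _).1 (PosDef.isUnit hE))
    intro E
    obtain ⟨⟨_, F⟩, hF, rfl⟩ : E ∈ G.map (LinearMap.fst ℂ _ _) := htop ▸ Submodule.mem_top
    exact ⟨F, hF⟩
  have hl0 : ∀ F, (0, F) ∈ G → F = 0 := fun F hF =>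
    eq_zero_of_dotProduct_mulVec_self fun y => by
      obtain ⟨x, hx⟩ := hr y
      simpa using (mem_rankOneGraph.1 hF x y hx).symm
  have hr0 : ∀ E, (E, 0) ∈ G → E = 0 := fun E hE =>
    eq_zero_of_dotProduct_mulVec_self fun x => by
      obtain ⟨y, hy⟩ := hl x
      simpa using mem_rankOneGraph.1 hE x y hy
  have huniq : ∀ E F F', (E, F) ∈ G → (E, F') ∈ G → F = F' := fun E F F' h h' =>
    sub_eq_zero.1 (hl0 _ (by simpa using G.sub_mem h h'))
  obtain ⟨χ, hχ⟩ : ∃ χ : Matrix ι ι ℂ →ₗ[ℂ] Matrix ι ι ℂ, ∀ E, (E, χ E) ∈ G := by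
    choose χ hχ using hex
    refine ⟨⟨⟨χ, fun E F => huniq _ _ _ (hχ _) ?_⟩, fun c E => huniq _ _ _ (hχ _) ?_⟩, hχ⟩
    · simpa using G.add_mem (hχ E) (hχ F)
    · simpa using G.smul_mem c (hχ E)
  have hinj : Function.Injective χ := by
    rw [← LinearMap.ker_eq_bot, LinearMap.ker_eq_bot']
    intro E hE
    exact hr0 E (hE ▸ hχ E)
  refine ⟨LinearEquiv.ofInjectiveEndo χ hinj, fun E => ?_, fun C => ?_⟩
  · rw [LinearEquiv.coe_ofInjectiveEndo, posSemidef_iff_forall_nonneg,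
      posSemidef_iff_forall_nonneg]
    refine ⟨fun h x => ?_, fun h y => ?_⟩
    · obtain ⟨y, hy⟩ := hl x
      rw [mem_rankOneGraph.1 (hχ E) x y hy]
      exact h y
    · obtain ⟨x, hx⟩ := hr y
      rw [← mem_rankOneGraph.1 (hχ E) x y hx]
      exact h x
  · rw [LinearEquiv.coe_ofInjectiveEndo]
    exact huniq _ _ _ (hχ _) (hmem C)

/-- Every rank-one matrix is, up to a small perturbation, the image of a rank-one matrix. -/
lemma PosHomogeneous.exists_tendsto_vecMulVec (he : PosHomogeneous e) (y : ι → ℂ) :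
    ∃ x : ι → ℂ, (∀ C : PDMatrix ι, star x ⬝ᵥ C.1⁻¹ *ᵥ x = star y ⬝ᵥ (e C).1⁻¹ *ᵥ y) ∧
      ∃ C : ℕ → PDMatrix ι, Tendsto (fun k => (C k).1) atTop (𝓝 (vecMulVec x (star x))) ∧
        Tendsto (fun k => (e (C k)).1) atTop (𝓝 (vecMulVec y (star y))) := by
  obtain ⟨x, hx⟩ := exists_coneRel_vecMulVec (e := e.symm)
    (PosHomogeneous.symm (e := e.toEquiv) he) y
  have hxy := ConeRel.symm hx
  rw [OrderIso.symm_symm] at hxy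
  refine ⟨x, hxy.dotProduct_inv_mulVec_eq he, ?_⟩
  obtain ⟨R, hR, hxR, ε, C, hC, hε, hlim⟩ :=
    exists_coneRel_of_posSemidef he (posSemidef_vecMulVec_self_star x)
  obtain rfl := ConeRel.unique (e := e.toEquiv) hR (posSemidef_vecMulVec_self_star y) hxR hxy
  refine ⟨C, ?_, hlim⟩
  simp only [hC]
  simpa using tendsto_const_nhds.add (hε.smul_const (1 : Matrix ι ι ℂ))

end ConeLinearisation

section RpowConj

open scoped MatrixOrder Matrix.Norms.L2Operator
open Filter Topology

variable {ι : Type*} [Fintype ι] [DecidableEq ι]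

lemma Matrix.PosDef.rpow {A : Matrix ι ι ℂ} (hA : A.PosDef) (t : ℝ) : (A ^ t).PosDef :=
  isStrictlyPositive_iff_posDef.1 (IsStrictlyPositive.rpow A t (isStrictlyPositive_iff_posDef.2 hA))

lemma Matrix.PosDef.rpow_rpow_inv {A : Matrix ι ι ℂ} (hA : A.PosDef) {t : ℝ} (ht : t ≠ 0) :
    (A ^ t) ^ t⁻¹ = A := by
  have h := nonneg_iff_posSemidef.2 hA.posSemidef
  rw [CFC.rpow_rpow A t t⁻¹ ht, mul_inv_cancel₀ ht, CFC.rpow_one A]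

/-- Real powers as a permutation of the cone of positive definite matrices. -/
noncomputable def pdRpow (t : ℝ) (ht : t ≠ 0) : PDMatrix ι ≃ PDMatrix ι where
  toFun A := ⟨A.1 ^ t, A.2.rpow t⟩
  invFun A := ⟨A.1 ^ t⁻¹, A.2.rpow t⁻¹⟩
  left_inv A := Subtype.ext (A.2.rpow_rpow_inv ht)
  right_inv A := Subtype.ext (by simpa using A.2.rpow_rpow_inv (inv_ne_zero ht))

lemma Matrix.PosDef.unitary_conj {A U : Matrix ι ι ℂ} (hA : A.PosDef) (hU : U ∈ unitaryGroup ι ℂ) :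
    (U * A * star U).PosDef := by
  have hU' : IsUnit (star U) := Unitary.isUnit_coe (U := star (⟨U, hU⟩ : unitary _))
  simpa [star_eq_conjTranspose] using
    hA.conjTranspose_mul_mul_same (mulVec_injective_of_isUnit hU')

lemma unitary_conj_rpow {A U : Matrix ι ι ℂ} (hA : A.PosDef) (hU : U ∈ unitaryGroup ι ℂ) (t : ℝ) :
    (U * A * star U) ^ t = U * A ^ t * star U := by
  have hfin : (spectrum ℝ A).Finite := Matrix.finite_real_spectrum
  rw [CFC.rpow_eq_cfc_real (nonneg_iff_posSemidef.2 hA.posSemidef),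
    CFC.rpow_eq_cfc_real (nonneg_iff_posSemidef.2 (hA.unitary_conj hU).posSemidef)]
  have := StarAlgHomClass.map_cfc (R := ℝ) (Unitary.conjStarAlgAut ℂ _ (⟨U, hU⟩ : unitary _))
    (fun x : ℝ => x ^ t) A (hfin.continuousOn _) (by
      exact LinearMap.continuous_of_finiteDimensional
        (Unitary.conjStarAlgAut ℂ _ (⟨U, hU⟩ : unitary (Matrix ι ι ℂ))).toAlgEquiv.toLinearMap)
      hA.isHermitian (hA.unitary_conj hU).isHermitian
  exact this.symm

lemma transpose_rpow {A : Matrix ι ι ℂ} (hA : A.PosDef) (t : ℝ) : (Aᵀ) ^ t = (A ^ t)ᵀ := by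
  have hfin : (spectrum ℝ A).Finite := Matrix.finite_real_spectrum
  let f : Matrix ι ι ℂ →⋆ₐ[ℝ] Matrix ι ι ℂ :=
    { (Complex.conjAe.toAlgHom).mapMatrix with
      map_star' := fun X => by ext i j; simp [star_apply] }
  have hf : ∀ {X : Matrix ι ι ℂ}, X.IsHermitian → f X = Xᵀ := fun {X} hX => by
    conv_lhs => rw [← hX]
    ext i j
    simp [f]
  have hf1 : f A = Aᵀ := hf hA.isHermitian
  rw [← hf hA.isHermitian, ← hf (hA.rpow t).isHermitian]
  rw [CFC.rpow_eq_cfc_real (nonneg_iff_posSemidef.2 hA.posSemidef),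
    CFC.rpow_eq_cfc_real (hf1 ▸ nonneg_iff_posSemidef.2 hA.transpose.posSemidef)]
  exact (StarAlgHomClass.map_cfc (R := ℝ) f
    (fun x : ℝ => x ^ t) A (hfin.continuousOn _) (by
      exact LinearMap.continuous_of_finiteDimensional f.toAlgHom.toLinearMap)
      hA.isHermitian (hf1 ▸ hA.transpose.isHermitian)).symm

end RpowConj

section SandwichedTrace

open scoped MatrixOrder Matrix.Norms.L2Operator
open Filter Topology

variable {ι : Type*} [Fintype ι] [DecidableEq ι]

/-- The functional `tr (A ^ (1/2) C A ^ (1/2)) ^ α`. -/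
noncomputable def sandwich (α : ℝ) (A C : Matrix ι ι ℂ) : ℝ :=
  traceRpow α (A ^ (1 / 2 : ℝ) * C * A ^ (1 / 2 : ℝ))

lemma Matrix.PosDef.rpow_mul_rpow_self {A : Matrix ι ι ℂ} (hA : A.PosDef) (t : ℝ) :
    A ^ t * A ^ t = A ^ (2 * t) := by
  rw [two_mul, CFC.rpow_add hA.isUnit]

lemma traceRpow_rpow_mul_mul_rpow {A B : Matrix ι ι ℂ} (hA : A.PosDef) (hB : B.PosDef)
    (α s : ℝ) : traceRpow α (B ^ s * A * B ^ s) = sandwich α A (B ^ (2 * s)) := by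
  have h := traceRpow_mul_comm (A ^ (1 / 2 : ℝ) * B ^ s) α
  have hA1 : (A ^ (1 / 2 : ℝ))ᴴ = A ^ (1 / 2 : ℝ) := (hA.rpow _).isHermitian
  have hB1 : (B ^ s)ᴴ = B ^ s := (hB.rpow _).isHermitian
  have hA2 : A ^ (1 / 2 : ℝ) * A ^ (1 / 2 : ℝ) = A := by
    rw [hA.rpow_mul_rpow_self, show (2 : ℝ) * (1 / 2) = 1 by norm_num,
      CFC.rpow_one A (ha := nonneg_iff_posSemidef.2 hA.posSemidef)]
  rw [conjTranspose_mul, hA1, hB1] at h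
  rw [sandwich, ← hB.rpow_mul_rpow_self]
  convert h using 2
  · rw [mul_assoc (B ^ s) (A ^ (1 / 2 : ℝ)), ← mul_assoc (A ^ (1 / 2 : ℝ)) (A ^ (1 / 2 : ℝ)), hA2,
      mul_assoc]
  · simp only [mul_assoc]

lemma sandwich_mono {α : ℝ} (hα : 0 < α) {A C D : Matrix ι ι ℂ} (hA : A.PosDef) (hC : 0 ≤ C)
    (h : C ≤ D) : sandwich α A C ≤ sandwich α A D := by
  have hA1 : star (A ^ (1 / 2 : ℝ)) = A ^ (1 / 2 : ℝ) := (hA.rpow _).isHermitian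
  refine traceRpow_mono hα ?_ ?_
  · simpa only [hA1] using star_left_conjugate_nonneg hC (A ^ (1 / 2 : ℝ))
  · simpa only [hA1] using star_left_conjugate_le_conjugate h (A ^ (1 / 2 : ℝ))

lemma sandwich_smul {α : ℝ} {A C : Matrix ι ι ℂ} (hA : A.PosDef) (hC : 0 ≤ C) {t : ℝ}
    (ht : 0 ≤ t) : sandwich α A (t • C) = t ^ α * sandwich α A C := by
  have hA1 : star (A ^ (1 / 2 : ℝ)) = A ^ (1 / 2 : ℝ) := (hA.rpow _).isHermitian
  rw [sandwich, mul_smul_comm, smul_mul_assoc, traceRpow_smul _ ht, sandwich]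
  simpa only [hA1] using star_left_conjugate_nonneg hC (A ^ (1 / 2 : ℝ))

lemma sandwich_pos [Nonempty ι] {α : ℝ} {A C : Matrix ι ι ℂ} (hA : A.PosDef) (hC : C.PosDef) :
    0 < sandwich α A C := by
  have hA1 : (A ^ (1 / 2 : ℝ))ᴴ = A ^ (1 / 2 : ℝ) := (hA.rpow _).isHermitian
  refine traceRpow_pos ?_ α
  have := hC.conjTranspose_mul_mul_same (B := A ^ (1 / 2 : ℝ))
    (mulVec_injective_of_isUnit (hA.rpow _).isUnit)
  rwa [hA1] at this

lemma traceRpow_mul_vecMulVec_mul {α : ℝ} (hα : 0 < α) {S : Matrix ι ι ℂ} (hS : S.IsHermitian)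
    (y : ι → ℂ) : traceRpow α (S * vecMulVec y (star y) * S) =
      (star y ⬝ᵥ (S * S) *ᵥ y).re ^ α := by
  have : S * vecMulVec y (star y) * S = vecMulVec (S *ᵥ y) (star (S *ᵥ y)) := by
    rw [mul_vecMulVec, vecMulVec_mul, star_mulVec, hS]
  rw [this, traceRpow_vecMulVec _ hα, star_mulVec, hS, ← dotProduct_mulVec, mulVec_mulVec]

/-- The family of functionals `sandwich α A` determines the order. -/
lemma le_of_forall_sandwich_le {α : ℝ} (hα : 0 < α) {C D : Matrix ι ι ℂ} (hC : C.PosDef)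
    (hD : D.PosDef) (h : ∀ A : PDMatrix ι, sandwich α A.1 C ≤ sandwich α A.1 D) : C ≤ D := by
  have hswap : ∀ {C : Matrix ι ι ℂ}, C.PosDef → ∀ A : PDMatrix ι,
      sandwich α A.1 C = traceRpow α (C ^ (1 / 2 : ℝ) * A.1 * C ^ (1 / 2 : ℝ)) := fun hC A => by
    rw [traceRpow_rpow_mul_mul_rpow A.2 hC, show (2 : ℝ) * (1 / 2) = 1 by norm_num,
      CFC.rpow_one _ (ha := nonneg_iff_posSemidef.2 hC.posSemidef)]
  rw [le_iff, posSemidef_iff_forall_nonneg]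
  intro x
  have hX := posSemidef_vecMulVec_self_star x
  let A : ℕ → PDMatrix ι := fun k =>
    ⟨vecMulVec x (star x) + (1 / ((k : ℝ) + 1)) • 1, hX.posDef_add_smul_one Nat.one_div_pos_of_nat⟩
  have hA : Tendsto (fun k => (A k).1) atTop (𝓝 (vecMulVec x (star x))) := by
    have h0 : Tendsto (fun k : ℕ => 1 / ((k : ℝ) + 1)) atTop (𝓝 0) :=
      tendsto_one_div_add_atTop_nhds_zero_nat
    simpa [A] using (tendsto_const_nhds (x := vecMulVec x (star x))).add
      (h0.smul_const (1 : Matrix ι ι ℂ))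
  have hlim : ∀ {C : Matrix ι ι ℂ}, C.PosDef → Tendsto (fun k => sandwich α (A k).1 C) atTop
      (𝓝 ((star x ⬝ᵥ C *ᵥ x).re ^ α)) := by
    intro C hC
    have hS := (hC.rpow (1 / 2)).isHermitian
    have hS' : star (C ^ (1 / 2 : ℝ)) = C ^ (1 / 2 : ℝ) := hS
    have h1 := traceRpow_mul_vecMulVec_mul hα hS x
    rw [hC.rpow_mul_rpow_self, show (2 : ℝ) * (1 / 2) = 1 by norm_num,
      CFC.rpow_one _ (ha := nonneg_iff_posSemidef.2 hC.posSemidef)] at h1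
    simp only [hswap hC, ← h1]
    refine tendsto_traceRpow hα (fun k => ?_) ?_
      ((tendsto_const_nhds.mul hA).mul tendsto_const_nhds)
    · simpa only [hS'] using star_left_conjugate_nonneg
        (nonneg_iff_posSemidef.2 (A k).2.posSemidef) (C ^ (1 / 2 : ℝ))
    · simpa only [hS'] using star_left_conjugate_nonneg
        (nonneg_iff_posSemidef.2 hX) (C ^ (1 / 2 : ℝ))
  have hle := le_of_tendsto_of_tendsto' (hlim hC) (hlim hD) fun k => h (A k)
  obtain ⟨c1, c2⟩ := Complex.le_def.1 (hC.posSemidef.dotProduct_mulVec_nonneg x)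
  obtain ⟨d1, d2⟩ := Complex.le_def.1 (hD.posSemidef.dotProduct_mulVec_nonneg x)
  rw [Real.rpow_le_rpow_iff c1 d1 hα] at hle
  rw [sub_mulVec, dotProduct_sub, sub_nonneg, Complex.le_def]
  exact ⟨hle, c2.symm.trans d2⟩

end SandwichedTrace

section RenyiPreservers

open scoped MatrixOrder Matrix.Norms.L2Operator
open Filter Topology

variable {ι : Type*} [Fintype ι] [DecidableEq ι]

omit [DecidableEq ι] in
lemma Matrix.PosDef.re_trace_pos [Nonempty ι] {A : Matrix ι ι ℂ} (hA : A.PosDef) :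
    0 < A.trace.re :=
  (Complex.lt_def.1 hA.trace_pos).1

section

variable {α : ℝ} {φ ψ : PDMatrix ι ≃ PDMatrix ι}

lemma le_iff_le_of_sandwich_mul_trace [Nonempty ι] (hα : 0 < α)
    (h : ∀ A C : PDMatrix ι, sandwich α (φ A).1 (ψ C).1 * A.1.trace.re =
      sandwich α A.1 C.1 * (φ A).1.trace.re) {C D : PDMatrix ι} : ψ C ≤ ψ D ↔ C ≤ D := by
  have key : ∀ A : PDMatrix ι, sandwich α (φ A).1 (ψ C).1 ≤ sandwich α (φ A).1 (ψ D).1 ↔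
      sandwich α A.1 C.1 ≤ sandwich α A.1 D.1 := fun A => by
    rw [← mul_le_mul_iff_left₀ A.2.re_trace_pos, h, h, mul_le_mul_iff_left₀ (φ A).2.re_trace_pos]
  constructor
  · exact fun hle => le_of_forall_sandwich_le hα C.2 D.2 fun A => (key A).1 <|
      sandwich_mono hα (φ A).2 (nonneg_iff_posSemidef.2 (ψ C).2.posSemidef) hle
  · refine fun hle => le_of_forall_sandwich_le hα (ψ C).2 (ψ D).2 fun A => ?_
    obtain ⟨A, rfl⟩ := φ.surjective A
    exact (key A).2 <| sandwich_mono hα A.2 (nonneg_iff_posSemidef.2 C.2.posSemidef) hle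

lemma posHomogeneous_of_sandwich_mul_trace [Nonempty ι] (hα : 0 < α)
    (h : ∀ A C : PDMatrix ι, sandwich α (φ A).1 (ψ C).1 * A.1.trace.re =
      sandwich α A.1 C.1 * (φ A).1.trace.re) : PosHomogeneous ψ := by
  intro t ht C D hD
  have key : ∀ A : PDMatrix ι, sandwich α A.1 (ψ D).1 = sandwich α A.1 (t • (ψ C).1) := by
    intro A
    obtain ⟨A, rfl⟩ := φ.surjective A
    refine mul_right_cancel₀ A.2.re_trace_pos.ne' ?_
    rw [h, hD, sandwich_smul A.2 (nonneg_iff_posSemidef.2 C.2.posSemidef) ht.le,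
      sandwich_smul (φ A).2 (nonneg_iff_posSemidef.2 (ψ C).2.posSemidef) ht.le, mul_assoc,
      mul_assoc, h]
  have htC := (ψ C).2.smul ht
  exact le_antisymm (le_of_forall_sandwich_le hα (ψ D).2 htC fun A => (key A).le)
    (le_of_forall_sandwich_le hα htC (ψ D).2 fun A => (key A).ge)

end

lemma smul_rpow_one {t : ℝ} (ht : 0 ≤ t) (r : ℝ) :
    (t • (1 : Matrix ι ι ℂ)) ^ r = t ^ r • (1 : Matrix ι ι ℂ) := by
  rw [smul_rpow (nonneg_iff_posSemidef.2 PosSemidef.one) ht, CFC.one_rpow]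

lemma tendsto_sandwich {α : ℝ} (hα : 0 < α) {A X : Matrix ι ι ℂ} (hA : A.PosDef)
    {C : ℕ → PDMatrix ι} (hX : X.PosSemidef) (h : Tendsto (fun k => (C k).1) atTop (𝓝 X)) :
    Tendsto (fun k => sandwich α A (C k).1) atTop (𝓝 (sandwich α A X)) := by
  have hA1 : star (A ^ (1 / 2 : ℝ)) = A ^ (1 / 2 : ℝ) := (hA.rpow _).isHermitian
  refine tendsto_traceRpow hα (fun k => ?_) ?_ ((tendsto_const_nhds.mul h).mul tendsto_const_nhds)
  · simpa only [hA1] using star_left_conjugate_nonneg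
      (nonneg_iff_posSemidef.2 (C k).2.posSemidef) (A ^ (1 / 2 : ℝ))
  · simpa only [hA1] using star_left_conjugate_nonneg
      (nonneg_iff_posSemidef.2 hX) (A ^ (1 / 2 : ℝ))

lemma sandwich_vecMulVec {α : ℝ} (hα : 0 < α) {A : Matrix ι ι ℂ} (hA : A.PosDef) (x : ι → ℂ) :
    sandwich α A (vecMulVec x (star x)) = (star x ⬝ᵥ A *ᵥ x).re ^ α := by
  rw [sandwich, traceRpow_mul_vecMulVec_mul hα (hA.rpow _).isHermitian, hA.rpow_mul_rpow_self,
    show (2 : ℝ) * (1 / 2) = 1 by norm_num,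
    CFC.rpow_one A (ha := nonneg_iff_posSemidef.2 hA.posSemidef)]

omit [DecidableEq ι] in
lemma dotProduct_mulVec_eq_re {A : Matrix ι ι ℂ} (hA : A.PosDef) (x : ι → ℂ) :
    star x ⬝ᵥ A *ᵥ x = ((star x ⬝ᵥ A *ᵥ x).re : ℂ) := by
  have := (Complex.le_def.1 (hA.posSemidef.dotProduct_mulVec_nonneg x)).2
  exact Complex.ext rfl (by simpa using this.symm)

/-- If `ψ` is induced by `φ` on powers, then `φ` maps the identity to a scalar matrix. -/
lemma exists_map_one_eq_smul_one [Nonempty ι] {α σ : ℝ} (hα : 0 < α) (hσ : 1 + σ = α⁻¹)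
    {φ : PDMatrix ι ≃ PDMatrix ι} {ψ : PDMatrix ι ≃o PDMatrix ι} (hψ : PosHomogeneous ψ)
    (hφψ : ∀ A B : PDMatrix ι, B.1 = A.1 ^ σ → (ψ B).1 = (φ A).1 ^ σ)
    (h : ∀ A C : PDMatrix ι, sandwich α (φ A).1 (ψ C).1 * A.1.trace.re =
      sandwich α A.1 C.1 * (φ A).1.trace.re) :
    ∃ c : ℝ, 0 < c ∧ ∀ A : PDMatrix ι, A.1 = 1 → (φ A).1 = c • (1 : Matrix ι ι ℂ) := by
  let I : PDMatrix ι := ⟨1, PosDef.one⟩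
  set T := (φ I).1 with hT
  have hTp : T.PosDef := (φ I).2
  have hI : (ψ I).1 = T ^ σ := hφψ I I (CFC.one_rpow (A := Matrix ι ι ℂ)).symm
  have hn := (PosDef.one (n := ι) (R := ℂ)).re_trace_pos
  set k : ℝ := (T.trace.re / (1 : Matrix ι ι ℂ).trace.re) ^ α⁻¹ with hk
  have hq : 0 < T.trace.re / (1 : Matrix ι ι ℂ).trace.re := div_pos hTp.re_trace_pos hn
  have hk0 : 0 < k := Real.rpow_pos_of_pos hq _
  have key : ∀ y, (star y ⬝ᵥ T *ᵥ y) = k * (star y ⬝ᵥ (T ^ σ)⁻¹ *ᵥ y) := by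
    intro y
    obtain ⟨x, hx, C, hC, hD⟩ := hψ.exists_tendsto_vecMulVec y
    have h1 := (tendsto_sandwich hα hTp (posSemidef_vecMulVec_self_star y) hD).mul_const
      (1 : Matrix ι ι ℂ).trace.re
    have h2 := (tendsto_sandwich hα PosDef.one (posSemidef_vecMulVec_self_star x) hC).mul_const
      T.trace.re
    have h3 := tendsto_nhds_unique h1 (h2.congr fun k => (h I (C k)).symm)
    rw [sandwich_vecMulVec hα hTp, sandwich_vecMulVec hα PosDef.one] at h3
    have h4 := hx I
    rw [hI] at h4
    simp only [I, inv_one] at h4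
    have hp1 := (Complex.le_def.1 (hTp.posSemidef.dotProduct_mulVec_nonneg y)).1
    have hp2 := (Complex.le_def.1
      ((PosDef.one (n := ι) (R := ℂ)).posSemidef.dotProduct_mulVec_nonneg x)).1
    rw [← h4, dotProduct_mulVec_eq_re hTp, dotProduct_mulVec_eq_re PosDef.one x,
      ← Complex.ofReal_mul]
    congr 1
    rw [Complex.zero_re] at hp1 hp2
    rw [← Real.rpow_left_inj hp1 (mul_nonneg hk0.le hp2) hα.ne', Real.mul_rpow hk0.le hp2, hk,
      ← Real.rpow_mul hq.le, inv_mul_cancel₀ hα.ne', Real.rpow_one]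
    field_simp
    linarith
  have hTk : T = k • (T ^ σ)⁻¹ := by
    refine sub_eq_zero.1 (eq_zero_of_dotProduct_mulVec_self fun y => ?_)
    rw [sub_mulVec, dotProduct_sub, key, smul_mulVec, dotProduct_smul, Complex.real_smul, sub_self]
  have hpow : T ^ α⁻¹ = k • (1 : Matrix ι ι ℂ) := by
    have hu := (hTp.rpow σ).isUnit
    rw [← hσ, CFC.rpow_add hTp.isUnit,
      CFC.rpow_one T (ha := nonneg_iff_posSemidef.2 hTp.posSemidef)]
    nth_rewrite 1 [hTk]
    rw [smul_mul_assoc, nonsing_inv_mul _ ((isUnit_iff_isUnit_det _).1 hu)]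
  refine ⟨k ^ α, Real.rpow_pos_of_pos hk0 _, fun A hA => ?_⟩
  obtain rfl : A = I := Subtype.ext hA
  have := hTp.rpow_rpow_inv (inv_ne_zero hα.ne')
  rw [hpow, inv_inv, smul_rpow_one hk0.le] at this
  exact this.symm

lemma eq_smul_of_rpow_eq {X Y : Matrix ι ι ℂ} (hX : X.PosDef) (hY : Y.PosDef) {σ c : ℝ}
    (hσ : σ ≠ 0) (hc : 0 < c) (h : X ^ σ = c ^ σ • Y ^ σ) : X = c • Y := by
  rw [← smul_rpow (nonneg_iff_posSemidef.2 hY.posSemidef) hc.le] at h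
  rw [← hX.rpow_rpow_inv hσ, h, (hY.smul hc).rpow_rpow_inv hσ]

lemma inv_unitary_conj {U X : Matrix ι ι ℂ} (hU : U ∈ unitaryGroup ι ℂ) :
    (U * X * star U)⁻¹ = U * X⁻¹ * star U := by
  have h1 : (star U)⁻¹ = U := inv_eq_left_inv (mem_unitaryGroup_iff.1 hU)
  have h2 : U⁻¹ = star U := inv_eq_left_inv (mem_unitaryGroup_iff'.1 hU)
  rw [Matrix.mul_inv_rev, Matrix.mul_inv_rev, h1, h2, mul_assoc]

/-- Preservers of the normalised traces `tr (A ^ (1/2) B ^ σ A ^ (1/2)) ^ α / tr A`. -/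
theorem exists_unitaryGroup_of_sandwich_mul_trace [Nonempty ι] {α σ : ℝ} (hα : 0 < α)
    (hσ : 1 + σ = α⁻¹) (hσ0 : σ ≠ 0) (φ : PDMatrix ι ≃ PDMatrix ι)
    (h : ∀ A B : PDMatrix ι, sandwich α (φ A).1 ((φ B).1 ^ σ) * A.1.trace.re =
      sandwich α A.1 (B.1 ^ σ) * (φ A).1.trace.re) :
    ∃ c : ℝ, 0 < c ∧ ∃ U ∈ unitaryGroup ι ℂ,
      (∀ A : PDMatrix ι, (φ A).1 = c • (U * A.1 * star U)) ∨
      (∀ A : PDMatrix ι, (φ A).1 = c • (U * A.1ᵀ * star U)) := by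
  let ψ₀ : PDMatrix ι ≃ PDMatrix ι := (pdRpow σ hσ0).symm.trans (φ.trans (pdRpow σ hσ0))
  have hφψ : ∀ A B : PDMatrix ι, B.1 = A.1 ^ σ → (ψ₀ B).1 = (φ A).1 ^ σ := fun A B hB => by
    obtain rfl : B = pdRpow σ hσ0 A := Subtype.ext hB
    simp only [ψ₀, Equiv.trans_apply, Equiv.symm_apply_apply]
    rfl
  have hH : ∀ A C : PDMatrix ι, sandwich α (φ A).1 (ψ₀ C).1 * A.1.trace.re =
      sandwich α A.1 C.1 * (φ A).1.trace.re := fun A C => by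
    obtain ⟨B, rfl⟩ := (pdRpow σ hσ0).surjective C
    rw [hφψ B _ rfl]
    exact h A B
  have hhom := posHomogeneous_of_sandwich_mul_trace hα hH
  let ψ : PDMatrix ι ≃o PDMatrix ι := ⟨ψ₀, le_iff_le_of_sandwich_mul_trace hα hH⟩
  obtain ⟨c, hc, hφ1⟩ := exists_map_one_eq_smul_one (ψ := ψ) hα hσ hhom hφψ hH
  obtain ⟨χ, hpos, hχ⟩ := PosHomogeneous.exists_linearEquiv (e := ψ) hhom
  have hcσ : 0 < c ^ σ := Real.rpow_pos_of_pos hc σ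
  let I : PDMatrix ι := ⟨1, PosDef.one⟩
  have hχ1 : χ 1 = (c ^ σ)⁻¹ • (1 : Matrix ι ι ℂ) := by
    have h1 := hχ I
    rw [show (ψ I).1 = (φ I).1 ^ σ from hφψ I I (CFC.one_rpow (A := Matrix ι ι ℂ)).symm,
      hφ1 I rfl, smul_rpow_one hc.le] at h1
    simp only [I, inv_one] at h1
    rw [h1]
    refine inv_eq_left_inv ?_
    rw [smul_mul_smul_comm, inv_mul_cancel₀ hcσ.ne', one_smul, one_mul]
  let χ' := χ.trans (LinearEquiv.smulOfNeZero ℂ (Matrix ι ι ℂ) ((c ^ σ : ℝ) : ℂ)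
    (by exact_mod_cast hcσ.ne'))
  have hχ' : ∀ E, χ' E = (c ^ σ : ℝ) • χ E := fun E => by
    ext i j
    simp [χ']
  obtain ⟨U, hU, hUχ⟩ := χ'.exists_unitaryGroup_of_posSemidef_iff
    (by rw [hχ', hχ1, smul_smul, mul_inv_cancel₀ hcσ.ne', one_smul])
    (fun E => by
      rw [hχ', ← hpos E]
      refine ⟨fun hE => ?_, fun hE => hE.smul hcσ.le⟩
      simpa [smul_smul, inv_mul_cancel₀ hcσ.ne'] using hE.smul (inv_pos.2 hcσ).le)
  have hkey : ∀ (B : PDMatrix ι) (X : Matrix ι ι ℂ), χ' (B.1 ^ σ)⁻¹ = U * X⁻¹ * star U → X.PosDef →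
      (φ B).1 ^ σ = c ^ σ • (U * X * star U) := by
    intro B X hX hXp
    have hψB : (ψ (pdRpow σ hσ0 B)).1 = (φ B).1 ^ σ := hφψ B _ rfl
    have h2 := hχ (pdRpow σ hσ0 B)
    change χ (B.1 ^ σ)⁻¹ = _ at h2
    rw [hχ', h2, hψB, ← inv_unitary_conj hU] at hX
    have hdet : ∀ {Y : Matrix ι ι ℂ}, Y.PosDef → IsUnit Y.det := fun hY =>
      (isUnit_iff_isUnit_det _).1 hY.isUnit
    have hYp := (φ B).2.rpow σ
    have hZp := hXp.unitary_conj hU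
    rw [← one_mul (U * X * star U), ← mul_nonsing_inv _ (hdet hYp), mul_assoc, ← mul_smul_comm,
      ← smul_mul_assoc, hX, nonsing_inv_mul _ (hdet hZp), mul_one]
  refine ⟨c, hc, U, hU, hUχ.imp (fun hE B => ?_) fun hE B => ?_⟩
  · refine eq_smul_of_rpow_eq (φ B).2 (B.2.unitary_conj hU) hσ0 hc ?_
    rw [unitary_conj_rpow B.2 hU]
    exact hkey B _ (hE _) (B.2.rpow σ)
  · refine eq_smul_of_rpow_eq (φ B).2 (B.2.transpose.unitary_conj hU) hσ0 hc ?_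
    rw [unitary_conj_rpow B.2.transpose hU, transpose_rpow B.2]
    exact hkey B _ (by rw [hE, transpose_nonsing_inv]) (B.2.rpow σ).transpose

lemma rpowMat_eq_rpow {n : ℕ} {A : Matrix (Fin n) (Fin n) ℂ} (hA : A.PosSemidef) (r : ℝ) :
    rpowMat A r = A ^ r := by
  rw [rpowMat, matFun, dif_pos hA.isHermitian, CFC.rpow_eq_cfc_real (nonneg_iff_posSemidef.2 hA),
    hA.isHermitian.cfc_eq]

lemma DalphaPD_eq {n : ℕ} {α : ℝ} (hα : 0 < α) {A B : Matrix (Fin n) (Fin n) ℂ} (hA : A.PosDef)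
    (hB : B.PosDef) : DalphaPD α A B =
      (α - 1)⁻¹ * Real.log (A.trace.re⁻¹ * sandwich α A (B ^ ((1 - α) / α))) := by
  have hs := hB.rpow ((1 - α) / (2 * α))
  have hs' : star (B ^ ((1 - α) / (2 * α))) = B ^ ((1 - α) / (2 * α)) := hs.isHermitian
  have hp : (B ^ ((1 - α) / (2 * α)) * A * B ^ ((1 - α) / (2 * α))).PosSemidef := by
    simpa only [hs'] using nonneg_iff_posSemidef.1 (star_left_conjugate_nonneg
      (nonneg_iff_posSemidef.2 hA.posSemidef) (B ^ ((1 - α) / (2 * α))))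
  have h2 := traceRpow_rpow_mul_mul_rpow hA hB α ((1 - α) / (2 * α))
  rw [show 2 * ((1 - α) / (2 * α)) = (1 - α) / α by field_simp] at h2
  rw [DalphaPD, rpowMat_eq_rpow hB.posSemidef, rpowMat_eq_rpow hp, ← h2]
  rfl

lemma sandwich_mul_trace_of_DalphaPD_eq {n : ℕ} [NeZero n] {α : ℝ} (hα : 0 < α) (hα1 : α ≠ 1)
    {A B C D : PDMatrix (Fin n)} (h : DalphaPD α C.1 D.1 = DalphaPD α A.1 B.1) :
    sandwich α C.1 (D.1 ^ ((1 - α) / α)) * A.1.trace.re =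
      sandwich α A.1 (B.1 ^ ((1 - α) / α)) * C.1.trace.re := by
  have hpos : ∀ A B : PDMatrix (Fin n),
      0 < A.1.trace.re⁻¹ * sandwich α A.1 (B.1 ^ ((1 - α) / α)) := fun A B =>
    mul_pos (inv_pos.2 A.2.re_trace_pos) (sandwich_pos A.2 (B.2.rpow _))
  rw [DalphaPD_eq hα C.2 D.2, DalphaPD_eq hα A.2 B.2] at h
  have h2 := Real.log_injOn_pos (hpos C D) (hpos A B)
    (mul_left_cancel₀ (inv_ne_zero (sub_ne_zero.2 hα1)) h)
  rwa [inv_mul_eq_div, inv_mul_eq_div, div_eq_div_iff C.2.re_trace_pos.ne'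
    A.2.re_trace_pos.ne'] at h2

end RenyiPreservers

/-- Bijective preservers of the quantum Rényi divergence `D_α` on the
cone of positive definite operators are scalar multiples of unitary or antiunitary
similarity transformations. -/
theorem stmt3 {n : ℕ} (α : ℝ) (hα : α ∈ Set.Ioo (0:ℝ) 1 ∪ Set.Ioi (1:ℝ))
    (φ : {A : Matrix (Fin n) (Fin n) ℂ // A.PosDef} → {A : Matrix (Fin n) (Fin n) ℂ // A.PosDef})
    (hbij : Function.Bijective φ)
    (hφ : ∀ A B : {A : Matrix (Fin n) (Fin n) ℂ // A.PosDef},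
      DalphaPD α (φ A).1 (φ B).1 = DalphaPD α A.1 B.1) :
    ∃ c : ℝ, 0 < c ∧ ∃ U ∈ Matrix.unitaryGroup (Fin n) ℂ,
      (∀ A : {A : Matrix (Fin n) (Fin n) ℂ // A.PosDef},
        (φ A).1 = (c : ℂ) • (U * A.1 * star U)) ∨
      (∀ A : {A : Matrix (Fin n) (Fin n) ℂ // A.PosDef},
        (φ A).1 = (c : ℂ) • (U * A.1ᵀ * star U)) := by
  have hα0 : 0 < α := hα.elim (fun h => h.1) (fun h => one_pos.trans h)
  have hα1 : α ≠ 1 := hα.elim (fun h => h.2.ne) (fun h => ne_of_gt h)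
  rcases n.eq_zero_or_pos with rfl | hn
  · exact ⟨1, one_pos, 1, one_mem _, Or.inl fun A => Subsingleton.elim _ _⟩
  have : NeZero n := ⟨hn.ne'⟩
  have hσ0 : (1 - α) / α ≠ 0 := div_ne_zero (sub_ne_zero.2 hα1.symm) hα0.ne'
  obtain ⟨c, hc, U, hU, h⟩ := exists_unitaryGroup_of_sandwich_mul_trace (σ := (1 - α) / α) hα0
    (by field_simp; ring) hσ0 (Equiv.ofBijective φ hbij) fun A B =>
      sandwich_mul_trace_of_DalphaPD_eq hα0 hα1 (hφ A B)
  simp_rw [Complex.coe_smul]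
  exact ⟨c, hc, U, hU, h⟩
end
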